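/- Let A ≥ 10^6 be a real number and set ε = 1/log A. Then for all fundamental discriminants D < 0 with |D| ≥ A, with at most one exception, one has L(1, χ_D) ≥ min(1/(7.732·log|D|), 1.5·10^6·ε/|D|^ε), and, setting m = log|D|/log A, the class number satisfies h(D) ≥ min(√|D|/(π·7.732·log|D|), m·1.5·10^6·√|D|/(π·e^m·log|D|)). -/

import Mathlib

open NumberField

/-- `D` is a fundamental discriminant: either `D ≡ 1 (mod 4)` and `D` is squarefree,
or `D = 4m` for a squarefree integer `m ≡ 2` or `3 (mod 4)`. (We exclude the degenerate
case `D = 1`, so that `D` is the discriminant of a quadratic number field.) -/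
def IsFundamentalDiscriminant (D : ℤ) : Prop :=
  D ≠ 1 ∧ ((D % 4 = 1 ∧ Squarefree D) ∨
    ∃ m : ℤ, D = 4 * m ∧ Squarefree m ∧ (m % 4 = 2 ∨ m % 4 = 3))

/-- `χ` is the Kronecker character attached to the fundamental discriminant `D`: the (unique)
Dirichlet character modulo `|D|` with `χ(p) = (D/p)` (Legendre symbol) for every odd prime
`p ∤ D`. -/
def IsKroneckerChar (D : ℤ) (χ : DirichletCharacter ℂ D.natAbs) : Prop :=
  ∀ (p : ℕ) (hp : p.Prime), p ≠ 2 → ¬ ((p : ℤ) ∣ D) →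
    χ (p : ZMod D.natAbs) = ((@legendreSym p ⟨hp⟩ D : ℤ) : ℂ)

/-- The analytically continued Dirichlet L-function, extended by the junk value `0` for
modulus `0`. -/
noncomputable def LFunc {N : ℕ} (χ : DirichletCharacter ℂ N) (s : ℂ) : ℂ :=
  if h : N = 0 then 0 else
    letI : NeZero N := ⟨h⟩
    DirichletCharacter.LFunction χ s

section

open MeasureTheory Filter Topology Set Complex
open scoped NNReal ENNReal NumberTheorySymbols

/-- `f` is bounded on every vertical strip of finite width. -/
def BoundedOnStrips (f : ℂ → ℂ) : Prop :=
  ∀ a b : ℝ, ∃ C, ∀ s : ℂ, a ≤ s.re → s.re ≤ b → ‖f s‖ ≤ C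

namespace BoundedOnStrips

lemma const (c : ℂ) : BoundedOnStrips fun _ ↦ c := fun _ _ ↦ ⟨‖c‖, fun _ _ _ ↦ le_rfl⟩

variable {f g : ℂ → ℂ}

lemma add (hf : BoundedOnStrips f) (hg : BoundedOnStrips g) :
    BoundedOnStrips fun s ↦ f s + g s := fun a b ↦ by
  obtain ⟨C, hC⟩ := hf a b
  obtain ⟨C', hC'⟩ := hg a b
  exact ⟨C + C', fun s h1 h2 ↦ (norm_add_le _ _).trans (add_le_add (hC s h1 h2) (hC' s h1 h2))⟩

lemma sub (hf : BoundedOnStrips f) (hg : BoundedOnStrips g) :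
    BoundedOnStrips fun s ↦ f s - g s := fun a b ↦ by
  obtain ⟨C, hC⟩ := hf a b
  obtain ⟨C', hC'⟩ := hg a b
  exact ⟨C + C', fun s h1 h2 ↦ (norm_sub_le _ _).trans (add_le_add (hC s h1 h2) (hC' s h1 h2))⟩

lemma mul (hf : BoundedOnStrips f) (hg : BoundedOnStrips g) :
    BoundedOnStrips fun s ↦ f s * g s := fun a b ↦ by
  obtain ⟨C, hC⟩ := hf a b
  obtain ⟨C', hC'⟩ := hg a b
  refine ⟨C * C', fun s h1 h2 ↦ ?_⟩
  rw [norm_mul]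
  exact mul_le_mul (hC s h1 h2) (hC' s h1 h2) (norm_nonneg _) ((norm_nonneg _).trans (hC s h1 h2))

lemma sum {ι : Type*} (S : Finset ι) {F : ι → ℂ → ℂ} (hF : ∀ i ∈ S, BoundedOnStrips (F i)) :
    BoundedOnStrips fun s ↦ ∑ i ∈ S, F i s := by
  classical
  induction S using Finset.induction_on with
  | empty => simpa using const 0
  | insert i S hi ih =>
    simp only [Finset.sum_insert hi]
    exact (hF i (by simp)).add (ih fun j hj ↦ hF j (by simp [hj]))

lemma comp_half (hf : BoundedOnStrips f) : BoundedOnStrips fun s ↦ f (s / 2) := fun a b ↦ by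
  obtain ⟨C, hC⟩ := hf (a / 2) (b / 2)
  refine ⟨C, fun s h1 h2 ↦ hC _ ?_ ?_⟩ <;> simp <;> linarith

lemma comp_add_one (hf : BoundedOnStrips f) : BoundedOnStrips fun s ↦ f (s + 1) := fun a b ↦ by
  obtain ⟨C, hC⟩ := hf (a + 1) (b + 1)
  refine ⟨C, fun s h1 h2 ↦ hC _ ?_ ?_⟩ <;> simp <;> linarith

lemma cexp_mul (c : ℝ) : BoundedOnStrips fun s ↦ cexp (c * s) := fun a b ↦ by
  refine ⟨Real.exp (|c| * max |a| |b|), fun s h1 h2 ↦ ?_⟩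
  rw [Complex.norm_exp, Real.exp_le_exp]
  simp only [mul_re, ofReal_re, ofReal_im, zero_mul, sub_zero]
  refine (le_abs_self _).trans ?_
  rw [abs_mul]
  gcongr
  exact abs_le_max_abs_abs h1 h2

lemma natCast_cpow_mul (N : ℕ) [NeZero N] (c : ℝ) :
    BoundedOnStrips fun s ↦ (N : ℂ) ^ (c * s) := by
  have h : (N : ℂ) ≠ 0 := NeZero.ne _
  convert cexp_mul (Real.log N * c) using 2 with s
  rw [cpow_def_of_ne_zero h, ← natCast_log]
  push_cast
  ring_nf

lemma mellin {P : WeakFEPair ℂ} (hP : IsStrongFEPair P) : BoundedOnStrips (mellin P.f) := by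
  intro a b
  have hconv (t : ℝ) : MellinConvergent P.f t :=
    mellinConvergent_of_isBigO_rpow (a := t + 1) (b := t - 1) P.hf_int (hP.hf_top _)
      (by simp) (hP.hf_zero _) (by simp)
  have ha := (hconv a).norm
  have hb := (hconv b).norm
  refine ⟨∫ t in Ioi (0 : ℝ), (‖(t : ℂ) ^ ((a : ℂ) - 1) • P.f t‖ +
    ‖(t : ℂ) ^ ((b : ℂ) - 1) • P.f t‖), fun s h1 h2 ↦ ?_⟩
  refine norm_integral_le_of_norm_le (ha.add hb) ?_
  filter_upwards [ae_restrict_mem measurableSet_Ioi] with t ht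
  have ht' : (0 : ℝ) < t := ht
  simp only [norm_smul, ← add_mul]
  gcongr
  simp only [norm_cpow_eq_rpow_re_of_pos ht', sub_re, ofReal_re, one_re]
  rcases le_total 1 t with h | h
  · exact (Real.rpow_le_rpow_of_exponent_le h (by linarith)).trans
      (le_add_of_nonneg_left (by positivity))
  · exact (Real.rpow_le_rpow_of_exponent_ge ht' h (by linarith)).trans
      (le_add_of_nonneg_right (by positivity))

lemma weakFEPair_Λ₀ (P : WeakFEPair ℂ) : BoundedOnStrips P.Λ₀ :=
  mellin P.isStrongFEPair_toStrongFEPair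

lemma dslope_of_differentiable (hf : Differentiable ℂ f) (hb : BoundedOnStrips f) (c : ℂ) :
    BoundedOnStrips (dslope f c) := fun a b ↦ by
  obtain ⟨C, hC⟩ := hb a b
  have hd : ContinuousOn (dslope f c) (Metric.closedBall c 1) :=
    ((differentiableOn_dslope (s := univ) (by simp)).2 hf.differentiableOn).continuousOn.mono
      (subset_univ _)
  obtain ⟨C', hC'⟩ := (isCompact_closedBall c 1).exists_bound_of_continuousOn hd
  refine ⟨max C' (C + ‖f c‖), fun s h1 h2 ↦ ?_⟩
  by_cases hs : s ∈ Metric.closedBall c 1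
  · exact (hC' s hs).trans (le_max_left _ _)
  · refine le_trans ?_ (le_max_right _ _)
    have h3 : 1 < ‖s - c‖ := by simpa [dist_eq] using hs
    have h4 : s ≠ c := by rintro rfl; norm_num at h3
    rw [dslope_of_ne _ h4, slope_def_field, norm_div]
    refine (div_le_self (norm_nonneg _) h3.le).trans ((norm_sub_le _ _).trans ?_)
    gcongr
    exact hC s h1 h2

lemma completedRiemannZeta₀ : BoundedOnStrips completedRiemannZeta₀ := by
  have := (weakFEPair_Λ₀ (HurwitzZeta.hurwitzEvenFEPair 0)).comp_half.mul (const (1 / 2))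
  intro a b
  obtain ⟨C, hC⟩ := this a b
  refine ⟨C, fun s h1 h2 ↦ ?_⟩
  convert hC s h1 h2 using 2
  simp [_root_.completedRiemannZeta₀, HurwitzZeta.completedHurwitzZetaEven₀]
  ring

lemma completedHurwitzZetaEven₀ (x : UnitAddCircle) :
    BoundedOnStrips (HurwitzZeta.completedHurwitzZetaEven₀ x) := by
  have := (weakFEPair_Λ₀ (HurwitzZeta.hurwitzEvenFEPair x)).comp_half.mul (const (1 / 2))
  intro a b
  obtain ⟨C, hC⟩ := this a b
  refine ⟨C, fun s h1 h2 ↦ ?_⟩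
  convert hC s h1 h2 using 2
  simp [HurwitzZeta.completedHurwitzZetaEven₀]
  ring

lemma completedHurwitzZetaOdd (x : UnitAddCircle) :
    BoundedOnStrips (HurwitzZeta.completedHurwitzZetaOdd x) := by
  have h := HurwitzZeta.isStrong_hurwitzOddFEPair x
  have := (mellin h).comp_half.comp_add_one.mul (const (1 / 2))
  intro a b
  obtain ⟨C, hC⟩ := this a b
  refine ⟨C, fun s h1 h2 ↦ ?_⟩
  convert hC s h1 h2 using 2
  simp only [HurwitzZeta.completedHurwitzZetaOdd, h.Λ_eq]
  ring

lemma completedLFunction {N : ℕ} [NeZero N] {χ : DirichletCharacter ℂ N} (hχ : χ ≠ 1) :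
    BoundedOnStrips χ.completedLFunction := by
  have hN : BoundedOnStrips fun s ↦ (N : ℂ) ^ (-s) := by
    simpa using natCast_cpow_mul N (-1)
  have hz : χ.completedLFunction = ZMod.completedLFunction₀ χ := by
    ext s
    have h0 : χ (0 : ZMod N) = 0 := by
      apply MulChar.map_nonunit
      rw [isUnit_zero_iff]
      intro h
      apply hχ
      have : Subsingleton (ZMod N) := subsingleton_of_zero_eq_one h
      ext u
      have : u = 1 := Units.ext (Subsingleton.elim _ _)
      simp [this]
    rw [DirichletCharacter.completedLFunction, ZMod.completedLFunction_eq,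
      MulChar.sum_eq_zero_of_ne_one hχ, h0]
    simp
  rw [hz]
  unfold ZMod.completedLFunction₀
  exact (hN.mul (sum _ fun j _ ↦ (const _).mul (completedHurwitzZetaEven₀ _))).add
    (hN.mul (sum _ fun j _ ↦ (const _).mul (completedHurwitzZetaOdd _)))

end BoundedOnStrips

section ZetaPole

lemma norm_inv_le_two_of_half_le_norm {z : ℂ} (h : 1 / 2 ≤ ‖z‖) : ‖z⁻¹‖ ≤ 2 := by
  rw [norm_inv]
  calc ‖z‖⁻¹ ≤ (1 / 2 : ℝ)⁻¹ := by gcongr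
    _ = 2 := by norm_num

/-- The product of the completed zeta function with `G`, with the polar part removed. -/
noncomputable def polarFree (G : ℂ → ℂ) (s : ℂ) : ℂ :=
  completedRiemannZeta₀ s * G s - dslope G 0 s + dslope G 1 s

variable {G : ℂ → ℂ}

lemma differentiable_dslope' (hG : Differentiable ℂ G) (c : ℂ) : Differentiable ℂ (dslope G c) :=
  differentiableOn_univ.1
    ((differentiableOn_dslope (s := univ) (by simp)).2 hG.differentiableOn)

lemma differentiable_polarFree (hG : Differentiable ℂ G) : Differentiable ℂ (polarFree G) :=
  ((differentiable_completedZeta₀.mul hG).sub (differentiable_dslope' hG 0)).add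
    (differentiable_dslope' hG 1)

lemma boundedOnStrips_polarFree (hG : Differentiable ℂ G) (hb : BoundedOnStrips G) :
    BoundedOnStrips (polarFree G) :=
  ((BoundedOnStrips.completedRiemannZeta₀.mul hb).sub
    (.dslope_of_differentiable hG hb 0)).add (.dslope_of_differentiable hG hb 1)

lemma polarFree_eq (s : ℂ) (h0 : s ≠ 0) (h1 : s ≠ 1) :
    polarFree G s = completedRiemannZeta s * G s - (G 1 / (s - 1) - G 0 / s) := by
  have h1' : s - 1 ≠ 0 := sub_ne_zero.2 h1
  have h1'' : 1 - s ≠ 0 := sub_ne_zero.2 h1.symm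
  rw [polarFree, completedRiemannZeta_eq, dslope_of_ne _ h0, dslope_of_ne _ h1, slope_def_field,
    slope_def_field]
  field_simp
  ring

end ZetaPole

/-- Half of the jump function: `1` on the positive axis, `1 / 2` at `0`, `0` on the negative
axis. -/
noncomputable def heckeWeight (x : ℝ) : ℝ≥0 := if 0 < x then 1 else if x = 0 then 1 / 2 else 0

lemma measurable_heckeWeight : Measurable heckeWeight := by
  unfold heckeWeight
  exact Measurable.ite measurableSet_Ioi measurable_const
    (Measurable.ite (measurableSet_singleton 0) measurable_const measurable_const)

/-- If `completedRiemannZeta * G` is, on the half plane `1 < re s`, the two-sided Laplace transform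
of a positive measure, and `G` satisfies a functional equation, then `completedRiemannZeta * G` is
everywhere the sum of its polar part and a symmetrised Laplace transform of a positive measure
supported on the nonnegative axis. -/
theorem exists_hecke_measure {G : ℂ → ℂ} (hG : Differentiable ℂ G) (hb : BoundedOnStrips G)
    {W : ℝ} (hW : W = 1 ∨ W = -1) (hfe : ∀ s, G (1 - s) = W * G s)
    {M : Measure ℝ} (hM : ∀ s : ℂ, 1 < s.re → Integrable (fun x : ℝ ↦ cexp (s * x)) M ∧
      ∫ x : ℝ, cexp (s * x) ∂M = completedRiemannZeta s * G s) :
    ∃ M' : Measure ℝ, (∀ᵐ x ∂M', 0 ≤ x) ∧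
      (∀ t : ℝ, Integrable (fun x : ℝ ↦ Real.exp (t * x)) M') ∧
      (∀ s : ℝ, s ≠ 0 → s ≠ 1 → completedRiemannZeta s * G s =
        G 1 * (1 / (s - 1) - W / s) +
          ((∫ x, (Real.exp (s * x) + W * Real.exp ((1 - s) * x)) ∂M' : ℝ) : ℂ)) ∧
      ∀ s : ℝ, 1 < s → ∫ x, Real.exp (s * x) ∂M' ≤ (completedRiemannZeta s * G s).re := by
  set M' : Measure ℝ := M.withDensity (fun x ↦ heckeWeight x) with hM'
  have hw := measurable_heckeWeight
  have hpos : ∀ᵐ x ∂M', 0 ≤ x := by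
    rw [hM', ae_withDensity_iff hw.coe_nnreal_ennreal]
    filter_upwards with x hx
    by_contra! h
    simp [heckeWeight, h.not_gt, h.ne] at hx
  have hw1 (x : ℝ) : heckeWeight x ≤ 1 := by
    unfold heckeWeight
    split_ifs
    · exact le_rfl
    · rw [div_le_one (by norm_num)]; norm_num
    · exact zero_le_one
  have hexpM (t : ℝ) (ht : 1 < t) : Integrable (fun x : ℝ ↦ Real.exp (t * x)) M := by
    have := (hM t (by simpa using ht)).1.norm
    simpa [Complex.norm_exp] using this
  have hexp (t : ℝ) : Integrable (fun x : ℝ ↦ Real.exp (t * x)) M' := by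
    have h2 : Integrable (fun x : ℝ ↦ Real.exp (max t 2 * x)) M' := by
      rw [hM', integrable_withDensity_iff_integrable_smul hw]
      refine (hexpM (max t 2) (by simp)).mono' (by fun_prop) ?_
      filter_upwards with x
      rw [NNReal.smul_def, norm_smul, Real.norm_of_nonneg (Real.exp_pos _).le]
      refine mul_le_of_le_one_left (Real.exp_pos _).le ?_
      simpa using hw1 x
    refine h2.mono' (by fun_prop) ?_
    filter_upwards [hpos] with x hx
    rw [Real.norm_of_nonneg (Real.exp_pos _).le]
    gcongr
    exact le_max_left _ _
  have hcexp (s : ℂ) : Integrable (fun x : ℝ ↦ cexp (s * x)) M' := by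
    refine (hexp s.re).mono' (by fun_prop) ?_
    filter_upwards with x
    simp [Complex.norm_exp]
  set J : ℂ → ℂ := fun s ↦ ∫ x, cexp (s * x) ∂M' with hJ
  have hJd : Differentiable ℂ J := by
    have h := ProbabilityTheory.differentiableOn_complexMGF (X := id) (μ := M')
    have hu : {z : ℂ | z.re ∈ interior (ProbabilityTheory.integrableExpSet id M')} = univ := by
      have : ProbabilityTheory.integrableExpSet id M' = univ := by
        ext t
        simpa [ProbabilityTheory.integrableExpSet] using hexp t
      simp [this]
    rw [hu, differentiableOn_univ] at h
    exact h
  have hJb : BoundedOnStrips J := fun a b ↦ by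
    refine ⟨∫ x, Real.exp (b * x) ∂M', fun s _ hsb ↦ norm_integral_le_of_norm_le (hexp b) ?_⟩
    filter_upwards [hpos] with x hx
    simp only [Complex.norm_exp, mul_re, ofReal_re, ofReal_im, mul_zero, sub_zero]
    gcongr
  have hWW : (W : ℂ) * W = 1 := by rcases hW with rfl | rfl <;> simp
  set E : ℂ → ℂ := fun s ↦ polarFree G s - J s - W * J (1 - s) with hE
  have hEd : Differentiable ℂ E := by
    have := differentiable_polarFree hG
    have h2 : Differentiable ℂ fun s ↦ J (1 - s) := hJd.comp (by fun_prop)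
    fun_prop
  have hG0 : G 0 = W * G 1 := by simpa using hfe 1
  have hEs (s : ℂ) : E (1 - s) = W * E s := by
    have key : ∀ s, s ≠ 0 → s ≠ 1 → polarFree G (1 - s) = W * polarFree G s := by
      intro s h0 h1
      have h0' : 1 - s ≠ 0 := sub_ne_zero.2 h1.symm
      have h1' : 1 - s ≠ 1 := by simpa using h0
      have h2 : s - 1 ≠ 0 := sub_ne_zero.2 h1
      rw [polarFree_eq _ h0 h1, polarFree_eq _ h0' h1', completedRiemannZeta_one_sub, hfe, hG0]
      have h3 : 1 - s - 1 = - s := by ring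
      have h4 : s - 1 = - (1 - s) := by ring
      rw [h3, h4, div_neg, div_neg]
      linear_combination (-G 1 / s) * hWW
    have key' : (fun s ↦ polarFree G (1 - s)) = fun s ↦ W * polarFree G s := by
      have hc := (differentiable_polarFree hG).continuous
      refine Continuous.ext_on (s := ({0, 1} : Set ℂ)ᶜ) ?_ (by fun_prop) (by fun_prop) ?_
      · exact (Set.toFinite {0, 1}).countable.dense_compl ℂ
      · intro s hs
        simp only [mem_compl_iff, mem_insert_iff, mem_singleton_iff, not_or] at hs
        exact key s hs.1 hs.2
    simp only [hE, sub_sub_cancel]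
    rw [congrFun key' s]
    linear_combination (J (1 - s)) * hWW
  have hker (s : ℂ) (hs : 1 < s.re) : J s + W * J (1 - s) =
      ∫ x : ℝ, (heckeWeight x : ℝ) * (cexp (s * x) + W * cexp ((1 - s) * x)) ∂M := by
    rw [hJ, ← integral_const_mul, ← integral_add (hcexp s) ((hcexp _).const_mul _), hM',
      integral_withDensity_eq_integral_smul hw]
    rfl
  have hker' (s : ℂ) (hs : 1 < s.re) : E s = (∫ x : ℝ, (cexp (s * x) -
      (heckeWeight x : ℝ) * (cexp (s * x) + W * cexp ((1 - s) * x))) ∂M) -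
      (G 1 / (s - 1) - G 0 / s) := by
    have h0 : s ≠ 0 := by rintro rfl; simp at hs; linarith
    have h1 : s ≠ 1 := by rintro rfl; simp at hs
    have hi : Integrable (fun x : ℝ ↦
        (heckeWeight x : ℝ) * (cexp (s * x) + W * cexp ((1 - s) * x))) M := by
      have := (hcexp s).add ((hcexp (1 - s)).const_mul W)
      rw [hM', integrable_withDensity_iff_integrable_smul hw] at this
      exact this
    rw [integral_sub (hM s hs).1 hi, (hM s hs).2, ← hker s hs, hE]
    simp only
    rw [polarFree_eq s h0 h1]
    ring
  have hkb (s : ℂ) (hs : 3 / 2 ≤ s.re) (x : ℝ) : ‖cexp (s * x) -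
      (heckeWeight x : ℝ) * (cexp (s * x) + W * cexp ((1 - s) * x))‖ ≤
      Real.exp (3 / 2 * x) := by
    have hWn : ‖(W : ℂ)‖ = 1 := by rcases hW with rfl | rfl <;> simp
    rcases lt_trichotomy x 0 with hx | rfl | hx
    · simp only [heckeWeight, hx.not_gt, hx.ne, if_false, NNReal.coe_zero, ofReal_zero, zero_mul,
        sub_zero, Complex.norm_exp, mul_re, ofReal_re, ofReal_im, mul_zero]
      exact Real.exp_le_exp.2 (mul_le_mul_of_nonpos_right hs hx.le)
    · rcases hW with rfl | rfl <;> simp [heckeWeight]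
      norm_num
    · simp only [heckeWeight, hx, if_true, NNReal.coe_one, ofReal_one, one_mul,
        sub_add_cancel_left, norm_neg, norm_mul, hWn, Complex.norm_exp, mul_re, sub_re, one_re,
        ofReal_re, ofReal_im, mul_zero, sub_zero]
      exact Real.exp_le_exp.2 (mul_le_mul_of_nonneg_right (by linarith) hx.le)
  have hEb : ∃ C, ∀ s : ℂ, 3 / 2 ≤ s.re → ‖E s‖ ≤ C := by
    refine ⟨(∫ x, Real.exp (3 / 2 * x) ∂M) + (‖G 1‖ * 2 + ‖G 0‖ * 2), fun s hs ↦ ?_⟩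
    have e1 : 3 / 2 - 1 ≤ ‖s - 1‖ := by
      have := (le_abs_self _).trans (abs_re_le_norm (s - 1))
      simp at this; linarith
    have e0 : 3 / 2 ≤ ‖s‖ := hs.trans ((le_abs_self _).trans (abs_re_le_norm s))
    rw [hker' s (by linarith)]
    refine (norm_sub_le _ _).trans (add_le_add ?_ ((norm_sub_le _ _).trans (add_le_add ?_ ?_)))
    · exact norm_integral_le_of_norm_le (hexpM _ (by norm_num)) (.of_forall (hkb s hs))
    · rw [div_eq_mul_inv, norm_mul]
      gcongr
      exact norm_inv_le_two_of_half_le_norm (by linarith)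
    · rw [div_eq_mul_inv, norm_mul]
      gcongr
      exact norm_inv_le_two_of_half_le_norm (by linarith)
  have hEconst (s t : ℂ) : E s = E t := by
    refine hEd.apply_eq_apply_of_bounded ?_ s t
    obtain ⟨C1, hC1⟩ := hEb
    have hEstrip : BoundedOnStrips E := by
      have h3 : BoundedOnStrips fun s ↦ J (1 - s) := fun a b ↦ by
        obtain ⟨C, hC⟩ := hJb (1 - b) (1 - a)
        refine ⟨C, fun s h1 h2 ↦ hC _ ?_ ?_⟩ <;> simp <;> linarith
      exact ((boundedOnStrips_polarFree hG hb).sub hJb).sub ((BoundedOnStrips.const _).mul h3)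
    obtain ⟨C2, hC2⟩ := hEstrip (-1 / 2) (3 / 2)
    rw [isBounded_iff_forall_norm_le]
    refine ⟨max C1 C2, ?_⟩
    rintro _ ⟨s, rfl⟩
    rcases le_total (3 / 2) s.re with h | h
    · exact (hC1 s h).trans (le_max_left _ _)
    rcases le_total (-1 / 2) s.re with h' | h'
    · exact (hC2 s h' h).trans (le_max_right _ _)
    · have h4 : ‖E s‖ = ‖E (1 - s)‖ := by
        rw [hEs]
        rcases hW with rfl | rfl <;> simp
      rw [h4]
      exact (hC1 _ (by simp; linarith)).trans (le_max_left _ _)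
  have hE0 (s : ℂ) : E s = 0 := by
    rcases hW with rfl | rfl
    · have hlim : Tendsto (fun n : ℕ ↦ E ((n + 2 : ℝ) : ℂ)) atTop (𝓝 0) := by
        have hn (n : ℕ) : (1 : ℝ) < ((n + 2 : ℝ) : ℂ).re := by
          simp only [ofReal_re]; linarith [(Nat.cast_nonneg n : (0 : ℝ) ≤ n)]
        have hcast : Tendsto (fun n : ℕ ↦ ((n : ℝ) : ℂ)) atTop (Bornology.cobounded ℂ) := by
          rw [← tendsto_norm_atTop_iff_cobounded]
          simpa using tendsto_natCast_atTop_atTop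
        have hpole (c d : ℂ) : Tendsto (fun n : ℕ ↦ c / (((n : ℝ) : ℂ) + d)) atTop (𝓝 0) := by
          have h := (tendsto_inv₀_cobounded.comp
            (tendsto_add_const_cobounded d |>.comp hcast)).const_mul c
          simpa [div_eq_mul_inv, Function.comp_def] using h
        have hint : Tendsto (fun n : ℕ ↦ ∫ x : ℝ, (cexp (((n + 2 : ℝ) : ℂ) * x) -
            (heckeWeight x : ℝ) * (cexp (((n + 2 : ℝ) : ℂ) * x) +
              (1 : ℝ) * cexp ((1 - ((n + 2 : ℝ) : ℂ)) * x))) ∂M) atTop (𝓝 (∫ x : ℝ, 0 ∂M)) := by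
          refine tendsto_integral_of_dominated_convergence (fun x ↦ Real.exp (3 / 2 * x))
            (fun n ↦ ?_) (hexpM _ (by norm_num)) (fun n ↦ .of_forall (hkb _ ?_)) ?_
          · have : Measurable fun x ↦ ((heckeWeight x : ℝ) : ℂ) :=
              Complex.measurable_ofReal.comp hw.coe_nnreal_real
            exact (by fun_prop : Measurable _).aestronglyMeasurable
          · simp only [ofReal_re]; linarith [(Nat.cast_nonneg n : (0 : ℝ) ≤ n)]
          · filter_upwards with x
            have hreal (c : ℝ) (d : ℝ) (hc : c < 0) :
                Tendsto (fun n : ℕ ↦ cexp (((n * c + d : ℝ) : ℂ))) atTop (𝓝 0) := by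
              have : Tendsto (fun n : ℕ ↦ (n : ℝ) * c + d) atTop atBot :=
                tendsto_atBot_add_const_right _ _
                  (tendsto_natCast_atTop_atTop.atTop_mul_const_of_neg hc)
              have := (Complex.continuous_ofReal.tendsto _).comp
                (Real.tendsto_exp_atBot.comp this)
              simpa [Function.comp_def] using this
            rcases lt_trichotomy x 0 with hx | rfl | hx
            · simp only [heckeWeight, hx.not_gt, hx.ne, if_false, NNReal.coe_zero, ofReal_zero,
                zero_mul, sub_zero]
              convert hreal x (2 * x) hx using 3 with n
              push_cast; ring
            · simp [heckeWeight]
              norm_num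
            · simp only [heckeWeight, hx, if_true, NNReal.coe_one, ofReal_one, one_mul,
                sub_add_cancel_left]
              have := (hreal (-x) (-x) (by linarith)).neg
              rw [neg_zero] at this
              refine this.congr fun n ↦ ?_
              push_cast
              ring_nf
        have := hint.sub ((hpole (G 1) 1).sub (hpole (G 0) 2))
        rw [integral_zero, sub_zero, sub_zero] at this
        convert this using 2 with n
        rw [hker' _ (hn n)]
        push_cast
        ring_nf
      have h2 : (fun n : ℕ ↦ E ((n + 2 : ℝ) : ℂ)) = fun _ ↦ E s := by
        ext n; exact hEconst _ _
      rw [h2] at hlim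
      exact tendsto_nhds_unique tendsto_const_nhds hlim
    · have := hEs s
      rw [hEconst (1 - s) s] at this
      push_cast at this
      linear_combination this / 2
  refine ⟨M', hpos, hexp, fun s h0 h1 ↦ ?_, fun s hs ↦ ?_⟩
  · have h := hE0 s
    have hs0 : (s : ℂ) ≠ 0 := by exact_mod_cast h0
    have hs1 : (s : ℂ) ≠ 1 := by exact_mod_cast h1
    simp only [hE] at h
    rw [polarFree_eq _ hs0 hs1, hG0] at h
    have hJs : ((∫ x, (Real.exp (s * x) + W * Real.exp ((1 - s) * x)) ∂M' : ℝ) : ℂ) =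
        J s + W * J (1 - s) := by
      rw [hJ, ← integral_const_mul, ← integral_add (hcexp s) ((hcexp _).const_mul _),
        ← integral_complex_ofReal]
      simp
    rw [hJs]
    linear_combination h
  · have hs' : (1 : ℝ) < (s : ℂ).re := by simpa using hs
    have h := (hM s hs').2
    have h2 : ∫ x : ℝ, cexp (s * x) ∂M = ((∫ x : ℝ, Real.exp (s * x) ∂M : ℝ) : ℂ) := by
      rw [← integral_complex_ofReal]
      simp
    rw [← h, h2, ofReal_re, hM', integral_withDensity_eq_integral_smul hw]
    have h3 := hexp s
    rw [hM', integrable_withDensity_iff_integrable_smul hw] at h3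
    refine integral_mono h3 (hexpM s hs) fun x ↦ ?_
    simp only [NNReal.smul_def, smul_eq_mul]
    exact mul_le_of_le_one_left (Real.exp_pos _).le (by simpa using hw1 x)

section Kernel

/-- The symmetrised exponential kernel `exp (s x) + W exp ((1 - s) x)`. -/
noncomputable def heckeKernel (W s x : ℝ) : ℝ := Real.exp (s * x) + W * Real.exp ((1 - s) * x)

variable {W s t x : ℝ}

lemma heckeKernel_nonneg (hW : W = 1 ∨ W = -1) (hs : 1 / 2 ≤ s) (hx : 0 ≤ x) :
    0 ≤ heckeKernel W s x := by
  unfold heckeKernel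
  rcases hW with rfl | rfl
  · positivity
  · have : Real.exp ((1 - s) * x) ≤ Real.exp (s * x) := by gcongr; linarith
    linarith

lemma heckeKernel_le_two_mul_exp (hW : W = 1 ∨ W = -1) (hs : 1 / 2 ≤ s) (hx : 0 ≤ x) :
    heckeKernel W s x ≤ 2 * Real.exp (s * x) := by
  unfold heckeKernel
  have : Real.exp ((1 - s) * x) ≤ Real.exp (s * x) := by gcongr; linarith
  have := Real.exp_pos ((1 - s) * x)
  rcases hW with rfl | rfl <;> linarith

lemma heckeKernel_mono (hW : W = 1 ∨ W = -1) (hs : 1 / 2 ≤ s) (hst : s ≤ t) (hx : 0 ≤ x) :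
    heckeKernel W s x ≤ heckeKernel W t x := by
  unfold heckeKernel
  rcases hW with rfl | rfl
  · have h1 : Real.exp ((1 - t) * x) = Real.exp ((1 - s - t) * x) * Real.exp (s * x) := by
      rw [← Real.exp_add]; ring_nf
    have h2 : Real.exp ((1 - s) * x) = Real.exp ((1 - s - t) * x) * Real.exp (t * x) := by
      rw [← Real.exp_add]; ring_nf
    have h3 : Real.exp ((1 - s - t) * x) ≤ 1 := by
      rw [Real.exp_le_one_iff]
      exact mul_nonpos_of_nonpos_of_nonneg (by linarith) hx
    have h4 : Real.exp (s * x) ≤ Real.exp (t * x) := by gcongr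
    rw [h1, h2]
    nlinarith
  · have h4 : Real.exp (s * x) ≤ Real.exp (t * x) := by gcongr
    have h5 : Real.exp ((1 - t) * x) ≤ Real.exp ((1 - s) * x) := by gcongr
    linarith

lemma mul_one_sub_exp_neg_le {u v y : ℝ} (hu : 0 < u) (huv : u ≤ v) :
    u * (1 - Real.exp (-(v * y))) ≤ v * (1 - Real.exp (-(u * y))) := by
  have hv : 0 < v := hu.trans_le huv
  have h := convexOn_exp.2 (mem_univ (-(v * y))) (mem_univ 0) (by positivity : 0 ≤ u / v)
    (by rw [sub_nonneg, div_le_one hv]; exact huv : 0 ≤ 1 - u / v) (by ring)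
  simp only [smul_eq_mul, mul_zero, add_zero, Real.exp_zero, mul_one] at h
  have h2 : u / v * -(v * y) = -(u * y) := by field_simp
  rw [h2] at h
  have h3 := mul_le_mul_of_nonneg_left h hv.le
  have h4 : v * (u / v * Real.exp (-(v * y)) + (1 - u / v)) = u * Real.exp (-(v * y)) + (v - u) := by
    field_simp
  rw [h4] at h3
  linarith

lemma exp_neg_mul_heckeKernel_le (hW : W = 1 ∨ W = -1) (hs : 1 / 2 < s) (hst : s ≤ t)
    (hx : 0 ≤ x) :
    (if W = 1 then 1 else (2 * s - 1) / (2 * t - 1)) *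
      (Real.exp (-(t - s) * x) * heckeKernel W t x) ≤ heckeKernel W s x := by
  have e1 : Real.exp (-(t - s) * x) * Real.exp (t * x) = Real.exp (s * x) := by
    rw [← Real.exp_add]; ring_nf
  unfold heckeKernel
  rcases hW with rfl | rfl
  · simp only [if_true, one_mul, mul_add, e1]
    rw [← Real.exp_add]
    gcongr
    nlinarith
  · have hne : ¬ ((-1 : ℝ) = 1) := by norm_num
    have h := mul_one_sub_exp_neg_le (u := 2 * s - 1) (v := 2 * t - 1) (y := x) (by linarith)
      (by linarith)
    have hv : 0 < 2 * t - 1 := by linarith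
    rw [if_neg hne, div_mul_eq_mul_div, div_le_iff₀ hv]
    have e2 : Real.exp (-(t - s) * x) * (Real.exp (t * x) + -1 * Real.exp ((1 - t) * x)) =
        Real.exp (s * x) * (1 - Real.exp (-((2 * t - 1) * x))) := by
      rw [mul_add, e1, mul_sub, ← Real.exp_add, mul_one, mul_left_comm, ← Real.exp_add]
      ring_nf
    have e3 : Real.exp (s * x) + -1 * Real.exp ((1 - s) * x) =
        Real.exp (s * x) * (1 - Real.exp (-((2 * s - 1) * x))) := by
      rw [mul_sub, ← Real.exp_add, mul_one]
      ring_nf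
    rw [e2, e3]
    have := mul_le_mul_of_nonneg_left h (Real.exp_pos (s * x)).le
    linarith

/-- The tangent line inequality for `y ↦ y ^ (-δ / η)` at `y = T ^ η`, evaluated at
`exp (η x)`. -/
lemma tangent_le_exp_neg {δ η T : ℝ} (hδ : 0 ≤ δ) (hη : 0 < η) (hT : 0 < T) (x : ℝ) :
    T ^ (-δ) * (1 + δ / η) - δ / η * T ^ (-δ - η) * Real.exp (η * x) ≤ Real.exp (-δ * x) := by
  set y := x - Real.log T with hy
  have h1 : T ^ (-δ) = Real.exp (-δ * Real.log T) := by
    rw [Real.rpow_def_of_pos hT]; ring_nf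
  have h2 : T ^ (-δ - η) = Real.exp (-δ * Real.log T) * Real.exp (-η * Real.log T) := by
    rw [Real.rpow_def_of_pos hT, ← Real.exp_add]; ring_nf
  have h3 : Real.exp (-δ * x) = Real.exp (-δ * Real.log T) * Real.exp (-δ * y) := by
    rw [← Real.exp_add, hy]; ring_nf
  have h4 : Real.exp (-η * Real.log T) * Real.exp (η * x) = Real.exp (η * y) := by
    rw [← Real.exp_add, hy]; ring_nf
  have h5 : 1 + δ / η - δ / η * Real.exp (η * y) ≤ Real.exp (-δ * y) := by
    have h6 := Real.add_one_le_exp (-δ * y)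
    have h7 := Real.add_one_le_exp (η * y)
    have h8 := mul_le_mul_of_nonneg_left h7 (by positivity : 0 ≤ δ / η)
    have h9 : δ / η * (η * y + 1) = δ * y + δ / η := by field_simp
    linarith
  rw [h1, h2, h3]
  calc _ = Real.exp (-δ * Real.log T) *
        (1 + δ / η - δ / η * (Real.exp (-η * Real.log T) * Real.exp (η * x))) := by ring
    _ ≤ _ := by
      rw [h4]
      exact mul_le_mul_of_nonneg_left h5 (Real.exp_pos _).le

end Kernel

/-- `f` is, off its poles `0` and `1`, the sum of a polar part with residue `κ` at `1` and a
symmetrised Laplace transform of a positive measure on the nonnegative axis which is dominated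
by `f` on `1 < s`. -/
structure IsHeckeFunction (f : ℝ → ℝ) (κ : ℝ) (W : ℝ) (M : Measure ℝ) : Prop where
  sign : W = 1 ∨ W = -1
  ae_nonneg : ∀ᵐ x ∂M, 0 ≤ x
  integrable_exp : ∀ t : ℝ, Integrable (fun x : ℝ ↦ Real.exp (t * x)) M
  eq_add : ∀ s : ℝ, s ≠ 0 → s ≠ 1 →
    f s = κ * (1 / (s - 1) - W / s) + ∫ x, heckeKernel W s x ∂M
  integral_exp_le : ∀ s : ℝ, 1 < s → ∫ x, Real.exp (s * x) ∂M ≤ f s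

namespace IsHeckeFunction

variable {f : ℝ → ℝ} {κ W : ℝ} {M : Measure ℝ} (hf : IsHeckeFunction f κ W M)
include hf

lemma integrable (s : ℝ) : Integrable (heckeKernel W s) M :=
  (hf.integrable_exp s).add ((hf.integrable_exp (1 - s)).const_mul W)

lemma integral_nonneg {s : ℝ} (hs : 1 / 2 ≤ s) : 0 ≤ ∫ x, heckeKernel W s x ∂M := by
  refine integral_nonneg_of_ae ?_
  filter_upwards [hf.ae_nonneg] with x hx using heckeKernel_nonneg hf.sign hs hx

lemma integral_mono {s t : ℝ} (hs : 1 / 2 ≤ s) (hst : s ≤ t) :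
    ∫ x, heckeKernel W s x ∂M ≤ ∫ x, heckeKernel W t x ∂M := by
  refine integral_mono_ae (hf.integrable s) (hf.integrable t) ?_
  filter_upwards [hf.ae_nonneg] with x hx using heckeKernel_mono hf.sign hs hst hx

lemma nonneg {s : ℝ} (hs : 1 < s) : 0 ≤ f s :=
  (integral_nonneg_of_ae (.of_forall fun _ ↦ (Real.exp_pos _).le)).trans (hf.integral_exp_le s hs)

lemma pole_le {s : ℝ} (hs : 1 < s) : 1 / (s - 1) - W / s ≤ (2 * s - 1) / (s * (s - 1)) := by
  have h1 : 0 < s - 1 := by linarith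
  have h0 : 0 < s := by linarith
  have : 1 / (s - 1) - W / s = (s - W * (s - 1)) / (s * (s - 1)) := by field_simp
  rw [this, div_le_div_iff_of_pos_right (by positivity)]
  rcases hf.sign with rfl | rfl <;> linarith

lemma le_pole {s : ℝ} (hs : 1 < s) : 1 / (s * (s - 1)) ≤ 1 / (s - 1) - W / s := by
  have h1 : 0 < s - 1 := by linarith
  have h0 : 0 < s := by linarith
  have : 1 / (s - 1) - W / s = (s - W * (s - 1)) / (s * (s - 1)) := by field_simp
  rw [this, div_le_div_iff_of_pos_right (by positivity)]
  rcases hf.sign with rfl | rfl <;> linarith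

lemma residue_nonneg : 0 ≤ κ := by
  by_contra! hκ
  set C := ∫ x, heckeKernel W 2 x ∂M with hC
  have hC0 : 0 ≤ C := hf.integral_nonneg (by norm_num)
  set u : ℝ := min 1 (-κ / (4 * (C + 1))) with hu
  have hu0 : 0 < u := by
    refine lt_min one_pos (div_pos (by linarith) (by linarith))
  have hu1 : u ≤ 1 := min_le_left _ _
  have hu2 : u * (4 * (C + 1)) ≤ -κ := by
    rw [← le_div_iff₀ (by linarith)]
    exact min_le_right _ _
  have hs : 1 < 1 + u := by linarith
  have h1 := hf.eq_add (1 + u) (by linarith) (by linarith)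
  have h2 := hf.nonneg hs
  have h3 := hf.integral_mono (s := 1 + u) (t := 2) (by linarith) (by linarith)
  have h4 := hf.le_pole hs
  have h5 := mul_le_mul_of_nonpos_left h4 hκ.le
  have h6 : κ * (1 / ((1 + u) * (1 + u - 1))) ≤ - (2 * (C + 1)) := by
    rw [mul_one_div, div_le_iff₀ (by nlinarith)]
    have : 0 < u * (C + 1) := by positivity
    nlinarith
  linarith

/-- The polar part is a lower bound to the right of `1`. -/
lemma residue_le {s : ℝ} (hs : 1 < s) : κ ≤ s * (s - 1) * f s := by
  have h1 := hf.eq_add s (by linarith) (by linarith)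
  have h2 := hf.integral_nonneg (s := s) (by linarith)
  have h3 := mul_le_mul_of_nonneg_left (hf.le_pole hs) hf.residue_nonneg
  have h4 : 0 < s * (s - 1) := mul_pos (by linarith) (by linarith)
  have h5 : κ * (1 / (s * (s - 1))) ≤ f s := by linarith
  rw [mul_one_div, div_le_iff₀ h4] at h5
  linarith

/-- A real zero close to `1` gives an upper bound for the residue. -/
lemma residue_mul_le_of_zero {s b : ℝ} (hs : 1 < s) (hb : 1 / 2 < b) (hb1 : b < 1)
    (h0 : f b = 0) : κ * (s - b) * (1 / ((s - 1) * (1 - b)) - 2) ≤ f s := by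
  have h1 := hf.eq_add s (by linarith) (by linarith)
  have h2 := hf.eq_add b (by linarith) (by linarith)
  have h3 := hf.integral_mono (s := b) (t := s) hb.le (by linarith)
  have hs1 : 0 < s - 1 := by linarith
  have hb' : 0 < 1 - b := by linarith
  have hb0 : 0 < b := by linarith
  have hs0 : 0 < s := by linarith
  have hsb : 0 < s - b := by linarith
  have hbn : b - 1 ≠ 0 := by linarith
  have hp : (s - b) * (1 / ((s - 1) * (1 - b)) - 2) ≤
      (1 / (s - 1) - W / s) - (1 / (b - 1) - W / b) := by
    have e : (1 / (s - 1) - W / s) - (1 / (b - 1) - W / b) =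
        (s - b) * (1 / ((s - 1) * (1 - b)) + W * (1 / (s * b))) := by
      rw [show b - 1 = -(1 - b) by ring]
      field_simp
      ring
    have h4 : 1 / (s * b) ≤ 2 := by
      rw [div_le_iff₀ (by positivity)]
      nlinarith
    have h5 : 0 < 1 / (s * b) := by positivity
    rw [e]
    refine mul_le_mul_of_nonneg_left ?_ hsb.le
    rcases hf.sign with rfl | rfl <;> linarith
  have := mul_le_mul_of_nonneg_left hp hf.residue_nonneg
  rw [← mul_assoc] at this
  nlinarith

lemma integral_le_of_nonpos {b s T : ℝ} (hb : 1 / 2 < b) (hbs : b ≤ s) (hs1 : 1 < s) (hs3 : s < 3)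
    (hT : 0 < T) (h3 : 2 * f 3 ≤ T ^ (3 - s) * ∫ x, heckeKernel W s x ∂M) :
    (if W = 1 then 1 else (2 * b - 1) / (2 * s - 1)) * (T ^ (-(s - b)) *
      ∫ x, heckeKernel W s x ∂M) ≤ ∫ x, heckeKernel W b x ∂M := by
  set ρ : ℝ := if W = 1 then 1 else (2 * b - 1) / (2 * s - 1) with hρ
  have hρ0 : 0 ≤ ρ := by
    rw [hρ]
    split_ifs
    · exact zero_le_one
    · exact div_nonneg (by linarith) (by linarith)
  set δ := s - b with hδ
  have hδ0 : 0 ≤ δ := sub_nonneg.2 hbs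
  set η := 3 - s with hη
  have hη0 : 0 < η := sub_pos.2 hs3
  set I := ∫ x, heckeKernel W s x ∂M
  set J := ∫ x, Real.exp (3 * x) ∂M
  have hJ : J ≤ f 3 := hf.integral_exp_le 3 (by norm_num)
  have key : ρ * (T ^ (-δ) * (1 + δ / η) * I - δ / η * T ^ (-δ - η) * (2 * J)) ≤
      ∫ x, heckeKernel W b x ∂M := by
    have hint : ρ * (T ^ (-δ) * (1 + δ / η) * I - δ / η * T ^ (-δ - η) * (2 * J)) =
        ∫ x, ρ * (T ^ (-δ) * (1 + δ / η) * heckeKernel W s x -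
          δ / η * T ^ (-δ - η) * (2 * Real.exp (3 * x))) ∂M := by
      rw [integral_const_mul, integral_sub ((hf.integrable s).const_mul _)
        (((hf.integrable_exp 3).const_mul _).const_mul _), integral_const_mul, integral_const_mul,
        integral_const_mul]
    rw [hint]
    refine integral_mono_ae ((((hf.integrable s).const_mul _).sub
      (((hf.integrable_exp 3).const_mul _).const_mul _)).const_mul _) (hf.integrable b) ?_
    filter_upwards [hf.ae_nonneg] with x hx
    refine le_trans (mul_le_mul_of_nonneg_left ?_ hρ0)
      (exp_neg_mul_heckeKernel_le hf.sign hb hbs hx)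
    have hk := heckeKernel_nonneg hf.sign (s := s) (by linarith) hx
    have hk2 := heckeKernel_le_two_mul_exp hf.sign (s := s) (by linarith) hx
    have ht := mul_le_mul_of_nonneg_right (tangent_le_exp_neg hδ0 hη0 hT x) hk
    refine le_trans ?_ ht
    rw [sub_mul]
    have e : 2 * Real.exp (3 * x) = Real.exp (η * x) * (2 * Real.exp (s * x)) := by
      rw [mul_left_comm, ← Real.exp_add, hη]; ring_nf
    rw [e, mul_assoc _ (Real.exp (η * x)) (heckeKernel W s x)]
    gcongr
  refine le_trans (mul_le_mul_of_nonneg_left ?_ hρ0) key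
  have h4 : δ / η * T ^ (-δ - η) * (2 * J) ≤ δ / η * T ^ (-δ) * I := by
    have : T ^ (-δ) = T ^ (-δ - η) * T ^ η := by
      rw [← Real.rpow_add hT]; ring_nf
    rw [this, mul_assoc, mul_assoc, mul_assoc]
    refine mul_le_mul_of_nonneg_left (mul_le_mul_of_nonneg_left ?_ ?_) ?_
    · linarith
    · positivity
    · positivity
  linarith

/-- A nonpositive value between `1 / 2` and `1` gives a lower bound for the residue. -/
lemma le_residue_of_nonpos {b s T τ : ℝ} (hb : 1 / 2 < b) (hb1 : b < 1) (hs1 : 1 < s) (hs3 : s < 3)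
    (hT : 0 < T) (h0 : f b ≤ 0) (h3 : 2 * f 3 ≤ T ^ (3 - s) * ((1 - τ) * f s)) :
    τ * (s * (s - 1)) * f s ≤ κ * (2 * s - 1) ∨
      (1 - τ) * (b * (1 - b)) * T ^ (-(s - b)) * f s ≤ κ * (2 * s - 1) := by
  have hs := hf.eq_add s (by linarith) (by linarith)
  have hbb := hf.eq_add b (by linarith) (by linarith)
  have hκ := hf.residue_nonneg
  have hp : 0 < s * (s - 1) := mul_pos (by linarith) (by linarith)
  have hq : 0 < b * (1 - b) := mul_pos (by linarith) (by linarith)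
  have h2s : 0 < 2 * s - 1 := by linarith
  have h2b : 0 < 2 * b - 1 := by linarith
  rcases le_total (τ * f s) (κ * (1 / (s - 1) - W / s)) with h | h
  · left
    have := h.trans (mul_le_mul_of_nonneg_left (hf.pole_le hs1) hκ)
    rw [← mul_div_assoc, le_div_iff₀ hp] at this
    linarith
  · right
    have hI : (1 - τ) * f s ≤ ∫ x, heckeKernel W s x ∂M := by linarith
    have hTp : 0 < T ^ (3 - s) := Real.rpow_pos_of_pos hT _
    have key := hf.integral_le_of_nonpos hb (by linarith) hs1 hs3 hT
      (h3.trans (mul_le_mul_of_nonneg_left hI hTp.le))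
    set Ib := ∫ x, heckeKernel W b x ∂M
    set Is := ∫ x, heckeKernel W s x ∂M
    have hTd : 0 < T ^ (-(s - b)) := Real.rpow_pos_of_pos hT _
    have h5 : T ^ (-(s - b)) * ((1 - τ) * f s) ≤ T ^ (-(s - b)) * Is := by gcongr
    have h6 : Ib ≤ κ * (1 / (1 - b) + W / b) := by
      have : 1 / (b - 1) = -(1 / (1 - b)) := by rw [← neg_sub, div_neg]
      rw [this] at hbb
      linarith
    have h7 : T ^ (-(s - b)) * Is * (b * (1 - b)) ≤ κ * (2 * s - 1) := by
      have h8 := key.trans h6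
      have hb0 : b ≠ 0 := by linarith
      have hb1' : 1 - b ≠ 0 := by linarith
      rcases hf.sign with rfl | rfl
      · have e : κ * (1 / (1 - b) + 1 / b) = κ / (b * (1 - b)) := by
          field_simp; ring
        rw [e, if_pos rfl, one_mul, le_div_iff₀ hq] at h8
        refine h8.trans (le_mul_of_one_le_right hκ (by linarith))
      · have e : κ * (1 / (1 - b) + -1 / b) = κ * (2 * b - 1) / (b * (1 - b)) := by
          field_simp; ring
        rw [e, if_neg (by norm_num), le_div_iff₀ hq, div_mul_eq_mul_div, div_mul_eq_mul_div,
          div_le_iff₀ h2s] at h8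
        have h9 : (2 * b - 1) * (T ^ (-(s - b)) * Is * (b * (1 - b))) ≤
            (2 * b - 1) * (κ * (2 * s - 1)) := by linarith
        exact le_of_mul_le_mul_left h9 h2b
    have h10 := mul_le_mul_of_nonneg_right h5 hq.le
    linarith

/-- If the residue is positive then the function is negative just to the left of `1`. -/
lemma exists_neg (hκ : 0 < κ) {a : ℝ} (ha : 1 / 2 < a) (ha1 : a < 1) :
    ∃ b, a < b ∧ b < 1 ∧ f b < 0 := by
  set C := ∫ x, heckeKernel W 1 x ∂M with hC
  have hC0 : 0 ≤ C := hf.integral_nonneg (by norm_num)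
  set u : ℝ := min ((1 - a) / 2) (κ / (C + 4 * κ + 1)) with hu
  have hu0 : 0 < u := lt_min (by linarith) (by positivity)
  have hu1 : u ≤ (1 - a) / 2 := min_le_left _ _
  have hu2 : u * (C + 4 * κ + 1) ≤ κ := by
    rw [← le_div_iff₀ (by positivity)]
    exact min_le_right _ _
  refine ⟨1 - u, by linarith, by linarith, ?_⟩
  have h1 := hf.eq_add (1 - u) (by linarith) (by linarith)
  have h3 := hf.integral_mono (s := 1 - u) (t := 1) (by linarith) (by linarith)
  have h5 : - W / (1 - u) ≤ 2 := by
    rw [div_le_iff₀ (by linarith)]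
    rcases hf.sign with rfl | rfl <;> linarith
  have h6 : C + 4 * κ + 1 ≤ κ * (1 / u) := by
    rw [mul_one_div, le_div_iff₀ hu0]; linarith
  have h7 : 1 / (1 - u - 1) = -(1 / u) := by
    rw [show 1 - u - 1 = -u by ring, div_neg]
  have h8 := mul_le_mul_of_nonneg_left h5 hκ.le
  rw [h1, h7]
  have : κ * (-(1 / u) - W / (1 - u)) = - (κ * (1 / u)) + κ * (-W / (1 - u)) := by ring
  rw [this]
  linarith

lemma exists_zero (hκ : 0 < κ) {a : ℝ} (ha : 1 / 2 < a) (ha1 : a < 1) (hpos : 0 < f a)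
    (hc : ContinuousOn f (Ioo (1 / 2) 1)) : ∃ b, a < b ∧ b < 1 ∧ f b = 0 := by
  obtain ⟨c, hac, hc1, hneg⟩ := hf.exists_neg hκ ha ha1
  have hsub : Icc a c ⊆ Ioo (1 / 2) 1 := fun x hx ↦ ⟨ha.trans_le hx.1, hx.2.trans_lt hc1⟩
  obtain ⟨b, hb, hb0⟩ := intermediate_value_Icc' hac.le (hc.mono hsub) ⟨hneg.le, hpos.le⟩
  refine ⟨b, lt_of_le_of_ne hb.1 ?_, hb.2.trans_lt hc1, hb0⟩
  rintro rfl
  exact hpos.ne' hb0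

end IsHeckeFunction

/-- The real form of `exists_hecke_measure`. -/
theorem exists_isHeckeFunction {G : ℂ → ℂ} (hG : Differentiable ℂ G) (hb : BoundedOnStrips G)
    {W : ℝ} (hW : W = 1 ∨ W = -1) (hfe : ∀ s, G (1 - s) = W * G s)
    {M : Measure ℝ} (hM : ∀ s : ℂ, 1 < s.re → Integrable (fun x : ℝ ↦ cexp (s * x)) M ∧
      ∫ x : ℝ, cexp (s * x) ∂M = completedRiemannZeta s * G s) :
    (∃ M', IsHeckeFunction (fun s ↦ (completedRiemannZeta s * G s).re) (G 1).re W M') ∧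
      ∀ s : ℝ, s ≠ 0 → s ≠ 1 → (completedRiemannZeta s * G s).im = 0 := by
  obtain ⟨M', h1, h2, h3, h4⟩ := exists_hecke_measure hG hb hW hfe hM
  have him : (G 1).im = 0 := by
    have e := congrArg Complex.im (h3 2 (by norm_num) (by norm_num))
    have e2 : (completedRiemannZeta (2 : ℝ) * G (2 : ℝ)).im = 0 := by
      rw [← (hM ((2 : ℝ) : ℂ) (by simp)).2]
      have h2 : ∫ x : ℝ, cexp ((2 : ℝ) * x) ∂M = ((∫ x : ℝ, Real.exp (2 * x) ∂M : ℝ) : ℂ) := by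
        rw [← integral_complex_ofReal]
        simp
      rw [h2, ofReal_im]
    rw [e2, add_im, ofReal_im, add_zero] at e
    have e3 : (1 / (((2 : ℝ) : ℂ) - 1) - (W : ℂ) / ((2 : ℝ) : ℂ)) =
        ((1 - W / 2 : ℝ) : ℂ) := by
      push_cast; norm_num
    rw [e3, im_mul_ofReal] at e
    rcases hW with rfl | rfl
    · linarith
    · linarith
  have hre : G 1 = ((G 1).re : ℂ) := by
    apply Complex.ext <;> simp [him]
  have hval (s : ℝ) (h0 : s ≠ 0) (h1 : s ≠ 1) : completedRiemannZeta s * G s =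
      (((G 1).re * (1 / (s - 1) - W / s) + ∫ x, heckeKernel W s x ∂M' : ℝ) : ℂ) := by
    rw [h3 s h0 h1]
    conv_lhs => rw [hre]
    simp only [heckeKernel]
    push_cast
    ring
  refine ⟨⟨M', hW, h1, h2, fun s h0 h1 ↦ ?_, h4⟩, fun s h0 h1 ↦ ?_⟩
  · rw [hval s h0 h1, ofReal_re]
  · rw [hval s h0 h1, ofReal_im]

/-- On the half plane `1 < re s`, the function `f` is the two-sided Laplace transform of a positive
measure. -/
def IsLaplace (f : ℂ → ℂ) : Prop :=
  ∃ M : Measure ℝ, SFinite M ∧ ∀ s : ℂ, 1 < s.re →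
    Integrable (fun x : ℝ ↦ cexp (s * x)) M ∧ ∫ x : ℝ, cexp (s * x) ∂M = f s

namespace IsLaplace

variable {f g : ℂ → ℂ}

lemma congr (hf : IsLaplace f) (h : ∀ s : ℂ, 1 < s.re → f s = g s) : IsLaplace g := by
  obtain ⟨M, h1, h2⟩ := hf
  exact ⟨M, h1, fun s hs ↦ ⟨(h2 s hs).1, (h2 s hs).2.trans (h s hs)⟩⟩

lemma mul (hf : IsLaplace f) (hg : IsLaplace g) : IsLaplace fun s ↦ f s * g s := by
  obtain ⟨M, h1, h2⟩ := hf
  obtain ⟨N, h3, h4⟩ := hg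
  refine ⟨M.conv N, inferInstance, fun s hs ↦ ?_⟩
  have hadd (x y : ℝ) : cexp (s * ((x + y : ℝ) : ℂ)) = cexp (s * x) * cexp (s * y) := by
    rw [← Complex.exp_add]; push_cast; ring_nf
  have hi : Integrable (fun x : ℝ ↦ cexp (s * x)) (M.conv N) := by
    rw [integrable_conv_iff (by fun_prop)]
    simp only [hadd]
    refine ⟨.of_forall fun x ↦ (h4 s hs).1.const_mul _, ?_⟩
    simp only [norm_mul, integral_const_mul]
    exact (h2 s hs).1.norm.mul_const _
  refine ⟨hi, ?_⟩
  rw [integral_conv hi]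
  simp only [hadd, integral_const_mul, integral_mul_const, (h2 s hs).2, (h4 s hs).2]

lemma const_mul_cexp {c : ℝ} (hc : 0 ≤ c) (a : ℝ) : IsLaplace fun s ↦ c * cexp (s * a) := by
  refine ⟨ENNReal.ofReal c • Measure.dirac a, inferInstance, fun s _ ↦ ⟨?_, ?_⟩⟩
  · exact (integrable_dirac (by simp)).smul_measure (by simp)
  · simp [integral_smul_measure, hc]

lemma natCast_cpow_half (N : ℕ) [NeZero N] : IsLaplace fun s ↦ (N : ℂ) ^ (s / 2) := by
  refine (const_mul_cexp zero_le_one (Real.log N / 2)).congr fun s _ ↦ ?_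
  rw [cpow_def_of_ne_zero (NeZero.ne _), ← natCast_log]
  push_cast
  ring_nf

open ComplexOrder in
lemma lseries {a : ℕ → ℂ} (ha : ∀ n, 0 ≤ a n)
    (hs : ∀ s : ℂ, 1 < s.re → LSeriesSummable a s) : IsLaplace (LSeries a) := by
  set c : ℕ → ℝ≥0∞ := fun n ↦ if n = 0 then 0 else ENNReal.ofReal (a n).re with hcdef
  have hc (n : ℕ) : c n ≠ ∞ := by
    simp only [hcdef]; split_ifs <;> simp
  have hterm (s : ℂ) (n : ℕ) :
      (c n).toReal • cexp (s * ((-Real.log n : ℝ) : ℂ)) = LSeries.term a s n := by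
    rcases eq_or_ne n 0 with rfl | hn
    · simp [hcdef]
    · have hn' : (n : ℂ) ≠ 0 := by exact_mod_cast hn
      have h0 := (Complex.nonneg_iff.1 (ha n))
      have hre : ((a n).re : ℂ) = a n := by
        apply Complex.ext <;> simp [← h0.2]
      rw [LSeries.term_of_ne_zero hn, div_eq_mul_inv, ← cpow_neg, cpow_def_of_ne_zero hn',
        ← natCast_log]
      simp only [hcdef, if_neg hn, ENNReal.toReal_ofReal h0.1, Complex.real_smul, hre]
      push_cast
      ring_nf
  have hsum (s : ℂ) (h : 1 < s.re) :
      Summable fun n ↦ (c n).toReal * ‖cexp (s * ((-Real.log n : ℝ) : ℂ))‖ := by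
    have h1 := (hs s h).norm
    refine h1.congr fun n ↦ ?_
    rw [← hterm, norm_smul, Real.norm_of_nonneg ENNReal.toReal_nonneg]
  refine ⟨Measure.sum fun n ↦ c n • Measure.dirac (-Real.log n), inferInstance, fun s h ↦ ⟨?_, ?_⟩⟩
  · exact integrable_sum_dirac hc (hsum s h)
  · rw [integral_sum_dirac_eq_tsum (f := fun x : ℝ ↦ cexp (s * x)) hc (hsum s h), LSeries]
    exact tsum_congr fun n ↦ hterm s n

lemma gamma {c : ℝ} (hc : 0 ≤ c) : IsLaplace fun s ↦ Gamma ((s + c) / 2) := by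
  have hm : Measurable fun t : ℝ ↦ (Real.exp (-t) * t ^ (c / 2 - 1)).toNNReal := by fun_prop
  refine ⟨((volume.restrict (Ioi (0 : ℝ))).withDensity
    fun t ↦ (Real.exp (-t) * t ^ (c / 2 - 1)).toNNReal).map fun t ↦ Real.log t / 2,
    inferInstance, fun s hs ↦ ?_⟩
  have hre : 0 < ((s + c) / 2).re := by
    simp; linarith
  have hG := GammaIntegral_convergent hre
  have hlog : Measurable fun t : ℝ ↦ Real.log t / 2 := by fun_prop
  have hcongr : (fun t : ℝ ↦ ((-t).exp * t ^ ((s + c) / 2 - 1) : ℂ)) =ᵐ[volume.restrict (Ioi 0)]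
      fun t : ℝ ↦ (Real.exp (-t) * t ^ (c / 2 - 1)).toNNReal •
        cexp (s * ((Real.log t / 2 : ℝ) : ℂ)) := by
    filter_upwards [ae_restrict_mem measurableSet_Ioi] with t ht
    have ht' : (0 : ℝ) < t := ht
    have ht0 : (t : ℂ) ≠ 0 := by exact_mod_cast ht'.ne'
    have e1 : cexp (s * ((Real.log t / 2 : ℝ) : ℂ)) = (t : ℂ) ^ (s / 2) := by
      rw [cpow_def_of_ne_zero ht0, ofReal_div, ofReal_log ht'.le, ofReal_ofNat]
      ring_nf
    rw [NNReal.smul_def, Real.coe_toNNReal _ (by positivity), e1, Complex.real_smul, ofReal_mul,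
      ofReal_cpow ht'.le, mul_assoc, ← cpow_add _ _ ht0]
    push_cast
    ring_nf
  constructor
  · rw [integrable_map_measure (by fun_prop) hlog.aemeasurable,
      integrable_withDensity_iff_integrable_smul hm]
    exact hG.congr hcongr
  · rw [integral_map hlog.aemeasurable (by fun_prop), integral_withDensity_eq_integral_smul hm]
    beta_reduce
    rw [Gamma_eq_integral hre, GammaIntegral]
    exact (integral_congr_ae hcongr).symm

lemma gammaℝ_add {c : ℝ} (hc : 0 ≤ c) : IsLaplace fun s ↦ Gammaℝ (s + c) := by
  have hpi : (Real.pi : ℂ) ≠ 0 := by exact_mod_cast Real.pi_ne_zero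
  refine ((const_mul_cexp (Real.rpow_nonneg Real.pi_pos.le (-c / 2))
    (-Real.log Real.pi / 2)).mul (gamma hc)).congr fun s _ ↦ ?_
  rw [Gammaℝ_def, ofReal_cpow Real.pi_pos.le, cpow_def_of_ne_zero hpi, cpow_def_of_ne_zero hpi,
    ← Complex.exp_add]
  push_cast [ofReal_log Real.pi_pos.le]
  ring_nf

lemma gammaFactor {N : ℕ} (χ : DirichletCharacter ℂ N) : IsLaplace χ.gammaFactor := by
  rcases χ.even_or_odd with h | h
  · refine (gammaℝ_add le_rfl).congr fun s _ ↦ ?_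
    simp [h.gammaFactor_def]
  · refine (gammaℝ_add zero_le_one).congr fun s _ ↦ ?_
    simp [h.gammaFactor_def]

end IsLaplace

namespace DirichletCharacter

variable {N : ℕ} [NeZero N] {χ : DirichletCharacter ℂ N}

/-- The completed `L`-function, normalised so that its functional equation is `s ↔ 1 - s` up to a
constant. -/
noncomputable def xi (χ : DirichletCharacter ℂ N) (s : ℂ) : ℂ :=
  (N : ℂ) ^ (s / 2) * χ.completedLFunction s

lemma natCast_cpow_ne_zero (s : ℂ) : (N : ℂ) ^ s ≠ 0 := by
  simp [cpow_eq_zero_iff, NeZero.ne N]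

lemma differentiable_xi (hχ : χ ≠ 1) : Differentiable ℂ χ.xi := fun s ↦ by
  have := differentiable_completedLFunction hχ s
  have hN : (N : ℂ) ≠ 0 := NeZero.ne _
  unfold xi
  fun_prop (disch := simp [hN])

lemma boundedOnStrips_xi (hχ : χ ≠ 1) : BoundedOnStrips χ.xi := by
  have h := (BoundedOnStrips.natCast_cpow_mul N (1 / 2)).mul (.completedLFunction hχ)
  have e : χ.xi = fun s ↦ (N : ℂ) ^ (((1 / 2 : ℝ) : ℂ) * s) * χ.completedLFunction s := by
    ext s
    rw [xi]
    push_cast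
    ring_nf
  rwa [e]

lemma ne_one_of_ne_one (hχ : χ ≠ 1) : N ≠ 1 := by
  rintro rfl
  exact hχ (level_one χ)

lemma xi_eq (hχ : χ ≠ 1) {s : ℂ} (hs : 0 < s.re) :
    χ.xi s = (N : ℂ) ^ (s / 2) * χ.gammaFactor s * χ.LFunction s := by
  have hg : χ.gammaFactor s ≠ 0 := by
    unfold gammaFactor
    split_ifs
    · exact Gammaℝ_ne_zero_of_re_pos hs
    · refine Gammaℝ_ne_zero_of_re_pos ?_
      simp only [add_re, one_re]
      linarith
  rw [xi, LFunction_eq_completed_div_gammaFactor χ s (.inr (ne_one_of_ne_one hχ))]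
  field_simp

lemma xi_ne_zero (hχ : χ ≠ 1) {s : ℂ} (hs : 1 ≤ s.re) : χ.xi s ≠ 0 := by
  have h := LFunction_ne_zero_of_one_le_re χ (s := s) (.inl hχ) hs
  rw [LFunction_eq_completed_div_gammaFactor χ s (.inr (ne_one_of_ne_one hχ))] at h
  exact mul_ne_zero (natCast_cpow_ne_zero _) (div_ne_zero_iff.1 h).1

omit [NeZero N] in
lemma inv_eq_self_of_sq (h2 : χ ^ 2 = 1) : χ⁻¹ = χ := by
  rw [inv_eq_iff_mul_eq_one, ← sq, h2]

lemma exists_xi_one_sub (hp : χ.IsPrimitive) (hχ : χ ≠ 1) (h2 : χ ^ 2 = 1) :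
    ∃ W : ℝ, (W = 1 ∨ W = -1) ∧ ∀ s, χ.xi (1 - s) = W * χ.xi s := by
  have hN : (N : ℂ) ≠ 0 := NeZero.ne _
  have h (s : ℂ) : χ.xi (1 - s) = χ.rootNumber * χ.xi s := by
    rw [xi, xi, hp.completedLFunction_one_sub, inv_eq_self_of_sq h2]
    have : (N : ℂ) ^ ((1 - s) / 2) * (N : ℂ) ^ (s - 1 / 2) = (N : ℂ) ^ (s / 2) := by
      rw [← cpow_add _ _ hN]; ring_nf
    rw [← this]
    ring
  have hsq : χ.rootNumber * χ.rootNumber = 1 := by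
    have e := h (1 - 2)
    rw [h 2, sub_sub_cancel] at e
    have h0 := xi_ne_zero hχ (s := 2) (by simp)
    refine mul_right_cancel₀ h0 ?_
    rw [one_mul, mul_assoc]
    exact e.symm
  rcases mul_self_eq_one_iff.1 hsq with h1 | h1
  · exact ⟨1, .inl rfl, fun s ↦ by rw [h, h1]; simp⟩
  · exact ⟨-1, .inr rfl, fun s ↦ by rw [h, h1]; simp⟩

lemma completedRiemannZeta_eq {s : ℂ} (hs : 0 < s.re) :
    completedRiemannZeta s = Gammaℝ s * riemannZeta s := by
  have h0 : s ≠ 0 := by rintro rfl; simp at hs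
  rw [riemannZeta_def_of_ne_zero h0, mul_div_cancel₀ _ (Gammaℝ_ne_zero_of_re_pos hs)]

omit [NeZero N] in
lemma lseriesSummable_toArithmeticFunction (χ : DirichletCharacter ℂ N) {s : ℂ} (hs : 1 < s.re) :
    LSeriesSummable (toArithmeticFunction (χ ·)) s :=
  LSeriesSummable_of_bounded_of_one_lt_re (m := 1) (fun n hn ↦ by
    simpa [toArithmeticFunction, hn] using norm_le_one χ _) hs

lemma lseries_toArithmeticFunction (χ : DirichletCharacter ℂ N) {s : ℂ} (hs : 1 < s.re) :
    LSeries (toArithmeticFunction (χ ·)) s = χ.LFunction s := by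
  rw [LFunction_eq_LSeries χ hs]
  exact LSeries_congr (fun {n} hn ↦ by simp [toArithmeticFunction, hn]) s

lemma lseriesSummable_zeta {s : ℂ} (hs : 1 < s.re) :
    LSeriesSummable ((ArithmeticFunction.zeta : ArithmeticFunction ℂ) ·) s := by
  simpa using ArithmeticFunction.LSeriesSummable_zeta_iff.2 hs

lemma lseries_zeta {s : ℂ} (hs : 1 < s.re) :
    LSeries ((ArithmeticFunction.zeta : ArithmeticFunction ℂ) ·) s = riemannZeta s := by
  simpa using ArithmeticFunction.LSeries_zeta_eq_riemannZeta hs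

lemma lseries_zetaMul (χ : DirichletCharacter ℂ N) {s : ℂ} (hs : 1 < s.re) :
    LSeries χ.zetaMul s = riemannZeta s * χ.LFunction s := by
  rw [zetaMul, ArithmeticFunction.LSeries_mul' (lseriesSummable_zeta hs)
    (lseriesSummable_toArithmeticFunction χ hs), lseries_zeta hs,
    lseries_toArithmeticFunction χ hs]

/-- For a real primitive character, `Γ_ℝ(s) ζ(s) ξ(s, χ)` is a Hecke function. -/
theorem exists_isHeckeFunction_xi (hp : χ.IsPrimitive) (hχ : χ ≠ 1) (h2 : χ ^ 2 = 1) :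
    ∃ W M, IsHeckeFunction (fun s ↦ (completedRiemannZeta s * χ.xi s).re) (χ.xi 1).re W M ∧
      ∀ s : ℝ, s ≠ 0 → s ≠ 1 → (completedRiemannZeta s * χ.xi s).im = 0 := by
  obtain ⟨W, hW, hfe⟩ := exists_xi_one_sub hp hχ h2
  have hl : IsLaplace fun s ↦ completedRiemannZeta s * χ.xi s := by
    have h := ((IsLaplace.gammaℝ_add le_rfl).mul (IsLaplace.natCast_cpow_half N)).mul
      ((IsLaplace.gammaFactor χ).mul
        (IsLaplace.lseries (zetaMul_nonneg h2) fun s hs ↦ LSeriesSummable_zetaMul χ hs))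
    refine h.congr fun s hs ↦ ?_
    have hs0 : 0 < s.re := by linarith
    rw [completedRiemannZeta_eq hs0, xi_eq hχ hs0, lseries_zetaMul χ hs]
    simp
    ring
  obtain ⟨M, -, hM⟩ := hl
  obtain ⟨⟨M', h3⟩, h4⟩ := exists_isHeckeFunction (differentiable_xi hχ) (boundedOnStrips_xi hχ)
    hW hfe hM
  exact ⟨W, M', h3, h4⟩

end DirichletCharacter

namespace ArithmeticFunction

open ComplexOrder

lemma mul_apply_prime_pow_nonneg {f g : ArithmeticFunction ℂ} {p : ℕ} (hp : p.Prime)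
    (hf : ∀ k, 0 ≤ f (p ^ k)) (hg : ∀ k, 0 ≤ g (p ^ k)) (k : ℕ) : 0 ≤ (f * g) (p ^ k) := by
  rw [mul_apply]
  refine Finset.sum_nonneg fun x hx ↦ ?_
  have hx' := (Nat.mem_divisorsAntidiagonal.1 hx).1
  obtain ⟨i, -, hi⟩ := (Nat.dvd_prime_pow hp).1 (Dvd.intro _ hx')
  obtain ⟨j, -, hj⟩ := (Nat.dvd_prime_pow hp).1 (Dvd.intro_left _ hx')
  rw [hi, hj]
  exact mul_nonneg (hf i) (hg j)

lemma IsMultiplicative.nonneg {f : ArithmeticFunction ℂ} (hf : f.IsMultiplicative)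
    (h : ∀ p : ℕ, p.Prime → ∀ k, 0 ≤ f (p ^ k)) (n : ℕ) : 0 ≤ f n := by
  rcases eq_or_ne n 0 with rfl | hn
  · simp
  · rw [hf.multiplicative_factorization _ hn]
    exact Finset.prod_nonneg fun p hp ↦ h p (Nat.prime_of_mem_primeFactors hp) _

end ArithmeticFunction

namespace DirichletCharacter

section coefficients

open ComplexOrder

variable {N N₁ N₂ N₃ : ℕ}

lemma toArithmeticFunction_apply_prime_pow (χ : DirichletCharacter ℂ N) {p : ℕ} (hp : p.Prime)
    (k : ℕ) : toArithmeticFunction (χ ·) (p ^ k) = χ p ^ k := by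
  simp [toArithmeticFunction, hp.ne_zero]

lemma toArithmeticFunction_mul_apply_prime_pow (χ : DirichletCharacter ℂ N₁)
    (ψ : DirichletCharacter ℂ N₂) {p : ℕ} (hp : p.Prime) (k : ℕ) :
    (toArithmeticFunction (χ ·) * toArithmeticFunction (ψ ·)) (p ^ k) =
      ∑ i ∈ Finset.range (k + 1), χ p ^ i * ψ p ^ (k - i) := by
  rw [ArithmeticFunction.mul_apply, Nat.sum_divisorsAntidiagonal fun i j ↦
    toArithmeticFunction (χ ·) i * toArithmeticFunction (ψ ·) j, Nat.sum_divisors_prime_pow hp]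
  refine Finset.sum_congr rfl fun i hi ↦ ?_
  have hi' : i ≤ k := Nat.lt_succ_iff.1 (Finset.mem_range.1 hi)
  rw [Nat.pow_div hi' hp.pos, toArithmeticFunction_apply_prime_pow χ hp,
    toArithmeticFunction_apply_prime_pow ψ hp]

lemma toArithmeticFunction_mul_apply_prime_pow_nonneg {χ : DirichletCharacter ℂ N₁}
    {ψ : DirichletCharacter ℂ N₂} (hψ : ψ ^ 2 = 1) {p : ℕ} (hp : p.Prime)
    (h : χ p = 1 ∨ χ p = 0 ∧ ψ p = 0) (k : ℕ) :
    0 ≤ (toArithmeticFunction (χ ·) * toArithmeticFunction (ψ ·)) (p ^ k) := by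
  rcases h with h | ⟨h, h'⟩
  · convert zetaMul_prime_pow_nonneg hψ hp k using 1
    rw [toArithmeticFunction_mul_apply_prime_pow _ _ hp, zetaMul,
      ArithmeticFunction.coe_zeta_mul_apply, Nat.sum_divisors_prime_pow hp,
      ← Finset.sum_range_reflect]
    refine Finset.sum_congr rfl fun i hi ↦ ?_
    have hi' : i ≤ k := Nat.lt_succ_iff.1 (Finset.mem_range.1 hi)
    rw [h, one_pow, one_mul, toArithmeticFunction_apply_prime_pow ψ hp]
    congr 1
    omega
  · rw [toArithmeticFunction_mul_apply_prime_pow _ _ hp, h, h']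
    refine Finset.sum_nonneg fun i _ ↦ mul_nonneg ?_ ?_ <;> exact pow_nonneg le_rfl _

/-- The Dirichlet coefficients of `ζ(s) L(s, χ₁) L(s, χ₂) L(s, χ₃)`. -/
noncomputable def biquadraticCoeff (χ₁ : DirichletCharacter ℂ N₁) (χ₂ : DirichletCharacter ℂ N₂)
    (χ₃ : DirichletCharacter ℂ N₃) : ArithmeticFunction ℂ :=
  χ₁.zetaMul * (toArithmeticFunction (χ₂ ·) * toArithmeticFunction (χ₃ ·))

variable {χ₁ : DirichletCharacter ℂ N₁} {χ₂ : DirichletCharacter ℂ N₂}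
  {χ₃ : DirichletCharacter ℂ N₃}

/-- The local condition satisfied by three quadratic characters whose product is trivial. -/
def ProductTrivialAt (χ₁ : DirichletCharacter ℂ N₁) (χ₂ : DirichletCharacter ℂ N₂)
    (χ₃ : DirichletCharacter ℂ N₃) (p : ℕ) : Prop :=
  (χ₁ p = 1 ∨ χ₂ p = 1 ∨ χ₃ p = 1) ∨
    (χ₁ p = 0 ∧ χ₂ p = 0) ∨ (χ₁ p = 0 ∧ χ₃ p = 0) ∨ (χ₂ p = 0 ∧ χ₃ p = 0)

lemma biquadraticCoeff_nonneg (h1 : χ₁ ^ 2 = 1) (h2 : χ₂ ^ 2 = 1) (h3 : χ₃ ^ 2 = 1)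
    (h : ∀ p : ℕ, p.Prime → ProductTrivialAt χ₁ χ₂ χ₃ p) (n : ℕ) :
    0 ≤ biquadraticCoeff χ₁ χ₂ χ₃ n := by
  have hm : (biquadraticCoeff χ₁ χ₂ χ₃).IsMultiplicative :=
    (isMultiplicative_zetaMul χ₁).mul ((isMultiplicative_toArithmeticFunction χ₂).mul
      (isMultiplicative_toArithmeticFunction χ₃))
  refine hm.nonneg (fun p hp k ↦ ?_) n
  have e2 : biquadraticCoeff χ₁ χ₂ χ₃ =
      χ₂.zetaMul * (toArithmeticFunction (χ₁ ·) * toArithmeticFunction (χ₃ ·)) := by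
    simp only [biquadraticCoeff, zetaMul]; ring
  have e3 : biquadraticCoeff χ₁ χ₂ χ₃ =
      χ₃.zetaMul * (toArithmeticFunction (χ₁ ·) * toArithmeticFunction (χ₂ ·)) := by
    simp only [biquadraticCoeff, zetaMul]; ring
  have c1 (h' : χ₂ p = 1 ∨ χ₂ p = 0 ∧ χ₃ p = 0) : 0 ≤ biquadraticCoeff χ₁ χ₂ χ₃ (p ^ k) :=
    ArithmeticFunction.mul_apply_prime_pow_nonneg hp (zetaMul_prime_pow_nonneg h1 hp)
      (toArithmeticFunction_mul_apply_prime_pow_nonneg h3 hp h') k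
  have c2 (h' : χ₁ p = 1 ∨ χ₁ p = 0 ∧ χ₃ p = 0) : 0 ≤ biquadraticCoeff χ₁ χ₂ χ₃ (p ^ k) := by
    rw [e2]
    exact ArithmeticFunction.mul_apply_prime_pow_nonneg hp (zetaMul_prime_pow_nonneg h2 hp)
      (toArithmeticFunction_mul_apply_prime_pow_nonneg h3 hp h') k
  have c3 (h' : χ₁ p = 0 ∧ χ₂ p = 0) : 0 ≤ biquadraticCoeff χ₁ χ₂ χ₃ (p ^ k) := by
    rw [e3]
    exact ArithmeticFunction.mul_apply_prime_pow_nonneg hp (zetaMul_prime_pow_nonneg h3 hp)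
      (toArithmeticFunction_mul_apply_prime_pow_nonneg h2 hp (.inr h')) k
  have c4 (h' : χ₃ p = 1) : 0 ≤ biquadraticCoeff χ₁ χ₂ χ₃ (p ^ k) := by
    rw [biquadraticCoeff, mul_comm (toArithmeticFunction (χ₂ ·))]
    exact ArithmeticFunction.mul_apply_prime_pow_nonneg hp (zetaMul_prime_pow_nonneg h1 hp)
      (toArithmeticFunction_mul_apply_prime_pow_nonneg h2 hp (.inl h')) k
  rcases h p hp with (h | h | h) | h | h | h
  exacts [c2 (.inl h), c1 (.inl h), c4 h, c3 h, c2 (.inr h), c1 (.inr h)]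

variable [NeZero N₁] [NeZero N₂] [NeZero N₃]

omit [NeZero N₁] [NeZero N₂] [NeZero N₃] in
lemma lseriesSummable_biquadraticCoeff {s : ℂ} (hs : 1 < s.re) :
    LSeriesSummable (biquadraticCoeff χ₁ χ₂ χ₃) s :=
  ArithmeticFunction.LSeriesSummable_mul (LSeriesSummable_zetaMul χ₁ hs)
    (ArithmeticFunction.LSeriesSummable_mul (lseriesSummable_toArithmeticFunction χ₂ hs)
      (lseriesSummable_toArithmeticFunction χ₃ hs))

lemma lseries_biquadraticCoeff {s : ℂ} (hs : 1 < s.re) :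
    LSeries (biquadraticCoeff χ₁ χ₂ χ₃) s =
      riemannZeta s * χ₁.LFunction s * (χ₂.LFunction s * χ₃.LFunction s) := by
  have h2 := lseriesSummable_toArithmeticFunction χ₂ hs
  have h3 := lseriesSummable_toArithmeticFunction χ₃ hs
  rw [biquadraticCoeff, ArithmeticFunction.LSeries_mul' (LSeriesSummable_zetaMul χ₁ hs)
    (ArithmeticFunction.LSeriesSummable_mul h2 h3), ArithmeticFunction.LSeries_mul' h2 h3,
    lseries_zetaMul χ₁ hs, lseries_toArithmeticFunction χ₂ hs, lseries_toArithmeticFunction χ₃ hs]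

/-- The completed zeta function of the biquadratic field attached to three real primitive
characters is a Hecke function. -/
theorem exists_isHeckeFunction_xi_mul_xi_mul_xi
    (hp1 : χ₁.IsPrimitive) (hp2 : χ₂.IsPrimitive) (hp3 : χ₃.IsPrimitive)
    (hχ1 : χ₁ ≠ 1) (hχ2 : χ₂ ≠ 1) (hχ3 : χ₃ ≠ 1)
    (h1 : χ₁ ^ 2 = 1) (h2 : χ₂ ^ 2 = 1) (h3 : χ₃ ^ 2 = 1)
    (h : ∀ p : ℕ, p.Prime → ProductTrivialAt χ₁ χ₂ χ₃ p) :
    ∃ W M, IsHeckeFunction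
      (fun s ↦ (completedRiemannZeta s * (χ₁.xi s * χ₂.xi s * χ₃.xi s)).re)
      (χ₁.xi 1 * χ₂.xi 1 * χ₃.xi 1).re W M := by
  obtain ⟨W1, hW1, hfe1⟩ := exists_xi_one_sub hp1 hχ1 h1
  obtain ⟨W2, hW2, hfe2⟩ := exists_xi_one_sub hp2 hχ2 h2
  obtain ⟨W3, hW3, hfe3⟩ := exists_xi_one_sub hp3 hχ3 h3
  have hl : IsLaplace fun s ↦ completedRiemannZeta s * (χ₁.xi s * χ₂.xi s * χ₃.xi s) := by
    have h := ((IsLaplace.gammaℝ_add le_rfl).mul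
      ((((IsLaplace.natCast_cpow_half N₁).mul (IsLaplace.natCast_cpow_half N₂)).mul
        (IsLaplace.natCast_cpow_half N₃)))).mul
      ((((IsLaplace.gammaFactor χ₁).mul (IsLaplace.gammaFactor χ₂)).mul
        (IsLaplace.gammaFactor χ₃)).mul
        (IsLaplace.lseries (biquadraticCoeff_nonneg h1 h2 h3 h) fun s hs ↦
          lseriesSummable_biquadraticCoeff hs))
    refine h.congr fun s hs ↦ ?_
    have hs0 : 0 < s.re := by linarith
    rw [completedRiemannZeta_eq hs0, xi_eq hχ1 hs0, xi_eq hχ2 hs0, xi_eq hχ3 hs0,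
      lseries_biquadraticCoeff hs]
    simp
    ring
  obtain ⟨M, -, hM⟩ := hl
  obtain ⟨⟨M', h4⟩, -⟩ := exists_isHeckeFunction
    (((differentiable_xi hχ1).mul (differentiable_xi hχ2)).mul (differentiable_xi hχ3))
    (((boundedOnStrips_xi hχ1).mul (boundedOnStrips_xi hχ2)).mul (boundedOnStrips_xi hχ3))
    (W := W1 * W2 * W3) (by rcases hW1 with rfl | rfl <;> rcases hW2 with rfl | rfl <;>
      rcases hW3 with rfl | rfl <;> simp)
    (fun s ↦ by
      simp only [Pi.mul_apply]
      rw [hfe1, hfe2, hfe3]; push_cast; ring) hM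
  exact ⟨_, M', h4⟩

end coefficients

end DirichletCharacter

lemma hasSum_re_lseries {a : ℕ → ℂ} (ha : ∀ n, (a n).im = 0) {s : ℝ} (hs0 : s ≠ 0)
    (hs : LSeriesSummable a s) :
    HasSum (fun n : ℕ ↦ (a n).re * (n : ℝ) ^ (-s)) (LSeries a s).re ∧ (LSeries a s).im = 0 := by
  have hterm (n : ℕ) : LSeries.term a s n = (((a n).re * (n : ℝ) ^ (-s) : ℝ) : ℂ) := by
    rcases eq_or_ne n 0 with rfl | hn
    · simp [Real.zero_rpow (neg_ne_zero.2 hs0)]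
    · have hre : a n = ((a n).re : ℂ) := by
        apply Complex.ext <;> simp [ha]
      rw [LSeries.term_of_ne_zero hn, ofReal_mul, ← hre, ofReal_cpow (Nat.cast_nonneg n),
        ofReal_neg, cpow_neg, div_eq_mul_inv, ofReal_natCast]
  have h : HasSum (LSeries.term a s) (LSeries a s) := hs.LSeriesHasSum
  have h1 := Complex.hasSum_re h
  have h2 := Complex.hasSum_im h
  simp only [hterm, ofReal_re, ofReal_im] at h1 h2
  exact ⟨h1, h2.unique hasSum_zero⟩

/-- The Riemann zeta function as a real function. -/
noncomputable def realZeta (s : ℝ) : ℝ := (riemannZeta s).re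

lemma hasSum_realZeta {s : ℝ} (hs : 1 < s) :
    HasSum (fun n : ℕ ↦ (n : ℝ) ^ (-s)) (realZeta s) := by
  have h := hasSum_re_lseries (a := 1) (by simp) (by linarith : s ≠ 0)
    (LSeriesSummable_one_iff.2 (by simpa using hs))
  rw [LSeries_one_eq_riemannZeta (by simpa using hs)] at h
  simpa [realZeta] using h.1

lemma riemannZeta_ofReal {s : ℝ} (hs : 1 < s) : riemannZeta s = realZeta s := by
  have h := hasSum_re_lseries (a := 1) (by simp) (by linarith : s ≠ 0)
    (LSeriesSummable_one_iff.2 (by simpa using hs))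
  rw [LSeries_one_eq_riemannZeta (by simpa using hs)] at h
  apply Complex.ext <;> simp [realZeta, h.2]

lemma realZeta_pos {s : ℝ} (hs : 1 < s) : 0 < realZeta s :=
  lt_of_lt_of_le (by simp) ((hasSum_realZeta hs).summable.le_tsum 1 (fun n _ ↦ by positivity)
    |>.trans_eq (hasSum_realZeta hs).tsum_eq)

lemma realZeta_le {s : ℝ} (hs : 1 < s) : realZeta s ≤ 1 + 1 / (s - 1) := by
  have h := ZetaAsymptotics.zeta_limit_aux1 hs
  have h0 : 0 ≤ ZetaAsymptotics.termTSum s :=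
    tsum_nonneg fun n ↦ ZetaAsymptotics.term_nonneg _ _
  have h1 : ∑' n : ℕ, 1 / ((n : ℝ) + 1) ^ s = realZeta s := by
    have := (hasSum_nat_add_iff' 1).2 (hasSum_realZeta hs)
    have h0 : (0 : ℝ) ^ (-s) = 0 := Real.zero_rpow (by linarith)
    simp only [Finset.sum_range_one, Nat.cast_zero, h0, sub_zero] at this
    rw [← this.tsum_eq]
    refine tsum_congr fun n ↦ ?_
    push_cast
    rw [Real.rpow_neg (by positivity), one_div]
  rw [h1] at h
  nlinarith [mul_nonneg (by linarith : (0 : ℝ) ≤ s) h0]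

lemma log_le_half_sub_inv {x : ℝ} (hx : 1 ≤ x) : Real.log x ≤ (x - x⁻¹) / 2 := by
  rw [← Real.sinh_log (by linarith)]
  exact Real.self_le_sinh_iff.2 (Real.log_nonneg hx)

lemma log_div_sq_le {m : ℝ} (hm : 1 < m) :
    Real.log m / m ^ 2 ≤
      (1 / (m - 1) + Real.log (m - 1) / (m - 1 / 2)) - (1 / m + Real.log m / (m + 1 / 2)) := by
  have h1 : 0 < m - 1 := by linarith
  have h2 : 0 < m - 1 / 2 := by linarith
  have hlog := log_le_half_sub_inv (x := m / (m - 1)) (by rw [le_div_iff₀ h1]; linarith)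
  rw [Real.log_div (by positivity) (by positivity)] at hlog
  have e1 : (m / (m - 1) - (m / (m - 1))⁻¹) / 2 = (m - 1 / 2) / (m * (m - 1)) := by
    field_simp; ring
  rw [e1] at hlog
  have hl : 0 ≤ Real.log m := Real.log_nonneg hm.le
  have e2 : Real.log (m - 1) / (m - 1 / 2) ≥
      Real.log m / (m - 1 / 2) - 1 / (m * (m - 1)) := by
    have : (Real.log m - Real.log (m - 1)) / (m - 1 / 2) ≤ 1 / (m * (m - 1)) := by
      rw [div_le_iff₀ h2]
      rwa [div_mul_eq_mul_div, one_mul]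
    rw [sub_div] at this
    linarith
  have e3 : 1 / (m - 1) - 1 / m = 1 / (m * (m - 1)) := by field_simp; ring
  have e4 : Real.log m / (m - 1 / 2) - Real.log m / (m + 1 / 2) =
      Real.log m / (m ^ 2 - 1 / 4) := by
    have : m ^ 2 - 1 / 4 = (m - 1 / 2) * (m + 1 / 2) := by ring
    rw [this, div_sub_div _ _ h2.ne' (by linarith)]
    ring
  have e5 : Real.log m / m ^ 2 ≤ Real.log m / (m ^ 2 - 1 / 4) := by
    gcongr
    · nlinarith
    · linarith
  linarith

lemma sum_log_div_sq_le {N : ℕ} (hN : 1 ≤ N) :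
    ∑ n ∈ Finset.range (N + 1), Real.log n / (n : ℝ) ^ 2 ≤
      1 - (1 / N + Real.log N / (N + 1 / 2)) := by
  induction N, hN using Nat.le_induction with
  | base => simp [Finset.sum_range_succ]
  | succ n hn ih =>
    rw [Finset.sum_range_succ]
    have h := log_div_sq_le (m := ((n + 1 : ℕ) : ℝ)) (by
      push_cast
      have : (1 : ℝ) ≤ n := by exact_mod_cast hn
      linarith)
    have e : ((n + 1 : ℕ) : ℝ) - 1 = n := by push_cast; ring
    have e' : ((n + 1 : ℕ) : ℝ) - 1 / 2 = n + 1 / 2 := by push_cast; ring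
    rw [e, e'] at h
    linarith

lemma le_realZeta_two_add {t : ℝ} (ht : 0 ≤ t) : Real.pi ^ 2 / 6 - t ≤ realZeta (2 + t) := by
  have h1 := hasSum_zeta_two.tendsto_sum_nat.sub_const t
  have h2 := (hasSum_realZeta (by linarith : 1 < 2 + t)).tendsto_sum_nat
  refine le_of_tendsto_of_tendsto h1 h2 ?_
  filter_upwards [eventually_ge_atTop 2] with N hN
  obtain ⟨M, rfl⟩ : ∃ M, N = M + 1 := ⟨N - 1, by omega⟩
  have h3 := sum_log_div_sq_le (N := M) (by omega)
  have h4 : ∑ n ∈ Finset.range (M + 1), (1 / (n : ℝ) ^ 2 - t * (Real.log n / (n : ℝ) ^ 2)) ≤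
      ∑ n ∈ Finset.range (M + 1), (n : ℝ) ^ (-(2 + t)) := by
    refine Finset.sum_le_sum fun n _ ↦ ?_
    rcases eq_or_ne n 0 with rfl | hn
    · have h0 : (0 : ℝ) ^ (-(2 + t)) = 0 := Real.zero_rpow (by linarith)
      simp only [Nat.cast_zero, h0]
      simp
    · have hn' : (0 : ℝ) < n := by positivity
      have e : (n : ℝ) ^ (-(2 + t)) = Real.exp (-(t * Real.log n)) / (n : ℝ) ^ 2 := by
        rw [neg_add, Real.rpow_add hn', Real.rpow_neg hn'.le, Real.rpow_ofNat,
          Real.rpow_def_of_pos hn']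
        ring_nf
      rw [e, ← mul_div_assoc, ← sub_div]
      gcongr
      linarith [Real.add_one_le_exp (-(t * Real.log n))]
  rw [Finset.sum_sub_distrib, ← Finset.mul_sum] at h4
  have h5 : 0 ≤ 1 / (M : ℝ) + Real.log M / (M + 1 / 2) := by
    have : 0 ≤ Real.log M := Real.log_natCast_nonneg M
    positivity
  nlinarith

namespace DirichletCharacter

open ComplexOrder

variable {N : ℕ} [NeZero N] {χ : DirichletCharacter ℂ N}

/-- The Dirichlet `L`-function as a real function, for real characters. -/
noncomputable def realL (χ : DirichletCharacter ℂ N) (s : ℝ) : ℝ := (χ.LFunction s).re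

omit [NeZero N] in
lemma apply_mem_of_sq (h2 : χ ^ 2 = 1) (x : ZMod N) : χ x = 0 ∨ χ x = 1 ∨ χ x = -1 :=
  MulChar.isQuadratic_iff_sq_eq_one.mpr h2 x

lemma hasSum_realL (h2 : χ ^ 2 = 1) {s : ℝ} (hs : 1 < s) :
    HasSum (fun n : ℕ ↦ (χ n).re * (n : ℝ) ^ (-s)) (χ.realL s) ∧ χ.LFunction s = χ.realL s := by
  have hs' : 1 < (s : ℂ).re := by simpa using hs
  have h := hasSum_re_lseries (a := (χ ·)) (fun n ↦ by
    rcases apply_mem_of_sq h2 n with h | h | h <;> simp [h]) (by linarith : s ≠ 0)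
    (LSeriesSummable_of_bounded_of_one_lt_re (m := 1) (fun n _ ↦ norm_le_one χ _) hs')
  rw [← LFunction_eq_LSeries χ hs'] at h
  exact ⟨h.1, by apply Complex.ext <;> simp [realL, h.2]⟩

lemma realL_le_realZeta (h2 : χ ^ 2 = 1) {s : ℝ} (hs : 1 < s) : χ.realL s ≤ realZeta s := by
  refine hasSum_le (fun n ↦ ?_) (hasSum_realL h2 hs).1 (hasSum_realZeta hs)
  refine mul_le_of_le_one_left (by positivity) ?_
  rcases apply_mem_of_sq h2 n with h | h | h <;> simp [h]

omit [NeZero N] in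
lemma one_le_zetaMul_prime_pow (h2 : χ ^ 2 = 1) {p : ℕ} (hp : p.Prime) (k : ℕ) :
    1 ≤ χ.zetaMul (p ^ (2 * k)) := by
  simp only [zetaMul, ArithmeticFunction.coe_zeta_mul_apply, Nat.sum_divisors_prime_pow hp]
  simp only [toArithmeticFunction_apply_prime_pow χ hp]
  rcases apply_mem_of_sq h2 p with h | h | h
  · simp [h, Finset.sum_range_succ']
  · simp [h]
    exact_mod_cast (by positivity : (0 : ℝ) ≤ 2 * k)
  · rw [h, neg_one_geom_sum, if_neg (by simp)]

omit [NeZero N] in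
lemma one_le_zetaMul_sq (h2 : χ ^ 2 = 1) {n : ℕ} (hn : n ≠ 0) : 1 ≤ χ.zetaMul (n ^ 2) := by
  rw [χ.isMultiplicative_zetaMul.multiplicative_factorization _ (by positivity)]
  refine Finset.prod_induction _ (fun x ↦ 1 ≤ x) (fun a b ha hb ↦ ?_) le_rfl fun p hp ↦ ?_
  · exact one_le_mul_of_one_le_of_one_le ha hb
  · rw [Nat.factorization_pow]
    exact one_le_zetaMul_prime_pow h2 (Nat.prime_of_mem_primeFactors hp) _

lemma realZeta_two_mul_le (h2 : χ ^ 2 = 1) {s : ℝ} (hs : 1 < s) :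
    realZeta (2 * s) ≤ realZeta s * χ.realL s := by
  have hs' : 1 < (s : ℂ).re := by simpa using hs
  have h := (hasSum_re_lseries (a := χ.zetaMul) (fun n ↦
    (Complex.nonneg_iff.1 (zetaMul_nonneg h2 n)).2.symm) (by linarith : s ≠ 0)
    (LSeriesSummable_zetaMul χ hs')).1
  rw [lseries_zetaMul χ hs', (hasSum_realL h2 hs).2, riemannZeta_ofReal hs, ← ofReal_mul,
    ofReal_re] at h
  have hnn (n : ℕ) : 0 ≤ (χ.zetaMul n).re := (Complex.nonneg_iff.1 (zetaMul_nonneg h2 n)).1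
  refine hasSum_le_inj (fun n : ℕ ↦ n ^ 2) (Nat.pow_left_injective two_ne_zero)
    (fun n _ ↦ mul_nonneg (hnn n) (by positivity)) (fun n ↦ ?_)
    (hasSum_realZeta (by linarith : 1 < 2 * s)) h
  rcases eq_or_ne n 0 with rfl | hn
  · simp [Real.zero_rpow (by linarith : -(2 * s) ≠ 0)]
  · have h1 : 1 ≤ (χ.zetaMul (n ^ 2)).re := (Complex.le_def.1 (one_le_zetaMul_sq h2 hn)).1
    have e : ((n ^ 2 : ℕ) : ℝ) ^ (-s) = (n : ℝ) ^ (-(2 * s)) := by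
      push_cast
      rw [← Real.rpow_natCast_mul (by positivity)]
      congr 1
      push_cast; ring
    rw [e]
    exact le_mul_of_one_le_left (by positivity) h1

lemma realL_pos (h2 : χ ^ 2 = 1) {s : ℝ} (hs : 1 < s) : 0 < χ.realL s :=
  pos_of_mul_pos_right ((realZeta_pos (by linarith)).trans_le (realZeta_two_mul_le h2 hs))
    (realZeta_pos hs).le

lemma LFunction_one_eq (h2 : χ ^ 2 = 1) (hχ : χ ≠ 1) :
    χ.LFunction 1 = χ.realL 1 ∧ 0 < χ.realL 1 := by
  have hc : Continuous fun s : ℝ ↦ χ.LFunction s :=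
    (differentiable_LFunction hχ).continuous.comp continuous_ofReal
  have ht : Tendsto (fun s : ℝ ↦ χ.LFunction s) (𝓝[>] 1) (𝓝 (χ.LFunction 1)) := by
    have := (hc.tendsto 1).mono_left (nhdsWithin_le_nhds (s := Ioi (1 : ℝ)))
    simpa using this
  have h1 : 0 ≤ χ.LFunction 1 := by
    refine ge_of_tendsto ht ?_
    filter_upwards [self_mem_nhdsWithin] with s hs
    rw [(hasSum_realL h2 hs).2]
    exact_mod_cast (realL_pos h2 hs).le
  have h3 := Complex.nonneg_iff.1 h1
  have e : χ.LFunction 1 = χ.realL 1 := by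
    apply Complex.ext <;> simp [realL, ← h3.2]
  refine ⟨e, lt_of_le_of_ne (by simpa [realL] using h3.1) fun h ↦ ?_⟩
  exact LFunction_apply_one_ne_zero hχ (by rw [e, ← h, ofReal_zero])

end DirichletCharacter

/-- The real function `π ^ (-s / 2) * Γ(s / 2)`. -/
noncomputable def gammaR (s : ℝ) : ℝ := Real.pi ^ (-s / 2) * Real.Gamma (s / 2)

lemma Gammaℝ_ofReal (s : ℝ) : Gammaℝ s = gammaR s := by
  rw [Gammaℝ_def, gammaR, ofReal_mul, ofReal_cpow Real.pi_pos.le, ← Complex.Gamma_ofReal]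
  push_cast
  rfl

lemma gammaR_pos {s : ℝ} (hs : 0 < s) : 0 < gammaR s :=
  mul_pos (by positivity) (Real.Gamma_pos_of_pos (by linarith))

lemma gammaR_one : gammaR 1 = 1 := by
  have := Gammaℝ_ofReal 1
  rw [ofReal_one, Gammaℝ_one] at this
  exact_mod_cast this.symm

lemma gammaR_two : gammaR 2 = 1 / Real.pi := by
  simp [gammaR, Real.rpow_neg_one]

lemma gammaR_mul_gammaR_add_one (s : ℝ) :
    gammaR s * gammaR (s + 1) = 2 * (2 * Real.pi) ^ (-s) * Real.Gamma s := by
  have h := Gammaℝ_mul_Gammaℝ_add_one s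
  rw [Gammaℂ_def, show (s : ℂ) + 1 = ((s + 1 : ℝ) : ℂ) by push_cast; rfl, Gammaℝ_ofReal,
    Gammaℝ_ofReal, Complex.Gamma_ofReal, show (2 * (Real.pi : ℂ)) = ((2 * Real.pi : ℝ) : ℂ) by
    push_cast; rfl, ← ofReal_neg, ← ofReal_cpow (by positivity)] at h
  exact_mod_cast h

lemma one_sub_mul_le_Gamma {a : ℝ} (ha : 0 ≤ a) : 1 - 2 / 3 * a ≤ Real.Gamma (1 + a) := by
  rcases ha.eq_or_lt with rfl | ha
  · simp
  · have h := Real.convexOn_Gamma.deriv_le_slope (x := 1) (y := 1 + a) (by simp)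
      (by simp only [mem_Ioi]; linarith) (by linarith) Real.hasDerivAt_Gamma_one.differentiableAt
    rw [Real.hasDerivAt_Gamma_one.deriv, slope_def_field, Real.Gamma_one, add_sub_cancel_left,
      le_div_iff₀ ha] at h
    nlinarith [Real.eulerMascheroniConstant_lt_two_thirds]

lemma log_two_mul_pi_le : Real.log (2 * Real.pi) ≤ 1.85 := by
  rw [Real.log_mul two_ne_zero Real.pi_ne_zero]
  have h1 := Real.log_le_sub_one_of_pos (x := Real.pi / Real.exp 1) (by positivity)
  rw [Real.log_div Real.pi_ne_zero (Real.exp_pos 1).ne', Real.log_exp] at h1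
  have h2 : Real.pi / Real.exp 1 ≤ 1.156 := by
    rw [div_le_iff₀ (Real.exp_pos 1)]
    nlinarith [Real.exp_one_gt_d9, Real.pi_lt_d4]
  linarith [Real.log_two_lt_d9]

lemma le_pi_mul_gammaR_mul_gammaR {a : ℝ} (ha : 0 ≤ a) (ha' : a ≤ 1 / 2) :
    (1 - 1.85 * a) * (1 - 2 / 3 * a) ≤ Real.pi * (gammaR (1 + a) * gammaR (1 + a + 1)) := by
  have e : Real.pi * (gammaR (1 + a) * gammaR (1 + a + 1)) =
      (2 * Real.pi) ^ (-a) * Real.Gamma (1 + a) := by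
    rw [gammaR_mul_gammaR_add_one, neg_add, Real.rpow_add (by positivity), Real.rpow_neg_one]
    field_simp
  have h1 : 1 - 1.85 * a ≤ (2 * Real.pi) ^ (-a) := by
    rw [Real.rpow_def_of_pos (by positivity)]
    nlinarith [Real.add_one_le_exp (Real.log (2 * Real.pi) * -a), log_two_mul_pi_le]
  rw [e]
  have := one_sub_mul_le_Gamma ha
  gcongr
  · linarith

lemma gammaR_three_mul_gammaR_four_le : gammaR 3 * gammaR 4 ≤ 0.0163 := by
  have h := gammaR_mul_gammaR_add_one 3
  rw [show (3 : ℝ) + 1 = 4 by norm_num] at h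
  have h3 : Real.Gamma 3 = 2 := by
    rw [show (3 : ℝ) = ((2 : ℕ) : ℝ) + 1 by norm_num, Real.Gamma_nat_eq_factorial]
    simp
  rw [h, h3, Real.rpow_neg (by positivity), show (3 : ℝ) = ((3 : ℕ) : ℝ) by norm_num,
    Real.rpow_natCast, ← div_eq_mul_inv, div_mul_eq_mul_div, div_le_iff₀ (by positivity)]
  have : (3.14 : ℝ) ^ 3 ≤ Real.pi ^ 3 := by
    have := Real.pi_gt_d2
    gcongr
  rw [mul_pow]
  nlinarith

lemma gammaR_one_add_le {a : ℝ} (ha : 0 ≤ a) (ha' : a ≤ 1) : gammaR (1 + a) ≤ 1 := by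
  have h1 : Real.Gamma ((1 + a) / 2) ≤ √Real.pi := by
    have h := Real.convexOn_Gamma.le_max_of_mem_Icc (x := 1 / 2) (y := 1) (z := (1 + a) / 2)
      (by simp) (by simp) ⟨by linarith, by linarith⟩
    rw [Real.Gamma_one_half_eq, Real.Gamma_one] at h
    rwa [max_eq_left (Real.one_le_sqrt.2 (by linarith [Real.pi_gt_three]))] at h
  rw [gammaR, show -(1 + a) / 2 = -(1 / 2) + -(a / 2) by ring, Real.rpow_add Real.pi_pos,
    Real.rpow_neg Real.pi_pos.le, ← Real.sqrt_eq_rpow]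
  have h2 : Real.pi ^ (-(a / 2)) ≤ 1 :=
    Real.rpow_le_one_of_one_le_of_nonpos (by linarith [Real.pi_gt_three]) (by linarith)
  have h3 : 0 < √Real.pi := Real.sqrt_pos.2 Real.pi_pos
  calc (√Real.pi)⁻¹ * Real.pi ^ (-(a / 2)) * Real.Gamma ((1 + a) / 2)
      ≤ (√Real.pi)⁻¹ * 1 * √Real.pi := by gcongr
    _ = 1 := by field_simp

namespace DirichletCharacter

/-- A nontrivial real primitive character. -/
structure IsRealPrimitive {N : ℕ} (χ : DirichletCharacter ℂ N) : Prop where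
  isPrimitive : χ.IsPrimitive
  ne_one : χ ≠ 1
  sq_eq_one : χ ^ 2 = 1

namespace IsRealPrimitive

variable {N : ℕ} [NeZero N] {χ : DirichletCharacter ℂ N} (h : χ.IsRealPrimitive)

include h

lemma realL_one_pos : 0 < χ.realL 1 := (LFunction_one_eq h.sq_eq_one h.ne_one).2

lemma realL_pos {s : ℝ} (hs : 1 < s) : 0 < χ.realL s :=
  DirichletCharacter.realL_pos h.sq_eq_one hs

lemma LFunction_ofReal {s : ℝ} (hs : 1 ≤ s) : χ.LFunction s = χ.realL s := by
  rcases hs.eq_or_lt with rfl | hs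
  · simpa using (LFunction_one_eq h.sq_eq_one h.ne_one).1
  · exact (hasSum_realL h.sq_eq_one hs).2

lemma xi_of_odd (ho : χ.Odd) {s : ℝ} (hs : 1 ≤ s) :
    χ.xi s = ((N : ℝ) ^ (s / 2) * gammaR (s + 1) * χ.realL s : ℝ) := by
  rw [xi_eq h.ne_one (by simp; linarith), ho.gammaFactor_def, h.LFunction_ofReal hs,
    show (s : ℂ) + 1 = ((s + 1 : ℝ) : ℂ) by push_cast; rfl, Gammaℝ_ofReal]
  push_cast
  rw [ofReal_cpow (Nat.cast_nonneg _)]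
  push_cast
  rfl

lemma xi_of_even (he : χ.Even) {s : ℝ} (hs : 1 ≤ s) :
    χ.xi s = ((N : ℝ) ^ (s / 2) * gammaR s * χ.realL s : ℝ) := by
  rw [xi_eq h.ne_one (by simp; linarith), he.gammaFactor_def, h.LFunction_ofReal hs, Gammaℝ_ofReal]
  push_cast
  rw [ofReal_cpow (Nat.cast_nonneg _)]
  push_cast
  rfl

end IsRealPrimitive

lemma completedRiemannZeta_ofReal {s : ℝ} (hs : 1 < s) :
    completedRiemannZeta s = (gammaR s * realZeta s : ℝ) := by
  rw [completedRiemannZeta_eq (by simp; linarith), Gammaℝ_ofReal, riemannZeta_ofReal hs, ofReal_mul]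

end DirichletCharacter

namespace DirichletCharacter

variable {N : ℕ} [NeZero N] {χ : DirichletCharacter ℂ N}

lemma natCast_rpow_eq_exp (x : ℝ) : (N : ℝ) ^ x = Real.exp (x * Real.log N) := by
  rw [Real.rpow_def_of_pos (by exact_mod_cast Nat.pos_of_neZero N), mul_comm]

/-- The value at `s > 1` of the Hecke function of an odd real character. -/
lemma IsRealPrimitive.completedRiemannZeta_mul_xi_re (h : χ.IsRealPrimitive) (ho : χ.Odd) {s : ℝ}
    (hs : 1 < s) : (completedRiemannZeta s * χ.xi s).re =
      Real.exp (s / 2 * Real.log N) * (gammaR s * gammaR (s + 1)) *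
        (realZeta s * χ.realL s) := by
  rw [completedRiemannZeta_ofReal hs, h.xi_of_odd ho hs.le, ← ofReal_mul, ofReal_re,
    natCast_rpow_eq_exp]
  ring

lemma IsRealPrimitive.xi_one_re (h : χ.IsRealPrimitive) (ho : χ.Odd) :
    (χ.xi 1).re = Real.exp (Real.log N / 2) * χ.realL 1 / Real.pi := by
  have := h.xi_of_odd ho le_rfl
  rw [ofReal_one] at this
  rw [this, ofReal_re, natCast_rpow_eq_exp, show (1 : ℝ) + 1 = 2 by norm_num, gammaR_two]
  ring_nf

lemma continuousOn_completedRiemannZeta_mul_xi (hχ : χ ≠ 1) :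
    ContinuousOn (fun s : ℝ ↦ (completedRiemannZeta s * χ.xi s).re) (Ioo (1 / 2) 1) := by
  intro s hs
  have h0 : (s : ℂ) ≠ 0 := by
    norm_cast
    linarith [hs.1]
  have h1 : (s : ℂ) ≠ 1 := by
    norm_cast
    exact hs.2.ne
  have hc : ContinuousAt (fun z ↦ completedRiemannZeta z * χ.xi z) (s : ℂ) :=
    (differentiableAt_completedZeta h0 h1).continuousAt.mul
      (differentiable_xi hχ).continuous.continuousAt
  exact (continuous_re.continuousAt.comp
    (hc.comp (f := fun s : ℝ ↦ (s : ℂ)) continuous_ofReal.continuousAt)).continuousWithinAt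

lemma realZeta_three_le : realZeta 3 ≤ 1.5 := by
  have := realZeta_le (s := 3) (by norm_num)
  norm_num at this ⊢
  linarith

set_option maxHeartbeats 1000000 in
/-- If `L(1, χ)` is small, then `ζ(s) L(s, χ)` has a real zero close to `1`. -/
theorem IsRealPrimitive.exists_zero (h : χ.IsRealPrimitive) (ho : χ.Odd)
    (hN : 13.8 ≤ Real.log N) (hL : χ.realL 1 * Real.log N ≤ 0.12934) :
    ∃ β : ℝ, 1 - 0.14 / Real.log N < β ∧ β < 1 ∧ completedRiemannZeta β * χ.xi β = 0 := by
  obtain ⟨W, M, hf, him⟩ := exists_isHeckeFunction_xi h.isPrimitive h.ne_one h.sq_eq_one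
  set f := fun s : ℝ ↦ (completedRiemannZeta s * χ.xi s).re with hfdef
  set ℓ := Real.log N with hℓ
  have hℓ0 : 0 < ℓ := by linarith
  have hL1 := h.realL_one_pos
  have hκ : 0 < (χ.xi 1).re := by
    rw [h.xi_one_re ho]
    positivity
  have hb2 : 0.14 / ℓ ≤ 0.0102 := by
    rw [div_le_iff₀ hℓ0]; linarith
  have hb0 : 0 < 0.14 / ℓ := by positivity
  rcases lt_or_ge 0 (f (1 - 0.14 / ℓ)) with hpos | hneg
  · obtain ⟨β, h1, h2, h3⟩ := hf.exists_zero hκ (a := 1 - 0.14 / ℓ) (by linarith) (by linarith)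
      hpos (continuousOn_completedRiemannZeta_mul_xi h.ne_one)
    refine ⟨β, h1, h2, Complex.ext h3 (him β (by linarith) h2.ne)⟩
  · exfalso
    set a := 0.7 / ℓ with ha
    have ha0 : 0 < a := by positivity
    have haℓ : a * ℓ = 0.7 := by rw [ha]; field_simp
    have ha2 : a ≤ 0.05073 := by
      rw [ha, div_le_iff₀ hℓ0]; linarith
    have hZ : 1.543 ≤ realZeta (2 * (1 + a)) := by
      have := le_realZeta_two_add (t := 2 * a) (by positivity)
      rw [show 2 * (1 + a) = 2 + 2 * a by ring]
      have := Real.pi_gt_d4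
      nlinarith
    set γ := gammaR (1 + a) * gammaR (1 + a + 1) with hγ
    have hγ1 : 0.8755 ≤ Real.pi * γ := by
      refine le_trans ?_ (le_pi_mul_gammaR_mul_gammaR ha0.le (by linarith))
      nlinarith
    have hγ2 : 0.27 ≤ γ := by
      by_contra! hlt
      nlinarith [mul_pos (sub_pos.2 hlt) Real.pi_pos, Real.pi_lt_d2]
    set ZL := realZeta (1 + a) * χ.realL (1 + a) with hZL
    have hZL1 : 1.543 ≤ ZL := hZ.trans (realZeta_two_mul_le h.sq_eq_one (by linarith))
    have hfσ : f (1 + a) = Real.exp ((1 + a) / 2 * ℓ) * γ * ZL :=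
      h.completedRiemannZeta_mul_xi_re ho (by linarith)
    have hf3 : f 3 ≤ Real.exp (3 / 2 * ℓ) * 0.0163 * (1.5 * 1.5) := by
      rw [hfdef]
      simp only
      rw [h.completedRiemannZeta_mul_xi_re ho (by norm_num)]
      have h3 := realL_le_realZeta h.sq_eq_one (s := 3) (by norm_num)
      have h4 := gammaR_three_mul_gammaR_four_le
      have h5 := realZeta_three_le
      have h6 := h.realL_pos (s := 3) (by norm_num)
      have h7 := realZeta_pos (s := 3) (by norm_num)
      rw [show (3 : ℝ) + 1 = 4 by norm_num]
      gcongr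
      exact h3.trans h5
    have hexp (x : ℝ) : Real.exp (ℓ / 2) ^ x = Real.exp (ℓ / 2 * x) := by
      rw [← Real.exp_mul]
    have hside : 2 * f 3 ≤ Real.exp (ℓ / 2) ^ (3 - (1 + a)) * ((1 - 0.12) * f (1 + a)) := by
      rw [hfσ, hexp]
      have e : Real.exp (ℓ / 2 * (3 - (1 + a))) * ((1 - 0.12) *
          (Real.exp ((1 + a) / 2 * ℓ) * γ * ZL)) =
          Real.exp (3 / 2 * ℓ) * (0.88 * (γ * ZL)) := by
        rw [show 3 / 2 * ℓ = ℓ / 2 * (3 - (1 + a)) + (1 + a) / 2 * ℓ by ring, Real.exp_add]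
        ring
      rw [e]
      have : 0.27 * 1.543 ≤ γ * ZL := by gcongr
      have hE := Real.exp_pos (3 / 2 * ℓ)
      nlinarith
    have hκe := h.xi_one_re ho
    rw [← hℓ] at hκe
    have hγZL : 0.8755 * 1.543 ≤ Real.pi * γ * ZL := by gcongr
    have hE : 0 < Real.exp (ℓ / 2) := Real.exp_pos _
    rcases hf.le_residue_of_nonpos (b := 1 - 0.14 / ℓ) (s := 1 + a) (T := Real.exp (ℓ / 2))
      (τ := 0.12) (by linarith) (by linarith) (by linarith) (by linarith) hE hneg hside with hc | hc
    · rw [hκe, hfσ] at hc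
      have e1 : Real.exp ((1 + a) / 2 * ℓ) = Real.exp (ℓ / 2) * Real.exp 0.35 := by
        rw [← Real.exp_add, show (1 + a) / 2 * ℓ = ℓ / 2 + a * ℓ / 2 by ring, haℓ]
        norm_num
      have e2 : 1.41 ≤ Real.exp 0.35 := by
        have := Real.quadratic_le_exp_of_nonneg (x := 0.35) (by norm_num)
        norm_num at this ⊢
        linarith
      rw [e1] at hc
      have h5 : 0.12 * ((1 + a) * (1 + a - 1)) * (Real.exp 0.35 * (Real.pi * γ * ZL)) ≤
          χ.realL 1 * (2 * (1 + a) - 1) := by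
        have hc' := mul_le_mul_of_nonneg_left hc Real.pi_pos.le
        refine le_of_mul_le_mul_left ?_ hE
        convert hc' using 1
        · ring
        · field_simp
      have h6 : 0.12 * ((1 + a) * 0.7) * (Real.exp 0.35 * (Real.pi * γ * ZL)) ≤
          χ.realL 1 * ℓ * (2 * (1 + a) - 1) := by
        rw [← haℓ]
        nlinarith
      have h7 : 1.41 * (0.8755 * 1.543) ≤ Real.exp 0.35 * (Real.pi * γ * ZL) := by gcongr
      nlinarith
    · rw [hκe, hfσ, hexp] at hc
      have e1 : Real.exp (ℓ / 2 * -(1 + a - (1 - 0.14 / ℓ))) * (Real.exp ((1 + a) / 2 * ℓ)) =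
          Real.exp (ℓ / 2) * Real.exp (-0.07) := by
        rw [← Real.exp_add, ← Real.exp_add]
        congr 1
        field_simp
        ring
      have e2 : 0.93 ≤ Real.exp (-0.07) := by
        have := Real.add_one_le_exp (-0.07)
        linarith
      have h5 : (1 - 0.12) * ((1 - 0.14 / ℓ) * (1 - (1 - 0.14 / ℓ))) *
          (Real.exp (-0.07) * (Real.pi * γ * ZL)) ≤ χ.realL 1 * (2 * (1 + a) - 1) := by
        have hc' := mul_le_mul_of_nonneg_left hc Real.pi_pos.le
        refine le_of_mul_le_mul_left ?_ hE
        convert hc' using 1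
        · rw [show ∀ x y z w v u : ℝ, x * (y * z * (w * u * v)) = y * (z * w) * (x * u * v) by
            intros; ring, e1]
          ring
        · field_simp
      have h6 : 0.88 * ((1 - 0.14 / ℓ) * 0.14) * (Real.exp (-0.07) * (Real.pi * γ * ZL)) ≤
          χ.realL 1 * ℓ * (2 * (1 + a) - 1) := by
        have e3 : (1 - 0.12) * ((1 - 0.14 / ℓ) * (1 - (1 - 0.14 / ℓ))) * ℓ =
            0.88 * ((1 - 0.14 / ℓ) * 0.14) := by
          rw [sub_sub_cancel, mul_assoc, mul_assoc, div_mul_cancel₀ _ hℓ0.ne']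
          norm_num
        rw [← e3]
        linarith [mul_le_mul_of_nonneg_left h5 hℓ0.le]
      have h7 : 0.93 * (0.8755 * 1.543) ≤ Real.exp (-0.07) * (Real.pi * γ * ZL) := by gcongr
      have h8 : 0.88 * (0.9898 * 0.14) * (0.93 * (0.8755 * 1.543)) ≤
          0.88 * ((1 - 0.14 / ℓ) * 0.14) * (Real.exp (-0.07) * (Real.pi * γ * ZL)) := by
        have hb3 : 0.9898 ≤ 1 - 0.14 / ℓ := by linarith
        refine mul_le_mul ?_ h7 (by norm_num) (by positivity)
        linarith
      have h9 : χ.realL 1 * ℓ * (2 * (1 + a) - 1) ≤ 0.12934 * (2 * (1 + 0.05073) - 1) := by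
        gcongr
        linarith
      norm_num at h6 h8 h9
      linarith

end DirichletCharacter

namespace DirichletCharacter

lemma IsRealPrimitive.completedRiemannZeta_mul_xi_re_of_even {N : ℕ} [NeZero N]
    {χ : DirichletCharacter ℂ N} (h : χ.IsRealPrimitive) (he : χ.Even) {s : ℝ}
    (hs : 1 < s) : (completedRiemannZeta s * χ.xi s).re =
      Real.exp (s / 2 * Real.log N) * gammaR s ^ 2 * (realZeta s * χ.realL s) := by
  rw [completedRiemannZeta_ofReal hs, h.xi_of_even he hs.le, ← ofReal_mul, ofReal_re,
    natCast_rpow_eq_exp]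
  ring

lemma IsRealPrimitive.xi_one_re_of_even {N : ℕ} [NeZero N]
    {χ : DirichletCharacter ℂ N} (h : χ.IsRealPrimitive) (he : χ.Even) :
    (χ.xi 1).re = Real.exp (Real.log N / 2) * χ.realL 1 := by
  have := h.xi_of_even he le_rfl
  rw [ofReal_one] at this
  rw [this, ofReal_re, natCast_rpow_eq_exp, gammaR_one]
  ring_nf

section Product

variable {N₁ N₂ N₃ : ℕ} [NeZero N₁] [NeZero N₂] [NeZero N₃]
  {χ₁ : DirichletCharacter ℂ N₁} {χ₂ : DirichletCharacter ℂ N₂} {χ₃ : DirichletCharacter ℂ N₃}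

lemma biquadratic_re (hr1 : χ₁.IsRealPrimitive) (hr2 : χ₂.IsRealPrimitive)
    (hr3 : χ₃.IsRealPrimitive) (ho1 : χ₁.Odd) (ho2 : χ₂.Odd) (he3 : χ₃.Even) {s : ℝ} (hs : 1 < s) :
    (completedRiemannZeta s * (χ₁.xi s * χ₂.xi s * χ₃.xi s)).re =
      Real.exp (s / 2 * (Real.log N₁ + Real.log N₂ + Real.log N₃)) *
        (gammaR s * gammaR (s + 1)) ^ 2 *
        (realZeta s * χ₁.realL s * (χ₂.realL s * χ₃.realL s)) := by
  rw [completedRiemannZeta_ofReal hs, hr1.xi_of_odd ho1 hs.le, hr2.xi_of_odd ho2 hs.le,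
    hr3.xi_of_even he3 hs.le, ← ofReal_mul, ← ofReal_mul, ← ofReal_mul, ofReal_re,
    natCast_rpow_eq_exp, natCast_rpow_eq_exp, natCast_rpow_eq_exp, mul_add, mul_add, Real.exp_add,
    Real.exp_add]
  ring

lemma biquadratic_residue (hr1 : χ₁.IsRealPrimitive) (hr2 : χ₂.IsRealPrimitive)
    (hr3 : χ₃.IsRealPrimitive) (ho1 : χ₁.Odd) (ho2 : χ₂.Odd) (he3 : χ₃.Even) :
    (χ₁.xi 1 * χ₂.xi 1 * χ₃.xi 1).re =
      Real.exp (1 / 2 * (Real.log N₁ + Real.log N₂ + Real.log N₃)) *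
        (χ₁.realL 1 * χ₂.realL 1 * χ₃.realL 1) / Real.pi ^ 2 := by
  have e1 := hr1.xi_of_odd ho1 le_rfl
  have e2 := hr2.xi_of_odd ho2 le_rfl
  have e3 := hr3.xi_of_even he3 le_rfl
  rw [ofReal_one] at e1 e2 e3
  rw [e1, e2, e3, ← ofReal_mul, ← ofReal_mul, ofReal_re,
    natCast_rpow_eq_exp, natCast_rpow_eq_exp, natCast_rpow_eq_exp, mul_add, mul_add, Real.exp_add,
    Real.exp_add, show (1 : ℝ) + 1 = 2 by norm_num, gammaR_two, gammaR_one]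
  ring

lemma biquadratic_anti (hr1 : χ₁.IsRealPrimitive) (hr2 : χ₂.IsRealPrimitive)
    (hr3 : χ₃.IsRealPrimitive) (h : ∀ p : ℕ, p.Prime → ProductTrivialAt χ₁ χ₂ χ₃ p)
    {s t : ℝ} (hs : 1 < s) (hst : s ≤ t) :
    realZeta t * χ₁.realL t * (χ₂.realL t * χ₃.realL t) ≤
      realZeta s * χ₁.realL s * (χ₂.realL s * χ₃.realL s) := by
  have hn := biquadraticCoeff_nonneg hr1.sq_eq_one hr2.sq_eq_one hr3.sq_eq_one h
  have hsum {u : ℝ} (hu : 1 < u) : HasSum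
      (fun n : ℕ ↦ (biquadraticCoeff χ₁ χ₂ χ₃ n).re * (n : ℝ) ^ (-u))
      (realZeta u * χ₁.realL u * (χ₂.realL u * χ₃.realL u)) := by
    have := (hasSum_re_lseries (fun n ↦ (Complex.nonneg_iff.1 (hn n)).2.symm) (by linarith : u ≠ 0)
      (lseriesSummable_biquadraticCoeff (s := (u : ℂ)) (by simpa using hu))).1
    rw [lseries_biquadraticCoeff (by simpa using hu), riemannZeta_ofReal hu,
      hr1.LFunction_ofReal hu.le, hr2.LFunction_ofReal hu.le, hr3.LFunction_ofReal hu.le,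
      ← ofReal_mul, ← ofReal_mul, ← ofReal_mul, ofReal_re] at this
    exact this
  refine hasSum_le (fun n ↦ ?_) (hsum (hs.trans_le hst)) (hsum hs)
  refine mul_le_mul_of_nonneg_left ?_ (Complex.nonneg_iff.1 (hn n)).1
  rcases Nat.eq_zero_or_pos n with rfl | hn0
  · rw [Nat.cast_zero, Real.zero_rpow (by linarith), Real.zero_rpow (by linarith)]
  · exact Real.rpow_le_rpow_of_exponent_le (by exact_mod_cast hn0) (by linarith)

end Product

/-- Elimination of the auxiliary values from the three inequalities. -/
lemma elimination {a b γ δ Z l1 l2 l3 L1 L2 L3 x1 x2 x3 y : ℝ} (ha : 0 < a) (ha' : a ≤ 0.03624)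
    (hb : 0 < b) (hb' : b ≤ 0.0102) (hγ : 0 < γ) (hγ1 : γ ≤ 1) (hδ : 0 < δ)
    (hγδ : 0.91 ≤ Real.pi * (γ * δ)) (hZ : 0 < Z) (hZa : a * Z ≤ 1 + a) (hl1 : 0 < l1)
    (hl3 : 0 < l3) (hL2 : 0 < L2) (hL3 : 0 < L3) (hx1 : 0 < x1)
    (hx2 : 0 < x2) (hx3 : 0 < x3) (hy : 0 < y) (hZl : 1.572 ≤ Z * l2)
    (h1 : L3 ≤ (1 + a) * a * (x3 * γ ^ 2 * (Z * l3)))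
    (h2 : L1 * ((a + b) * (1 - 2 * (a * b))) ≤
      Real.pi * (a * b) * (x1 * (γ * δ) * (Z * l1)))
    (h3 : 0.1 * ((1 + a) * a) * (x1 * x2 * x3 * (γ * δ) ^ 2 * (Z * l1 * (l2 * l3))) ≤
        L1 * L2 * L3 / Real.pi ^ 2 * (1 + 2 * a) ∨
      (1 - 0.1) * ((1 - b) * b) * (y * (γ * δ) ^ 2 * (Z * l1 * (l2 * l3))) ≤
        L1 * L2 * L3 / Real.pi ^ 2 * (1 + 2 * a)) :
    0.124 * x2 * (a * (a + b)) ≤ L2 * b ∨ 1.066 * (a + b) * y ≤ L2 * (x1 * x3) := by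
  have hπ := Real.pi_pos
  have hab0 : 0 < a * b := mul_pos ha hb
  have hab : a * b ≤ 0.00037 := by
    calc a * b ≤ 0.03624 * 0.0102 := by gcongr
      _ ≤ _ := by norm_num
  set q := (a + b) * (1 - 2 * (a * b)) with hq
  have hq0 : 0 < q := mul_pos (by linarith) (by linarith)
  have h12 : L1 * q * L3 ≤ Real.pi * (a * b) * (x1 * (γ * δ) * (Z * l1)) *
      ((1 + a) * a * (x3 * γ ^ 2 * (Z * l3))) := by gcongr
  have hγ2 : γ ^ 2 ≤ 1 := pow_le_one₀ hγ.le hγ1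
  have hZa2 : (a * Z) ^ 2 ≤ (1 + a) ^ 2 := by gcongr
  have hγZ : γ ^ 2 * (a * Z) ^ 2 ≤ (1 + a) ^ 2 := by
    calc γ ^ 2 * (a * Z) ^ 2 ≤ 1 * (1 + a) ^ 2 := by gcongr
      _ = _ := one_mul _
  have hc : 0.91 * 1.572 ≤ Real.pi * (γ * δ) * (Z * l2) := by gcongr
  have hq1 : 0.9992 * (a + b) ≤ q := by
    rw [hq]; nlinarith
  have key {c : ℝ} (hc : c ≤ L1 * L2 * L3 / Real.pi ^ 2 * (1 + 2 * a)) :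
      c * Real.pi ^ 2 * q ≤ L2 * (1 + 2 * a) * (Real.pi * (a * b) * (x1 * (γ * δ) * (Z * l1)) *
        ((1 + a) * a * (x3 * γ ^ 2 * (Z * l3)))) := by
    calc c * Real.pi ^ 2 * q ≤ L1 * L2 * L3 / Real.pi ^ 2 * (1 + 2 * a) * Real.pi ^ 2 * q := by
          gcongr
      _ = L2 * (1 + 2 * a) * (L1 * q * L3) := by field_simp
      _ ≤ _ := by gcongr
  rcases h3 with h3 | h3
  · left
    have h4 := key h3
    have h5 : 0.1 * x2 * (Real.pi * (γ * δ) * (Z * l2)) * q * a ≤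
        L2 * (1 + 2 * a) * b * (γ ^ 2 * (a * Z) ^ 2) := by
      have hp : 0 < (1 + a) * a * x1 * x3 * γ * δ * l1 * l3 * Real.pi := by positivity
      refine le_of_mul_le_mul_left ?_ hp
      convert mul_le_mul_of_nonneg_left h4 (by positivity : 0 ≤ a) using 1 <;> ring
    have h6 : L2 * (1 + 2 * a) * b * (γ ^ 2 * (a * Z) ^ 2) ≤
        L2 * (1 + 2 * 0.03624) * b * ((1 + 0.03624) ^ 2) := by
      refine mul_le_mul (by gcongr) (hγZ.trans (by gcongr)) (by positivity) (by positivity)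
    have h7 : 0.1 * x2 * (0.91 * 1.572) * (0.9992 * (a + b)) * a ≤
        0.1 * x2 * (Real.pi * (γ * δ) * (Z * l2)) * q * a := by gcongr
    have h8 : 0 < x2 * (a * (a + b)) := by positivity
    have h9 : 0 < L2 * b := by positivity
    norm_num at h5 h6 h7 ⊢
    nlinarith
  · right
    have h4 := key h3
    have h5 : (1 - 0.1) * (1 - b) * y * (Real.pi * (γ * δ) * (Z * l2)) * q ≤
        L2 * (1 + 2 * a) * (1 + a) * (x1 * x3) * (γ ^ 2 * (a * Z) ^ 2) := by
      have hp : 0 < b * γ * δ * l1 * l3 * Real.pi := by positivity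
      refine le_of_mul_le_mul_left ?_ hp
      convert mul_le_mul_of_nonneg_left h4 (by norm_num : (0 : ℝ) ≤ 1) using 1 <;> ring
    have h6 : L2 * (1 + 2 * a) * (1 + a) * (x1 * x3) * (γ ^ 2 * (a * Z) ^ 2) ≤
        L2 * (1 + 2 * 0.03624) * (1 + 0.03624) * (x1 * x3) * ((1 + 0.03624) ^ 2) := by
      refine mul_le_mul (by gcongr) (hγZ.trans (by gcongr)) (by positivity) (by positivity)
    have h7 : (1 - 0.1) * (1 - 0.0102) * y * (0.91 * 1.572) * (0.9992 * (a + b)) ≤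
        (1 - 0.1) * (1 - b) * y * (Real.pi * (γ * δ) * (Z * l2)) * q := by
      refine mul_le_mul (mul_le_mul (by gcongr) hc (by norm_num) ?_) hq1 (by positivity) ?_
      · have : 0 ≤ 1 - b := by linarith
        positivity
      · have : 0 ≤ 1 - b := by linarith
        positivity
    have h8 : 0 < (a + b) * y := by positivity
    have h9 : 0 < L2 * (x1 * x3) := by positivity
    have h10 := h7.trans (h5.trans h6)
    norm_num at h10 ⊢
    linarith

/-- A real zero of `ζ(s) L(s, χ₁)` near `1` repels: it bounds `L(1, χ₂)` from below. -/
theorem le_realL_one_of_zero {N₁ N₂ N₃ : ℕ} [NeZero N₁] [NeZero N₂] [NeZero N₃]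
    {χ₁ : DirichletCharacter ℂ N₁} {χ₂ : DirichletCharacter ℂ N₂} {χ₃ : DirichletCharacter ℂ N₃}
    (hr1 : χ₁.IsRealPrimitive) (hr2 : χ₂.IsRealPrimitive)
    (hr3 : χ₃.IsRealPrimitive) (ho1 : χ₁.Odd) (ho2 : χ₂.Odd) (he3 : χ₃.Even)
    (h : ∀ p : ℕ, p.Prime → ProductTrivialAt χ₁ χ₂ χ₃ p)
    {a b : ℝ} (ha : 0 < a) (ha' : a ≤ 0.03624) (hb : 0 < b) (hb' : b ≤ 0.0102)
    (h0 : completedRiemannZeta ((1 - b : ℝ) : ℂ) * χ₁.xi ((1 - b : ℝ) : ℂ) = 0) :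
    0.124 * Real.exp (a / 2 * Real.log N₂) * (a * (a + b)) ≤ χ₂.realL 1 * b ∨
      1.066 * (a + b) * Real.exp (-(b / 2 * (Real.log N₁ + Real.log N₂ + Real.log N₃))) ≤
        χ₂.realL 1 * (Real.exp (a / 2 * Real.log N₁) * Real.exp (a / 2 * Real.log N₃)) := by
  obtain ⟨W, M, hf, -⟩ := exists_isHeckeFunction_xi hr1.isPrimitive hr1.ne_one hr1.sq_eq_one
  obtain ⟨W', M', hg, -⟩ := exists_isHeckeFunction_xi hr3.isPrimitive hr3.ne_one hr3.sq_eq_one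
  obtain ⟨W'', M'', hF⟩ := exists_isHeckeFunction_xi_mul_xi_mul_xi hr1.isPrimitive hr2.isPrimitive
    hr3.isPrimitive hr1.ne_one hr2.ne_one hr3.ne_one hr1.sq_eq_one hr2.sq_eq_one hr3.sq_eq_one h
  have hσ : 1 < 1 + a := by linarith
  have hπ := Real.pi_pos
  have hA := hg.residue_le hσ
  have hB := hf.residue_mul_le_of_zero (b := 1 - b) hσ (by linarith) (by linarith) (by rw [h0]; rfl)
  have hγδ : 0.91 ≤ Real.pi * (gammaR (1 + a) * gammaR (1 + a + 1)) := by
    refine le_trans ?_ (le_pi_mul_gammaR_mul_gammaR ha.le (by linarith))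
    nlinarith
  have hγ : 0 < gammaR (1 + a) := gammaR_pos (by linarith)
  have hδ : 0 < gammaR (1 + a + 1) := gammaR_pos (by linarith)
  have hl1 := hr1.realL_pos hσ
  have hl2 := hr2.realL_pos hσ
  have hl3 := hr3.realL_pos hσ
  have hL2 := hr2.realL_one_pos
  have hL3 := hr3.realL_one_pos
  have hZ := realZeta_pos hσ
  have hZl : 1.572 ≤ realZeta (1 + a) * χ₂.realL (1 + a) := by
    refine le_trans ?_ (realZeta_two_mul_le hr2.sq_eq_one hσ)
    have := le_realZeta_two_add (t := 2 * a) (by positivity)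
    rw [show 2 * (1 + a) = 2 + 2 * a by ring]
    have := Real.pi_gt_d4
    nlinarith
  have hZa : a * realZeta (1 + a) ≤ 1 + a := by
    have := mul_le_mul_of_nonneg_left (realZeta_le hσ) ha.le
    rw [add_sub_cancel_left, mul_add, mul_one_div_cancel ha.ne'] at this
    linarith
  have hF0 : (completedRiemannZeta ((1 - b : ℝ) : ℂ) * (χ₁.xi ((1 - b : ℝ) : ℂ) *
      χ₂.xi ((1 - b : ℝ) : ℂ) * χ₃.xi ((1 - b : ℝ) : ℂ))).re ≤ 0 := by
    rw [mul_assoc, ← mul_assoc, h0, zero_mul, zero_re]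
  have hanti := biquadratic_anti hr1 hr2 hr3 h hσ (by linarith : 1 + a ≤ 3)
  set ℓ := Real.log N₁ with hℓ
  set ρ := Real.log N₂ with hρ
  set lam := Real.log N₃ with hlam
  have hexp (x : ℝ) : Real.exp (1 / 2 * (ℓ + ρ + lam)) ^ x =
      Real.exp (x / 2 * (ℓ + ρ + lam)) := by
    rw [← Real.exp_mul]
    congr 1
    ring
  have hside : 2 * (completedRiemannZeta ((3 : ℝ) : ℂ) * (χ₁.xi (3 : ℝ) *
      χ₂.xi (3 : ℝ) * χ₃.xi (3 : ℝ))).re ≤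
      Real.exp (1 / 2 * (ℓ + ρ + lam)) ^ (3 - (1 + a)) * ((1 - 0.1) *
        (completedRiemannZeta ((1 + a : ℝ) : ℂ) * (χ₁.xi (1 + a : ℝ) *
      χ₂.xi (1 + a : ℝ) * χ₃.xi (1 + a : ℝ))).re) := by
    rw [biquadratic_re hr1 hr2 hr3 ho1 ho2 he3 hσ,
      biquadratic_re hr1 hr2 hr3 ho1 ho2 he3 (by norm_num), hexp]
    have e : Real.exp ((3 - (1 + a)) / 2 * (ℓ + ρ + lam)) *
        Real.exp ((1 + a) / 2 * (ℓ + ρ + lam)) = Real.exp (3 / 2 * (ℓ + ρ + lam)) := by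
      rw [← Real.exp_add]
      congr 1
      ring
    have hg4 := gammaR_three_mul_gammaR_four_le
    have hp3 : 0 < gammaR 3 * gammaR 4 := mul_pos (gammaR_pos (by norm_num)) (gammaR_pos (by norm_num))
    have hg1 : 0.27 ≤ gammaR (1 + a) * gammaR (1 + a + 1) := by
      by_contra! hlt
      nlinarith [mul_pos (sub_pos.2 hlt) Real.pi_pos, Real.pi_lt_d2]
    have hg : 2 * (gammaR 3 * gammaR (3 + 1)) ^ 2 ≤
        (1 - 0.1) * (gammaR (1 + a) * gammaR (1 + a + 1)) ^ 2 := by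
      rw [show (3 : ℝ) + 1 = 4 by norm_num]
      nlinarith
    have hp := mul_le_mul hg hanti (by
      have := realZeta_pos (s := 3) (by norm_num)
      have := hr1.realL_pos (s := 3) (by norm_num)
      have := hr2.realL_pos (s := 3) (by norm_num)
      have := hr3.realL_pos (s := 3) (by norm_num)
      positivity) (by positivity)
    have := mul_le_mul_of_nonneg_left hp (Real.exp_pos (3 / 2 * (ℓ + ρ + lam))).le
    calc _ = _ := by ring
      _ ≤ _ := this
      _ = _ := by rw [← e]; ring
  have hC := hF.le_residue_of_nonpos (b := 1 - b) (s := 1 + a)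
    (T := Real.exp (1 / 2 * (ℓ + ρ + lam))) (τ := 0.1) (by linarith) (by linarith) hσ
    (by linarith) (Real.exp_pos _) hF0 hside
  rw [hr3.xi_one_re_of_even he3, hr3.completedRiemannZeta_mul_xi_re_of_even he3 hσ] at hA
  rw [hr1.xi_one_re ho1, hr1.completedRiemannZeta_mul_xi_re ho1 hσ] at hB
  rw [biquadratic_re hr1 hr2 hr3 ho1 ho2 he3 hσ, biquadratic_residue hr1 hr2 hr3 ho1 ho2 he3,
    hexp, ← hℓ, ← hρ, ← hlam] at hC
  rw [← hlam, show (1 + a) / 2 * lam = lam / 2 + a / 2 * lam by ring, Real.exp_add] at hA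
  rw [← hℓ, show (1 + a) / 2 * ℓ = ℓ / 2 + a / 2 * ℓ by ring, Real.exp_add, add_sub_cancel_left,
    sub_sub_cancel] at hB
  refine elimination ha ha' hb hb' hγ (gammaR_one_add_le ha.le (by linarith)) hδ hγδ hZ hZa hl1 hl3
    hL2 hL3 (Real.exp_pos _) (Real.exp_pos _) (Real.exp_pos _) (Real.exp_pos _) hZl
    (L1 := χ₁.realL 1) ?_ ?_ ?_
  · refine le_of_mul_le_mul_left ?_ (Real.exp_pos (lam / 2))
    refine (le_of_eq ?_).trans (hA.trans (le_of_eq ?_))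
    · ring
    · ring
  · refine le_of_mul_le_mul_left ?_ (Real.exp_pos (ℓ / 2))
    have := mul_le_mul_of_nonneg_left hB (by positivity : 0 ≤ Real.pi * (a * b))
    refine (le_of_eq ?_).trans (this.trans (le_of_eq ?_))
    · field_simp
      ring
    · ring
  · refine hC.imp (fun hC ↦ ?_) (fun hC ↦ ?_) 
    · refine le_of_mul_le_mul_left ?_ (Real.exp_pos (1 / 2 * (ℓ + ρ + lam)))
      refine (le_of_eq ?_).trans (hC.trans (le_of_eq ?_))
      · rw [show (1 + a) / 2 * (ℓ + ρ + lam) = 1 / 2 * (ℓ + ρ + lam) + a / 2 * ℓ + a / 2 * ρ +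
          a / 2 * lam by ring, Real.exp_add, Real.exp_add, Real.exp_add]
        ring
      · ring
    · refine le_of_mul_le_mul_left ?_ (Real.exp_pos (1 / 2 * (ℓ + ρ + lam)))
      refine (le_of_eq ?_).trans (hC.trans (le_of_eq ?_))
      · have e : Real.exp (-(1 + a - (1 - b)) / 2 * (ℓ + ρ + lam)) *
            Real.exp ((1 + a) / 2 * (ℓ + ρ + lam)) = Real.exp (1 / 2 * (ℓ + ρ + lam)) *
              Real.exp (-(b / 2 * (ℓ + ρ + lam))) := by
          rw [← Real.exp_add, ← Real.exp_add]
          congr 1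
          ring
        linear_combination (-(1 - 0.1) * ((1 - b) * b) *
          ((gammaR (1 + a) * gammaR (1 + a + 1)) ^ 2 * (realZeta (1 + a) * χ₁.realL (1 + a) *
            (χ₂.realL (1 + a) * χ₃.realL (1 + a))))) * e
      · ring

end DirichletCharacter

lemma exp_le_chord {x y z t : ℝ} (ht0 : 0 ≤ t) (ht1 : t ≤ 1) (h : x ≤ (1 - t) * y + t * z) :
    Real.exp x ≤ (1 - t) * Real.exp y + t * Real.exp z :=
  (Real.exp_le_exp.2 h).trans
    (convexOn_exp.2 (mem_univ y) (mem_univ z) (by linarith : 0 ≤ 1 - t) ht0 (by ring))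

lemma le_exp_natCast_add (n : ℕ) (x : ℝ) : 2.7182 ^ n * (x + 1) ≤ Real.exp (n + x) := by
  rw [Real.exp_add, ← Real.exp_one_pow]
  have h1 := Real.exp_one_gt_d9
  rcases le_or_gt (x + 1) 0 with h | h
  · exact (mul_nonpos_of_nonneg_of_nonpos (by positivity) h).trans (by positivity)
  · gcongr
    · linarith
    · exact Real.add_one_le_exp x

lemma exp_middle_le {v : ℝ} (h2 : 2 ≤ v) (hv : v ≤ 20.25) :
    Real.exp (0.14 * v + 1 / (2 * v)) ≤ 4.994 * ((v - 1) * (1 / v + 0.14)) := by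
  have hv0 : 0 < v := by linarith
  have hinv : 1 / v ≤ (22.25 - v) / 40.5 := by
    rw [div_le_div_iff₀ hv0 (by norm_num)]
    nlinarith [mul_nonneg (sub_nonneg.2 h2) (sub_nonneg.2 hv)]
  have hinv2 : 1 / (2 * v) = 1 / v / 2 := by field_simp
  set t := (v - 2) / 18.25 with ht
  have hvt : v = 2 + 18.25 * t := by rw [ht]; ring
  have ht0 : 0 ≤ t := by rw [ht]; apply div_nonneg <;> linarith
  have ht1 : 0 ≤ 1 - t := by rw [hvt] at hv; linarith
  have h := exp_le_chord (x := 0.14 * v + 1 / (2 * v)) (y := 0.53) (z := 2.86) (t := t)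
    ht0 (by linarith) (by
      rw [hinv2]
      generalize 1 / v = w at *
      clear_value t
      clear ht
      subst hvt
      norm_num at *
      linarith)
  have e1 : Real.exp 0.53 ≤ 3 :=
    (Real.exp_bound_div_one_sub_of_interval (by norm_num) (by norm_num)).trans (by norm_num)
  have e2 : Real.exp 2.86 ≤ 17.6 := by
    have h1 : Real.exp 2.86 * Real.exp 0.14 = Real.exp 1 ^ 3 := by
      rw [← Real.exp_add, Real.exp_one_pow]
      norm_num
    have h2 : Real.exp 1 ^ 3 ≤ 2.7182818286 ^ 3 := by
      gcongr
      exact Real.exp_one_lt_d9.le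
    have h3 := Real.quadratic_le_exp_of_nonneg (x := 0.14) (by norm_num)
    have h4 := Real.exp_pos 2.86
    rw [← h1] at h2
    norm_num at h2 h3
    nlinarith
  have e3 : (v - 1) * (1 / v + 0.14) = 0.14 * v + 0.86 - 1 / v := by
    field_simp
    ring
  rw [e3]
  have h5 : (1 - t) * Real.exp 0.53 + t * Real.exp 2.86 ≤ (1 - t) * 3 + t * 17.6 := by gcongr
  refine (h.trans h5).trans ?_
  clear h h5 e1 e2 e3
  generalize 1 / v = w at *
  clear_value t
  clear ht
  subst hvt
  norm_num at *
  linarith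

lemma deuring_numerics {v : ℝ} (h2 : 2 ≤ v) :
    0.12934 ≤ 1.066 * ((v - 1) * (1 / v + 0.14)) * Real.exp (-(0.14 * v + 1 / (2 * v) + 1 / 2)) ∨
      1500000 * (v - 1) * Real.exp (-(v - 1)) ≤
        1.066 * ((v - 1) * (1 / v + 0.14)) * Real.exp (-(0.14 * v + 1 / (2 * v) + 1 / 2)) := by
  have hv0 : 0 < v := by linarith
  rcases le_total v 20.25 with hv | hv
  · left
    have h1 := exp_middle_le h2 hv
    have h3 : 0.606 ≤ Real.exp (-(1 / 2)) := by
      rw [Real.exp_neg, le_inv_comm₀ (by norm_num) (Real.exp_pos _)]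
      have := Real.exp_bound' (x := 1 / 2) (by norm_num) (by norm_num) (n := 4) (by norm_num)
      norm_num [Finset.sum_range_succ, Nat.factorial] at this ⊢
      linarith
    rw [neg_add, Real.exp_add, Real.exp_neg (0.14 * v + 1 / (2 * v)), ← mul_assoc, mul_right_comm,
      ← div_eq_mul_inv, le_div_iff₀ (Real.exp_pos _)]
    have : 0 < (v - 1) * (1 / v + 0.14) := by
      have : 0 < v - 1 := by linarith
      positivity
    nlinarith
  · right
    have e : Real.exp (-(0.14 * v + 1 / (2 * v) + 1 / 2)) =
        Real.exp (v - 1 - (0.14 * v + 1 / (2 * v) + 1 / 2)) * Real.exp (-(v - 1)) := by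
      rw [← Real.exp_add]
      congr 1
      ring
    rw [e, ← mul_assoc]
    refine mul_le_mul_of_nonneg_right ?_ (Real.exp_pos _).le
    have hinv : 1 / (2 * v) ≤ 0.0247 := by
      rw [div_le_iff₀ (by linarith)]
      linarith
    have h0 : (0 : ℝ) ≤ v - 1 := by linarith
    suffices 1500000 ≤ 1.066 * (1 / v + 0.14) *
        Real.exp (v - 1 - (0.14 * v + 1 / (2 * v) + 1 / 2)) by
      calc _ ≤ (1.066 * (1 / v + 0.14) *
        Real.exp (v - 1 - (0.14 * v + 1 / (2 * v) + 1 / 2))) * (v - 1) := by gcongr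
        _ = _ := by ring
    rcases le_total v 20.6 with hv' | hv'
    · have h3 : 0.0485 ≤ 1 / v := by
        rw [le_div_iff₀ hv0]
        linarith
      have h4 := (le_exp_natCast_add 16 (-0.11)).trans (Real.exp_le_exp.2
        (by push_cast; linarith :
          ((16 : ℕ) : ℝ) + -0.11 ≤ v - 1 - (0.14 * v + 1 / (2 * v) + 1 / 2)))
      calc (1500000 : ℝ) ≤ 1.066 * (0.0485 + 0.14) * (2.7182 ^ 16 * (-0.11 + 1)) := by norm_num
        _ ≤ _ := by gcongr
    · have h3 : 0 ≤ 1 / v := by positivity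
      have h4 := (le_exp_natCast_add 16 0.19).trans (Real.exp_le_exp.2
        (by push_cast; linarith :
          ((16 : ℕ) : ℝ) + 0.19 ≤ v - 1 - (0.14 * v + 1 / (2 * v) + 1 / 2)))
      calc (1500000 : ℝ) ≤ 1.066 * (0 + 0.14) * (2.7182 ^ 16 * (0.19 + 1)) := by norm_num
        _ ≤ _ := by gcongr

lemma one_add_mul_exp_neg_anti {y z : ℝ} (hy : 0 ≤ y) (hyz : y ≤ z) :
    (1 + z) * Real.exp (-z) ≤ (1 + y) * Real.exp (-y) := by
  have h1 : 1 + z ≤ (1 + y) * Real.exp (z - y) := by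
    have := Real.add_one_le_exp (z - y)
    nlinarith
  calc (1 + z) * Real.exp (-z) ≤ (1 + y) * Real.exp (z - y) * Real.exp (-z) := by gcongr
    _ = _ := by
      rw [mul_assoc, ← Real.exp_add]
      ring_nf

namespace DirichletCharacter

/-- If `L(1, χ₁)` is small, then `L(1, χ₂)` is not. -/
theorem le_realL_one_of_small {N₁ N₂ N₃ : ℕ} [NeZero N₁] [NeZero N₂] [NeZero N₃]
    {χ₁ : DirichletCharacter ℂ N₁} {χ₂ : DirichletCharacter ℂ N₂} {χ₃ : DirichletCharacter ℂ N₃}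
    (hr1 : χ₁.IsRealPrimitive) (hr2 : χ₂.IsRealPrimitive)
    (hr3 : χ₃.IsRealPrimitive) (ho1 : χ₁.Odd) (ho2 : χ₂.Odd) (he3 : χ₃.Even)
    (h : ∀ p : ℕ, p.Prime → ProductTrivialAt χ₁ χ₂ χ₃ p) (hN : N₃ ≤ N₁ * N₂) (hN12 : N₁ ≤ N₂)
    (hN1 : 13.8 ≤ Real.log N₁) (hL : χ₁.realL 1 * Real.log N₁ ≤ 0.12934) :
    0.12934 ≤ χ₂.realL 1 * Real.log N₂ ∨
      1500000 * (Real.log N₂ / Real.log N₁) * Real.exp (-(Real.log N₂ / Real.log N₁)) ≤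
        χ₂.realL 1 * Real.log N₂ := by
  obtain ⟨β, hβ, hβ1, h0⟩ := hr1.exists_zero ho1 hN1 hL
  have hp1 : (0 : ℝ) < N₁ := by exact_mod_cast Nat.pos_of_neZero N₁
  have hp2 : (0 : ℝ) < N₂ := by exact_mod_cast Nat.pos_of_neZero N₂
  have hp3 : (0 : ℝ) < N₃ := by exact_mod_cast Nat.pos_of_neZero N₃
  have h12 : Real.log N₁ ≤ Real.log N₂ := Real.log_le_log hp1 (by exact_mod_cast hN12)
  have h3 : Real.log N₃ ≤ Real.log N₁ + Real.log N₂ := by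
    rw [← Real.log_mul hp1.ne' hp2.ne']
    exact Real.log_le_log hp3 (by exact_mod_cast hN)
  set ℓ := Real.log N₁ with hℓ
  set ρ := Real.log N₂ with hρ
  set lam := Real.log N₃
  have hℓ0 : 0 < ℓ := by linarith
  have hρ0 : 0 < ρ := by linarith
  obtain ⟨b, rfl⟩ : ∃ b, β = 1 - b := ⟨1 - β, by ring⟩
  have hb0 : 0 < b := by linarith
  have hbℓ : b * ℓ ≤ 0.14 := by
    rw [← le_div_iff₀ hℓ0]
    linarith
  have hb' : b ≤ 0.0102 := by nlinarith
  have hL2 := hr2.realL_one_pos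
  set a := 1 / (ℓ + ρ) with ha
  have ha0 : 0 < a := by positivity
  have ha1 : a * (ℓ + ρ) = 1 := by rw [ha]; field_simp
  have ha' : a ≤ 0.03624 := by
    rw [ha, div_le_iff₀ (by positivity)]
    linarith
  set v := (ℓ + ρ) / ℓ with hv
  have hv2 : 2 ≤ v := by
    rw [hv, le_div_iff₀ hℓ0]
    linarith
  have hv1 : ρ / ℓ = v - 1 := by rw [hv]; field_simp; ring
  have haℓ : a * ℓ = 1 / v := by rw [ha, hv]; field_simp
  have haρ : a * ρ = (v - 1) / v := by rw [ha, ← hv1, hv]; field_simp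
  rcases le_realL_one_of_zero hr1 hr2 hr3 ho1 ho2 he3 h ha0 ha' hb0 hb' h0 with hc | hc
  · left
    have hu : 1 / 2 ≤ a * ρ := by nlinarith
    have hE : 1.28 ≤ Real.exp (a / 2 * ρ) := by
      have := Real.quadratic_le_exp_of_nonneg (x := a / 2 * ρ) (by positivity)
      nlinarith
    have hbu : b * (a * ℓ) ≤ 0.14 * a := by nlinarith
    have hb1 : b ≤ a * ρ * (a + b) := by nlinarith
    refine le_of_mul_le_mul_right ?_ hb0
    calc 0.12934 * b ≤ 0.124 * 1.28 * b := by
          gcongr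
          norm_num
      _ ≤ 0.124 * Real.exp (a / 2 * ρ) * (a * ρ * (a + b)) := by gcongr
      _ = 0.124 * Real.exp (a / 2 * ρ) * (a * (a + b)) * ρ := by ring
      _ ≤ χ₂.realL 1 * b * ρ := by gcongr
      _ = _ := by ring
  · have hmain : 1.066 * ((v - 1) * (1 / v + 0.14)) * Real.exp (-(0.14 * v + 1 / (2 * v) + 1 / 2)) ≤
        χ₂.realL 1 * ρ := by
      have hv0 : 0 < v := by linarith
      have hyv : b * (ℓ + ρ) ≤ 0.14 * v := by
        rw [hv, ← mul_div_assoc, le_div_iff₀ hℓ0]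
        nlinarith
      have h4 := one_add_mul_exp_neg_anti (by positivity) hyv
      have h5 : Real.exp (-(b * (ℓ + ρ))) ≤ Real.exp (-(b / 2 * (ℓ + ρ + lam))) := by
        have := mul_le_mul_of_nonneg_left h3 hb0.le
        rw [Real.exp_le_exp]
        linarith
      have h6 : Real.exp (a / 2 * ℓ) * Real.exp (a / 2 * lam) ≤ Real.exp (1 / (2 * v) + 1 / 2) := by
        rw [← Real.exp_add, Real.exp_le_exp, show 1 / (2 * v) = a * ℓ / 2 by rw [haℓ]; field_simp]
        have := mul_le_mul_of_nonneg_left h3 ha0.le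
        linarith
      have h7 : (v - 1) * (1 / v + 0.14) = a * ρ * (1 + 0.14 * v) := by
        rw [haρ]
        field_simp
      have h8 : a + b = a * (1 + b * (ℓ + ρ)) := by linear_combination -b * ha1
      have h9 : Real.exp (-(0.14 * v + 1 / (2 * v) + 1 / 2)) * Real.exp (1 / (2 * v) + 1 / 2) =
          Real.exp (-(0.14 * v)) := by
        rw [← Real.exp_add]
        congr 1
        ring
      refine le_of_mul_le_mul_right ?_ (Real.exp_pos (1 / (2 * v) + 1 / 2))
      calc _ = 1.066 * (a * ρ) * ((1 + 0.14 * v) * Real.exp (-(0.14 * v))) := by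
            rw [h7, ← h9]
            ring
        _ ≤ 1.066 * (a * ρ) * ((1 + b * (ℓ + ρ)) * Real.exp (-(b * (ℓ + ρ)))) := by gcongr
        _ = 1.066 * (a + b) * Real.exp (-(b * (ℓ + ρ))) * ρ := by
            rw [h8]
            ring
        _ ≤ 1.066 * (a + b) * Real.exp (-(b / 2 * (ℓ + ρ + lam))) * ρ := by gcongr
        _ ≤ χ₂.realL 1 * (Real.exp (a / 2 * ℓ) * Real.exp (a / 2 * lam)) * ρ := by gcongr
        _ ≤ χ₂.realL 1 * Real.exp (1 / (2 * v) + 1 / 2) * ρ := by gcongr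
        _ = _ := by ring
    rw [hv1]
    exact (deuring_numerics hv2).imp (fun h ↦ h.trans hmain) (fun h ↦ h.trans hmain)

end DirichletCharacter

namespace DirichletCharacter

variable {N₁ N₂ : ℕ} [NeZero N₁] [NeZero N₂] {χ₁ : DirichletCharacter ℂ N₁}
  {χ₂ : DirichletCharacter ℂ N₂}

omit [NeZero N₁] in
lemma apply_natCast_eq_zero {p : ℕ} (hp : p.Prime) (h : p ∣ N₁) (χ : DirichletCharacter ℂ N₁) :
    χ (p : ZMod N₁) = 0 :=
  χ.map_nonunit fun hu ↦ hp.coprime_iff_not_dvd.1 ((ZMod.isUnit_iff_coprime _ _).1 hu) h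

omit [NeZero N₁] [NeZero N₂] in
lemma primitive_mul_apply {a : ℤ} (h1 : IsCoprime a N₁) (h2 : IsCoprime a N₂) :
    (χ₁.primitive_mul χ₂) a = χ₁ a * χ₂ a := by
  have h : IsCoprime a (N₁.lcm N₂ : ℕ) :=
    (h1.mul_right h2).of_isCoprime_of_dvd_right (by exact_mod_cast Nat.lcm_dvd_mul N₁ N₂)
  rw [mul_def, primitiveCharacter_apply_of_isCoprime _ h, DirichletCharacter.mul, MulChar.mul_apply,
    changeLevel_eq_cast_of_dvd' _ _ h, changeLevel_eq_cast_of_dvd' _ _ h]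

omit [NeZero N₁] in
lemma apply_natCast_ne_zero {p : ℕ} (hp : p.Prime) (h : ¬ p ∣ N₁) (χ : DirichletCharacter ℂ N₁) :
    χ (p : ZMod N₁) ≠ 0 :=
  (((ZMod.isUnit_iff_coprime _ _).2 (hp.coprime_iff_not_dvd.2 h)).map χ).ne_zero

omit [NeZero N₁] [NeZero N₂] in
/-- A prime dividing exactly one of two levels ramifies in the product. -/
lemma dvd_conductor_mul (hp1 : χ₁.IsPrimitive) (h2 : χ₂ ^ 2 = 1) {p L : ℕ} [NeZero L]
    (hL1 : N₁ ∣ L) (hL2 : N₂ ∣ L) (hp : p.Prime) (h1 : p ∣ N₁) (h : ¬ p ∣ N₂) :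
    p ∣ (changeLevel hL1 χ₁ * changeLevel hL2 χ₂).conductor := by
  have h3 : changeLevel hL1 χ₁ * changeLevel hL2 χ₂ * changeLevel hL2 χ₂ =
      changeLevel hL1 χ₁ := by
    rw [mul_assoc, ← map_mul, ← sq, h2, map_one, mul_one]
  have h4 := conductor_mul_dvd_lcm_conductor (changeLevel hL1 χ₁ * changeLevel hL2 χ₂)
    (changeLevel hL2 χ₂)
  rw [h3, conductor_changeLevel, conductor_changeLevel, (isPrimitive_def _).1 hp1] at h4
  have h5 := h4.trans (Nat.lcm_dvd_mul _ _)
  rcases (hp.dvd_mul).1 (h1.trans h5) with h6 | h6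
  · exact h6
  · exact absurd (h6.trans (conductor_dvd_level _)) h

/-- The primitive character inducing the product of two distinct odd real primitive characters. -/
theorem IsRealPrimitive.exists_product (hr1 : χ₁.IsRealPrimitive) (hr2 : χ₂.IsRealPrimitive)
    (ho1 : χ₁.Odd) (ho2 : χ₂.Odd) (hN : N₁ ≠ N₂) :
    ∃ (N₃ : ℕ) (_ : NeZero N₃) (χ₃ : DirichletCharacter ℂ N₃), χ₃.IsRealPrimitive ∧ χ₃.Even ∧
      N₃ ≤ N₁ * N₂ ∧ ∀ p : ℕ, p.Prime → ProductTrivialAt χ₁ χ₂ χ₃ p := by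
  have : NeZero (N₁.lcm N₂) := ⟨Nat.lcm_ne_zero (NeZero.ne _) (NeZero.ne _)⟩
  have hne : NeZero (χ₁.mul χ₂).conductor := ⟨conductor_ne_zero _⟩
  have hsq : (χ₁.mul χ₂) ^ 2 = 1 := by
    rw [DirichletCharacter.mul, mul_pow, ← map_pow, ← map_pow, hr1.sq_eq_one, hr2.sq_eq_one,
      map_one, map_one, mul_one]
  have hone : χ₁.mul χ₂ ≠ 1 := by
    intro h
    have h3 : changeLevel (Nat.dvd_lcm_right N₁ N₂) χ₂ =
        changeLevel (Nat.dvd_lcm_left N₁ N₂) χ₁ := by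
      rw [← one_mul (changeLevel _ χ₂), ← h, DirichletCharacter.mul, mul_assoc, ← map_mul, ← sq,
        hr2.sq_eq_one, map_one, mul_one]
    have h4 := congrArg conductor h3
    rw [conductor_changeLevel, conductor_changeLevel, (isPrimitive_def _).1 hr1.isPrimitive,
      (isPrimitive_def _).1 hr2.isPrimitive] at h4
    exact hN h4.symm
  refine ⟨_, hne, χ₁.primitive_mul χ₂, ⟨primitive_mul_isPrimitive _ _, ?_, ?_⟩, ?_, ?_, ?_⟩
  · rintro h
    apply hone
    rw [← changeLevel_primitiveCharacter (χ₁.mul χ₂), ← mul_def, h, map_one]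
  · apply changeLevel_injective (conductor_dvd_level (χ₁.mul χ₂))
    rw [map_pow, mul_def, changeLevel_primitiveCharacter, hsq, map_one]
  · have := primitive_mul_apply (χ₁ := χ₁) (χ₂ := χ₂) (a := -1) isCoprime_one_left.neg_left
      isCoprime_one_left.neg_left
    push_cast at this
    rw [DirichletCharacter.Even, this, ho1, ho2]
    norm_num
  · exact (Nat.le_of_dvd (Nat.pos_of_neZero _) (conductor_dvd_level _)).trans
      (Nat.le_of_dvd (Nat.mul_pos (Nat.pos_of_neZero _) (Nat.pos_of_neZero _))
        (Nat.lcm_dvd_mul _ _))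
  · intro p hp
    by_cases h1 : p ∣ N₁ <;> by_cases h2 : p ∣ N₂
    · exact .inr (.inl ⟨apply_natCast_eq_zero hp h1 _, apply_natCast_eq_zero hp h2 _⟩)
    · exact .inr (.inr (.inl ⟨apply_natCast_eq_zero hp h1 _,
        apply_natCast_eq_zero hp (dvd_conductor_mul hr1.isPrimitive hr2.sq_eq_one _ _ hp h1 h2) _⟩))
    · refine .inr (.inr (.inr ⟨apply_natCast_eq_zero hp h2 _,
        apply_natCast_eq_zero hp ?_ _⟩))
      rw [DirichletCharacter.mul, mul_comm]
      exact dvd_conductor_mul hr2.isPrimitive hr1.sq_eq_one _ _ hp h2 h1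
    · left
      have c1 : IsCoprime (p : ℤ) N₁ := Nat.isCoprime_iff_coprime.2 (hp.coprime_iff_not_dvd.2 h1)
      have c2 : IsCoprime (p : ℤ) N₂ := Nat.isCoprime_iff_coprime.2 (hp.coprime_iff_not_dvd.2 h2)
      have h3 := primitive_mul_apply (χ₁ := χ₁) (χ₂ := χ₂) c1 c2
      push_cast at h3
      have n1 : χ₁ p ≠ 0 := apply_natCast_ne_zero hp h1 _
      have n2 : χ₂ p ≠ 0 := apply_natCast_ne_zero hp h2 _
      rw [h3]
      rcases apply_mem_of_sq hr1.sq_eq_one (p : ZMod N₁) with e1 | e1 | e1 <;>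
        rcases apply_mem_of_sq hr2.sq_eq_one (p : ZMod N₂) with e2 | e2 | e2 <;> simp_all

end DirichletCharacter

namespace DirichletCharacter

lemma exists_of_periodic {N : ℕ} [NeZero N] (f : ℕ → ℤ) (h1 : f 1 = 1)
    (hmul : ∀ a b, f (a * b) = f a * f b) (hper : ∀ a, f (a % N) = f a)
    (h0 : ∀ a : ℕ, ¬ a.Coprime N → f a = 0) :
    ∃ χ : DirichletCharacter ℂ N, ∀ n : ℕ, χ n = f n := by
  refine ⟨{ toFun := fun x ↦ f x.val, map_one' := ?_, map_mul' := ?_, map_nonunit' := ?_ }, ?_⟩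
  · have := ZMod.val_natCast N 1
    rw [Nat.cast_one] at this
    rw [this, hper, h1, Int.cast_one]
  · intro x y
    rw [ZMod.val_mul, hper, hmul, Int.cast_mul]
  · intro x hx
    rw [h0, Int.cast_zero]
    intro hc
    apply hx
    rw [← ZMod.natCast_zmod_val x]
    exact (ZMod.isUnit_iff_coprime _ _).2 hc
  · intro n
    change ((f (ZMod.val (n : ZMod N)) : ℤ) : ℂ) = _
    rw [ZMod.val_natCast, hper]

/-- A character that is nontrivial on the kernel of reduction modulo `N / q` for every prime
`q ∣ N` is primitive. -/
lemma isPrimitive_of_forall_prime {N : ℕ} [NeZero N] {χ : DirichletCharacter ℂ N}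
    (h : ∀ q : ℕ, q.Prime → q ∣ N → ∃ n : ℕ, n ≡ 1 [MOD N / q] ∧ χ n = -1) :
    χ.IsPrimitive := by
  rw [isPrimitive_def]
  by_contra hne
  obtain ⟨k, hk⟩ := conductor_dvd_level χ
  have hk1 : k ≠ 1 := by
    rintro rfl
    exact hne (by rw [mul_one] at hk; exact hk.symm)
  obtain ⟨q, hq, l, rfl⟩ := Nat.exists_prime_and_dvd hk1
  obtain ⟨n, hn, hχ⟩ := h q hq (hk ▸ (dvd_mul_right q l).mul_left _)
  have hd : N / q = χ.conductor * l := by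
    apply Nat.div_eq_of_eq_mul_left hq.pos
    conv_lhs => rw [hk]
    ring
  rw [hd] at hn
  have hcop : IsCoprime (n : ℤ) N := by
    rw [← apply_ne_zero_iff χ]
    simp [hχ]
  obtain ⟨hdv, χ₀, h0⟩ := factorsThrough_conductor χ
  have h2 := changeLevel_eq_cast_of_dvd' χ₀ hdv hcop
  rw [← h0] at h2
  have h3 : ((n : ℤ) : ZMod χ.conductor) = 1 := by
    have := (ZMod.natCast_eq_natCast_iff _ _ _).2 (hn.of_mul_right l)
    exact_mod_cast this
  rw [h3, map_one, Int.cast_natCast, hχ] at h2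
  norm_num at h2

/-- A quadratic character is determined by its values at large primes. -/
lemma ext_of_prime {N : ℕ} [NeZero N] {χ ψ : DirichletCharacter ℂ N} (B : ℕ)
    (h : ∀ p : ℕ, p.Prime → B < p → χ p = ψ p) : χ = ψ := by
  ext a
  obtain ⟨p, hpB, hp, hpa⟩ := Nat.forall_exists_prime_gt_and_eq_mod a.isUnit B
  rw [← hpa]
  exact h p hp hpB

end DirichletCharacter

namespace jacobiSym

lemma exists_eq_neg_one {q : ℕ} (hq : q.Prime) (hq2 : q ≠ 2) : ∃ a : ℕ, J(a | q) = -1 := by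
  have : Fact q.Prime := ⟨hq⟩
  obtain ⟨a, ha⟩ := FiniteField.exists_nonsquare (F := ZMod q)
    (by rwa [ringChar.eq (ZMod q) q])
  refine ⟨a.val, ?_⟩
  rw [ZMod.nonsquare_iff_jacobiSym_eq_neg_one]
  simpa using ha

lemma of_modEq {a b n : ℕ} (h : a ≡ b [MOD n]) : J(a | n) = J(b | n) :=
  mod_left' (by exact_mod_cast h)

lemma of_modEq_one {a n : ℕ} (h : a ≡ 1 [MOD n]) : J(a | n) = 1 := by
  rw [of_modEq h, Nat.cast_one, one_left]

/-- For squarefree odd `n` and a prime `q ∣ n`, there are residues that are `1` modulo `n / q` and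
modulo a coprime modulus, with Jacobi symbol `-1`. -/
lemma exists_modEq_of_squarefree {n q k : ℕ} (hn : Squarefree n) (hodd : Odd n) (hq : q.Prime)
    (hqn : q ∣ n) (hk : k.Coprime n) :
    ∃ a : ℕ, a ≡ 1 [MOD k * (n / q)] ∧ J(a | n) = -1 := by
  obtain ⟨l, rfl⟩ := hqn
  have hql : q.Coprime l := Nat.coprime_of_squarefree_mul hn
  have hl0 : NeZero l := ⟨by rintro rfl; simp at hn⟩
  have hq0 : NeZero q := ⟨hq.ne_zero⟩
  obtain ⟨b, hb⟩ := exists_eq_neg_one hq (by rintro rfl; exact absurd hodd (by simp))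
  rw [Nat.mul_div_cancel_left l hq.pos]
  obtain ⟨a, ha1, ha2⟩ := Nat.chineseRemainder
    (Nat.Coprime.mul_right hk.coprime_mul_right_right.symm hql) b 1
  refine ⟨a, ha2, ?_⟩
  rw [mul_right, of_modEq ha1, hb, of_modEq_one (ha2.of_mul_left k), mul_one]

lemma exists_neg_eq_neg_one {M q : ℕ} (hM : Squarefree M) (hM4 : M % 4 = 1 ∨ ∃ k, M = 2 * k ∧ Odd k)
    (hq : q.Prime) (hqM : q ∣ 4 * M) :
    ∃ n : ℕ, n ≡ 1 [MOD 4 * M / q] ∧ Odd n ∧ J(-(M : ℤ) | n) = -1 := by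
  rcases hM4 with hM4 | ⟨k, rfl, hk⟩
  · have hMo : Odd M := Nat.odd_iff.2 (by omega)
    rcases eq_or_ne q 2 with rfl | hq2
    · obtain ⟨n, hn1, hn2⟩ := Nat.chineseRemainder (n := 4) (m := M)
        (Nat.Coprime.pow_left 2 hMo.coprime_two_left) 3 1
      have hn4 : n % 4 = 3 := hn1
      have hno : Odd n := Nat.odd_iff.2 (by omega)
      refine ⟨n, ?_, hno, ?_⟩
      · rw [show 4 * M / 2 = 2 * M by omega]
        exact (Nat.modEq_and_modEq_iff_modEq_mul hMo.coprime_two_left).1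
          ⟨Nat.odd_iff.1 hno, hn2⟩
      · rw [jacobiSym.neg _ hno, ZMod.χ₄_nat_three_mod_four hn4,
          quadratic_reciprocity_one_mod_four hM4 hno, of_modEq_one hn2, mul_one]
    · have hqM' : q ∣ M := (Nat.Coprime.pow_right 2 ((Nat.coprime_primes hq Nat.prime_two).2
        hq2)).dvd_of_dvd_mul_left hqM
      obtain ⟨n, hn, hn'⟩ := exists_modEq_of_squarefree (k := 4) hM hMo hq hqM'
        (Nat.Coprime.pow_left 2 hMo.coprime_two_left)
      have hn4 : n % 4 = 1 := hn.of_mul_right _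
      have hno : Odd n := Nat.odd_iff.2 (by omega)
      refine ⟨n, by rwa [Nat.mul_div_assoc _ hqM'], hno, ?_⟩
      rw [jacobiSym.neg _ hno, ZMod.χ₄_nat_one_mod_four hn4,
        quadratic_reciprocity_one_mod_four hM4 hno, hn', one_mul]
  · have hks : Squarefree k := hM.of_mul_right
    have h8 : 4 * (2 * k) = 8 * k := by ring
    have key {n : ℕ} (hn4 : n % 4 = 1) (hno : Odd n) :
        J(-((2 * k : ℕ) : ℤ) | n) = J(2 | n) * J(n | k) := by
      rw [jacobiSym.neg _ hno, ZMod.χ₄_nat_one_mod_four hn4, one_mul, Nat.cast_mul, mul_left,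
        quadratic_reciprocity_one_mod_four' hk hn4, Nat.cast_two]
    rw [h8] at hqM ⊢
    rcases eq_or_ne q 2 with rfl | hq2
    · obtain ⟨n, hn1, hn2⟩ := Nat.chineseRemainder (n := 8) (m := k)
        (Nat.Coprime.pow_left 3 hk.coprime_two_left) 5 1
      have hn8 : n % 8 = 5 := hn1
      have hno : Odd n := Nat.odd_iff.2 (by omega)
      refine ⟨n, ?_, hno, ?_⟩
      · rw [show 8 * k / 2 = 4 * k by omega]
        exact (Nat.modEq_and_modEq_iff_modEq_mul
          (Nat.Coprime.pow_left 2 hk.coprime_two_left)).1 ⟨by change n % 4 = 1; omega, hn2⟩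
      · rw [key (by omega) hno, of_modEq_one hn2, mul_one, at_two hno,
          ZMod.χ₈_nat_eq_if_mod_eight, if_neg (by omega), if_neg (by omega)]
    · have hqk : q ∣ k := (Nat.Coprime.pow_right 3 ((Nat.coprime_primes hq Nat.prime_two).2
        hq2)).dvd_of_dvd_mul_left hqM
      obtain ⟨n, hn, hn'⟩ := exists_modEq_of_squarefree (k := 8) hks hk hq hqk
        (Nat.Coprime.pow_left 3 hk.coprime_two_left)
      have hn8 : n % 8 = 1 := hn.of_mul_right _
      have hno : Odd n := Nat.odd_iff.2 (by omega)
      refine ⟨n, by rwa [Nat.mul_div_assoc _ hqk], hno, ?_⟩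
      rw [key (by omega) hno, hn', at_two hno, ZMod.χ₈_nat_eq_if_mod_eight, if_neg (by omega),
        if_pos (by omega), one_mul]

end jacobiSym

section Kronecker

open DirichletCharacter

variable {D : ℤ}

/-- The properties of the Kronecker character of a negative fundamental discriminant that are used
below. -/
structure IsOddKroneckerChar (D : ℤ) (χ : DirichletCharacter ℂ D.natAbs) : Prop where
  isKroneckerChar : IsKroneckerChar D χ
  isPrimitive : χ.IsPrimitive
  odd : χ.Odd
  sq_eq_one : χ ^ 2 = 1
  mod_eight : χ ((2 : ℕ) : ZMod D.natAbs) = 1 → D % 8 = 1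

lemma DirichletCharacter.sq_eq_one_of_int {N : ℕ} [NeZero N] {χ : DirichletCharacter ℂ N}
    {f : ℕ → ℤ} (hf : ∀ n, f n = 0 ∨ f n = 1 ∨ f n = -1) (h : ∀ n : ℕ, χ n = f n) : χ ^ 2 = 1 := by
  ext a
  have h1 := h (a : ZMod N).val
  rw [ZMod.natCast_zmod_val] at h1
  have h2 : χ a ≠ 0 := (a.isUnit.map χ).ne_zero
  rw [MulChar.pow_apply_coe, MulChar.one_apply_coe, h1]
  rcases hf (a : ZMod N).val with h3 | h3 | h3
  · rw [h1, h3] at h2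
    simp at h2
  all_goals rw [h3]; norm_num

lemma DirichletCharacter.odd_of_apply {N : ℕ} [NeZero N] {χ : DirichletCharacter ℂ N}
    (h : χ ((N - 1 : ℕ) : ZMod N) = -1) : χ.Odd := by
  rw [Nat.cast_sub (Nat.one_le_iff_ne_zero.2 (NeZero.ne N))] at h
  simpa [DirichletCharacter.Odd] using h

lemma exists_isOddKroneckerChar_of_mod_four (h1 : D % 4 = 1) (hs : Squarefree D) (hneg : D < 0) :
    ∃ χ, IsOddKroneckerChar D χ := by
  set N := D.natAbs with hNdef
  have hN : (N : ℤ) = -D := by omega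
  have hN4 : N % 4 = 3 := by omega
  have hodd : Odd N := Nat.odd_iff.2 (by omega)
  have hN0 : NeZero N := ⟨by omega⟩
  have hsN : Squarefree N := Int.squarefree_natAbs.2 hs
  obtain ⟨χ, hχ⟩ := exists_of_periodic (N := N) (fun n ↦ J(n | N)) (by simp)
    (fun a b ↦ by push_cast; exact jacobiSym.mul_left _ _ _)
    (fun a ↦ jacobiSym.of_modEq (Nat.mod_modEq a N))
    (fun a ha ↦ jacobiSym.eq_zero_iff_not_coprime.2 (by rwa [Int.gcd_natCast_natCast]))
  refine ⟨χ, ?_, ?_, ?_, ?_, ?_⟩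
  · intro p hp hp2 hpD
    have : Fact p.Prime := ⟨hp⟩
    have hpo : Odd p := hp.odd_of_ne_two hp2
    rw [hχ, jacobiSym.legendreSym.to_jacobiSym, show D = -(N : ℤ) by omega, jacobiSym.neg _ hpo]
    congr 1
    rcases Nat.odd_mod_four_iff.1 (Nat.odd_iff.1 hpo) with h4 | h4
    · rw [ZMod.χ₄_nat_one_mod_four h4, one_mul, jacobiSym.quadratic_reciprocity_one_mod_four h4 hodd]
    · rw [ZMod.χ₄_nat_three_mod_four h4, jacobiSym.quadratic_reciprocity_three_mod_four h4 hN4,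
        neg_one_mul]
  · refine isPrimitive_of_forall_prime fun q hq hqN ↦ ?_
    obtain ⟨a, ha, ha'⟩ := jacobiSym.exists_modEq_of_squarefree hsN hodd hq hqN
      (Nat.coprime_one_left N)
    refine ⟨a, by rwa [one_mul] at ha, ?_⟩
    rw [hχ, ha', Int.cast_neg, Int.cast_one]
  · refine odd_of_apply ?_
    rw [hχ, jacobiSym.mod_left' (a₂ := -1), jacobiSym.at_neg_one hodd,
      ZMod.χ₄_nat_three_mod_four hN4, Int.cast_neg, Int.cast_one]
    rw [Nat.cast_sub (by omega), Nat.cast_one, sub_eq_neg_add, Int.add_emod_right]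
  · exact sq_eq_one_of_int (fun n ↦ jacobiSym.trichotomy n N) hχ
  · intro h
    rw [hχ, Nat.cast_two, jacobiSym.at_two hodd, ZMod.χ₈_nat_eq_if_mod_eight] at h
    split_ifs at h with h2 h3
    · norm_num at h
    · omega
    · norm_num at h

lemma exists_isOddKroneckerChar_four_mul {m : ℤ} (hD : D = 4 * m) (hs : Squarefree m)
    (hm : m % 4 = 2 ∨ m % 4 = 3) (hneg : D < 0) : ∃ χ, IsOddKroneckerChar D χ := by
  set N := D.natAbs with hNdef
  set M := m.natAbs with hMdef
  have hM : m = -(M : ℤ) := by omega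
  have hNM : N = 4 * M := by omega
  have hN0 : NeZero N := ⟨by omega⟩
  have hsM : Squarefree M := Int.squarefree_natAbs.2 hs
  have hfo {n : ℕ} (h : Odd n) : (if Odd n then J(m | n) else 0) = J(m | n) := if_pos h
  obtain ⟨χ, hχ⟩ := exists_of_periodic (N := N) (fun n ↦ if Odd n then J(m | n) else 0) (by simp)
    (fun a b ↦ by
      by_cases ha : Odd a
      · by_cases hb : Odd b
        · have : NeZero a := ⟨ha.pos.ne'⟩
          have : NeZero b := ⟨hb.pos.ne'⟩
          simp only [Nat.odd_mul, ha, hb, and_self, if_true]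
          exact jacobiSym.mul_right _ _ _
        · simp [Nat.odd_mul, hb]
      · simp [Nat.odd_mul, ha])
    (fun a ↦ by
      have h2 : Odd (a % N) ↔ Odd a := by
        rw [Nat.odd_iff, Nat.odd_iff, Nat.mod_mod_of_dvd _ ⟨2 * M, by rw [hNM]; ring⟩]
      simp only [h2]
      split_ifs with h
      · rw [jacobiSym.mod_right m h, ← hMdef, ← hNM]
      · rfl)
    (fun a ha ↦ by
      split_ifs with h
      · refine jacobiSym.eq_zero_iff.2 ⟨h.pos.ne', fun hc ↦ ha ?_⟩
        rw [Int.gcd_comm, Int.gcd_eq_natAbs_gcd_natAbs, Int.natAbs_natCast] at hc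
        rw [hNM]
        exact Nat.Coprime.mul_right (Nat.Coprime.pow_right 2 h.coprime_two_right) hc
      · rfl)
  refine ⟨χ, ?_, ?_, ?_, ?_, ?_⟩
  · intro p hp hp2 hpD
    have : Fact p.Prime := ⟨hp⟩
    have hpo : Odd p := hp.odd_of_ne_two hp2
    rw [hχ, hfo hpo, jacobiSym.legendreSym.to_jacobiSym, hD, jacobiSym.mul_left,
      jacobiSym.at_four hpo, one_mul]
  · refine isPrimitive_of_forall_prime fun q hq hqN ↦ ?_
    suffices h : ∃ n : ℕ, n ≡ 1 [MOD N / q] ∧ _root_.Odd n ∧ J(m | n) = -1 by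
      obtain ⟨n, h1, h2, h3⟩ := h
      exact ⟨n, h1, by rw [hχ, hfo h2, h3, Int.cast_neg, Int.cast_one]⟩
    rw [hM, hNM]
    replace hqN : q ∣ 4 * M := hNM ▸ hqN
    have hMm : M % 4 = 1 ∨ ∃ k, M = 2 * k ∧ _root_.Odd k := by
      rcases hm with hm | hm
      · exact Or.inr ⟨M / 2, by omega, Nat.odd_iff.2 (by omega)⟩
      · exact Or.inl (by omega)
    clear_value M
    exact jacobiSym.exists_neg_eq_neg_one hsM hMm hq hqN
  · refine odd_of_apply ?_
    have ho : _root_.Odd (N - 1) := Nat.odd_iff.2 (by omega)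
    have h4 : (N - 1) % 4 = 3 := by omega
    rw [hχ, hfo ho, hM, jacobiSym.neg _ ho, ZMod.χ₄_nat_three_mod_four h4]
    have h5 : J(M | (N - 1)) = 1 := by
      have h6 : J(4 * M | (N - 1)) = 1 := by
        rw [jacobiSym.mod_left' (a₂ := 1), jacobiSym.one_left]
        rw [show (4 * M : ℤ) = 1 + (N - 1 : ℕ) by omega, Int.add_emod_right]
      rwa [jacobiSym.mul_left, jacobiSym.at_four ho, one_mul] at h6
    rw [h5]
    norm_num
  · refine sq_eq_one_of_int (fun n ↦ ?_) hχ
    split_ifs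
    · exact jacobiSym.trichotomy m n
    · exact Or.inl rfl
  · intro h
    rw [hχ, if_neg (by decide)] at h
    norm_num at h

/-- Every negative fundamental discriminant has a Kronecker character. -/
theorem IsFundamentalDiscriminant.exists_isOddKroneckerChar (hD : IsFundamentalDiscriminant D)
    (hneg : D < 0) : ∃ χ, IsOddKroneckerChar D χ := by
  obtain ⟨-, ⟨h1, h2⟩ | ⟨m, h1, h2, h3⟩⟩ := hD
  · exact exists_isOddKroneckerChar_of_mod_four h1 h2 hneg
  · exact exists_isOddKroneckerChar_four_mul h1 h2 h3 hneg

lemma IsKroneckerChar.unique (hneg : D < 0) {χ ψ : DirichletCharacter ℂ D.natAbs}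
    (hχ : IsKroneckerChar D χ) (hψ : IsKroneckerChar D ψ) : χ = ψ := by
  have : NeZero D.natAbs := ⟨by omega⟩
  refine ext_of_prime (2 + D.natAbs) fun p hp hlt ↦ ?_
  have h1 : ¬ (p : ℤ) ∣ D := fun h ↦ by
    have := Nat.le_of_dvd (by omega) (Int.natCast_dvd.1 h)
    omega
  rw [hχ p hp (by omega) h1, hψ p hp (by omega) h1]

lemma IsOddKroneckerChar.isRealPrimitive {χ : DirichletCharacter ℂ D.natAbs}
    (h : IsOddKroneckerChar D χ) : χ.IsRealPrimitive where
  isPrimitive := h.isPrimitive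
  sq_eq_one := h.sq_eq_one
  ne_one := by
    rintro rfl
    have := h.odd
    rw [DirichletCharacter.Odd, MulChar.one_apply (isUnit_neg_one)] at this
    norm_num at this

end Kronecker

namespace NumberField

variable {K : Type*} [Field K] [NumberField K]

lemma exists_sq_eq_of_trace_eq_zero (h2 : Module.finrank ℚ K = 2) {x : K}
    (hx : Algebra.trace ℚ K x = 0) : ∃ r : ℚ, x ^ 2 = algebraMap ℚ K r := by
  let b := Module.finBasisOfFinrankEq ℚ K h2
  refine ⟨-(Algebra.leftMulMatrix b x).det, ?_⟩
  have h3 := Matrix.aeval_self_charpoly (Algebra.leftMulMatrix b x)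
  rw [Matrix.charpoly_fin_two, ← Algebra.trace_eq_matrix_trace b, hx] at h3
  apply Algebra.leftMulMatrix_injective b
  simp only [map_zero, zero_mul, sub_zero, map_add, map_pow, Polynomial.aeval_X,
    Polynomial.aeval_C] at h3
  rw [map_pow, map_neg, map_neg, AlgHom.commutes, ← add_eq_zero_iff_eq_neg, h3]

/-- The ring of integers of a quadratic field contains a square root of the discriminant. -/
theorem exists_sq_eq_discr (h2 : Module.finrank ℚ K = 2) :
    ∃ δ : 𝓞 K, δ ^ 2 = (discr K : 𝓞 K) ∧ Algebra.trace ℚ K (algebraMap (𝓞 K) K δ) = 0 := by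
  have hker : 0 < Module.finrank ℚ (Algebra.trace ℚ K).ker := by
    have h3 := (Algebra.trace ℚ K).finrank_range_add_finrank_ker
    have h4 : Module.finrank ℚ (Algebra.trace ℚ K).range ≤ 1 :=
      (Submodule.finrank_le _).trans_eq (Module.finrank_self ℚ)
    omega
  have := Module.finrank_pos_iff.1 hker
  obtain ⟨⟨x, hx⟩, hx0⟩ := exists_ne (0 : (Algebra.trace ℚ K).ker)
  replace hx0 : x ≠ 0 := fun h ↦ hx0 (Subtype.ext h)
  replace hx : Algebra.trace ℚ K x = 0 := hx
  obtain ⟨r, hr⟩ := exists_sq_eq_of_trace_eq_zero h2 hx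
  have hr0 : r ≠ 0 := by
    rintro rfl
    rw [map_zero] at hr
    exact hx0 (pow_eq_zero_iff two_ne_zero |>.1 hr)
  have hcard : Fintype.card (Module.Free.ChooseBasisIndex ℤ (𝓞 K)) = 2 := by
    rw [← Module.finrank_eq_card_basis (integralBasis K), h2]
  let e := Fintype.equivFinOfCardEq hcard
  let b := (integralBasis K).reindex e
  have hb : Algebra.discr ℚ b = discr K := by
    rw [coe_discr, Module.Basis.coe_reindex, Algebra.discr_reindex]
  have h3 := Algebra.discr_of_matrix_vecMul (A := ℚ) b (b.toMatrix ![1, x])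
  rw [b.toMatrix_map_vecMul, hb] at h3
  have h4 : Algebra.discr ℚ ![1, x] = 4 * r := by
    rw [Algebra.discr_def, Matrix.det_fin_two]
    simp only [Algebra.traceMatrix_apply, Algebra.traceForm_apply, Matrix.cons_val_zero,
      Matrix.cons_val_one, mul_one, one_mul, hx, ← sq, hr,
      Algebra.trace_algebraMap, h2]
    rw [one_pow, ← map_one (algebraMap ℚ K), Algebra.trace_algebraMap, h2]
    simp
    ring
  rw [h4] at h3
  set d := (b.toMatrix ![1, x]).det
  have hd : d ≠ 0 := by
    intro h
    rw [h] at h3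
    apply hr0
    simpa using h3
  have h5 : ((2 / d) • x) ^ 2 = (algebraMap ℚ K) (discr K : ℚ) := by
    rw [smul_pow, hr, Algebra.smul_def, ← map_mul]
    congr 1
    field_simp
    linarith
  have hint : IsIntegral ℤ ((2 / d) • x) := by
    refine IsIntegral.of_pow two_pos ?_
    rw [h5, map_intCast]
    exact isIntegral_algebraMap (R := ℤ) (x := discr K)
  obtain ⟨y, hy⟩ := IsIntegralClosure.isIntegral_iff (A := 𝓞 K).1 hint
  refine ⟨y, ?_, ?_⟩
  · apply FaithfulSMul.algebraMap_injective (𝓞 K) K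
    rw [map_intCast] at h5
    rw [map_pow, map_intCast, hy, h5]
  · rw [hy, map_smul, hx, smul_zero]

variable (K) in
lemma nrPlaces_of_discr_neg (h2 : Module.finrank ℚ K = 2) (hneg : discr K < 0) :
    InfinitePlace.nrRealPlaces K = 0 ∧ InfinitePlace.nrComplexPlaces K = 1 := by
  have h3 := sign_discr K
  rw [Int.sign_eq_neg_one_of_neg hneg] at h3
  have h4 := InfinitePlace.card_add_two_mul_card_eq_rank K
  rw [h2] at h4
  have h5 : InfinitePlace.nrComplexPlaces K ≠ 0 := by
    intro h
    rw [h] at h3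
    norm_num at h3
  omega

variable (K) in
lemma regulator_eq_one (h2 : Module.finrank ℚ K = 2) (hneg : discr K < 0) :
    Units.regulator K = 1 := by
  classical
  obtain ⟨hr, hc⟩ := nrPlaces_of_discr_neg K h2 hneg
  have h3 : Units.rank K = 0 := by
    rw [Units.rank, InfinitePlace.card_eq_nrRealPlaces_add_nrComplexPlaces, hr, hc]
  rw [Units.regulator_eq_det']
  have : IsEmpty (Fin (Units.rank K)) := by rw [h3]; infer_instance
  have : IsEmpty {w : InfinitePlace K // w ≠ Units.dirichletUnitTheorem.w₀} :=
    (Units.equivFinRank K).symm.isEmpty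
  rw [Matrix.det_isEmpty, abs_one]

variable (K) in
lemma dedekindZeta_residue_le (h2 : Module.finrank ℚ K = 2) (hneg : discr K < 0) :
    dedekindZeta_residue K ≤ Real.pi * classNumber K / √|(discr K : ℝ)| := by
  obtain ⟨hr, hc⟩ := nrPlaces_of_discr_neg K h2 hneg
  have h3 : (2 : ℝ) ≤ Units.torsionOrder K := by
    exact_mod_cast Nat.le_of_dvd (Units.torsionOrder_pos K) (Units.even_torsionOrder K).two_dvd
  have h4 : 0 < √|(discr K : ℝ)| :=
    Real.sqrt_pos.2 (abs_pos.2 (Int.cast_ne_zero.2 hneg.ne))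
  rw [dedekindZeta_residue_def, hr, hc, regulator_eq_one K h2 hneg, pow_zero, one_mul, pow_one, mul_one, div_le_div_iff₀ (by positivity) h4]
  calc 2 * Real.pi * classNumber K * √|(discr K : ℝ)|
      ≤ Units.torsionOrder K * Real.pi * classNumber K * √|(discr K : ℝ)| := by gcongr
    _ = _ := by ring

end NumberField

namespace NumberField

variable {K : Type*} [Field K] [NumberField K]

lemma absNorm_span_natCast_of_finrank (h2 : Module.finrank ℚ K = 2) (n : ℕ) :
    Ideal.absNorm (Ideal.span {(n : 𝓞 K)}) = n ^ 2 := by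
  rw [Ideal.absNorm_span_singleton, Algebra.norm_natCast, RingOfIntegers.rank, h2, Int.natAbs_pow,
    Int.natAbs_natCast]

/-- If `x` and `y` have the same trace `x + y`, prime to `p`, and their product is divisible by
`p`, then `p` splits. -/
lemma exists_coprime_absNorm_eq (h2 : Module.finrank ℚ K = 2) {p : ℕ} (hp : p.Prime) {x y : 𝓞 K}
    {t : ℤ} (hxy : x + y = t) (hx : Algebra.trace ℤ (𝓞 K) x = t)
    (hy : Algebra.trace ℤ (𝓞 K) y = t) (ht : ¬ (p : ℤ) ∣ t) (hdvd : (p : 𝓞 K) ∣ x * y) :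
    ∃ P Q : Ideal (𝓞 K), P.absNorm = p ∧ Q.absNorm = p ∧ IsCoprime P Q := by
  have hnd {z : 𝓞 K} (hz : Algebra.trace ℤ (𝓞 K) z = t) : ¬ (p : 𝓞 K) ∣ z := by
    rintro ⟨w, rfl⟩
    rw [← nsmul_eq_mul, map_nsmul, nsmul_eq_mul] at hz
    exact ht ⟨_, hz.symm⟩
  have hcop : IsCoprime (Ideal.span {(p : 𝓞 K), x}) (Ideal.span {(p : 𝓞 K), y}) := by
    rw [Ideal.isCoprime_iff_exists]
    have h3 : IsCoprime (p : ℤ) t :=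
      (Nat.prime_iff_prime_int.1 hp).coprime_iff_not_dvd.2 ht
    obtain ⟨a, b, hab⟩ := h3
    refine ⟨a * p + b * x, ?_, b * y, ?_, ?_⟩
    · exact Ideal.mem_span_pair.2 ⟨a, b, rfl⟩
    · exact Ideal.mem_span_pair.2 ⟨0, b, by ring⟩
    · have := congrArg (Int.cast : ℤ → 𝓞 K) hab
      push_cast at this
      rw [← this, ← hxy]
      ring
  have hmul : Ideal.span {(p : 𝓞 K), x} * Ideal.span {(p : 𝓞 K), y} = Ideal.span {(p : 𝓞 K)} := by
    apply le_antisymm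
    · rw [Ideal.span_pair_mul_span_pair, Ideal.span_le]
      intro z hz
      simp only [Set.mem_insert_iff, Set.mem_singleton_iff] at hz
      rw [SetLike.mem_coe, Ideal.mem_span_singleton]
      rcases hz with rfl | rfl | rfl | rfl
      · exact dvd_mul_right _ _
      · exact dvd_mul_right _ _
      · exact dvd_mul_left _ _
      · exact hdvd
    · rw [Ideal.mul_eq_inf_of_isCoprime hcop, Ideal.span_singleton_le_iff_mem]
      exact ⟨Ideal.subset_span (by simp), Ideal.subset_span (by simp)⟩
  have hnorm := congrArg Ideal.absNorm hmul
  rw [map_mul, absNorm_span_natCast_of_finrank h2] at hnorm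
  have h3 := (hp.mul_eq_prime_sq_iff ?_ ?_).1 hnorm
  · exact ⟨_, _, h3.1, h3.2, hcop⟩
  · intro h
    rw [Ideal.absNorm_eq_one_iff] at h
    rw [h, Ideal.top_mul] at hmul
    exact hnd hy (Ideal.mem_span_singleton.1 (hmul ▸ Ideal.subset_span (by simp)))
  · intro h
    rw [Ideal.absNorm_eq_one_iff] at h
    rw [h, Ideal.mul_top] at hmul
    exact hnd hx (Ideal.mem_span_singleton.1 (hmul ▸ Ideal.subset_span (by simp)))

lemma exists_absNorm_eq_of_sq (h2 : Module.finrank ℚ K = 2) {p : ℕ} {x a b c : 𝓞 K}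
    (hdvd : (p : 𝓞 K) ∣ x * x) (h : a * (p * p) + b * (p * x) + c * (x * x) = p) :
    ∃ P : Ideal (𝓞 K), P.absNorm = p := by
  refine ⟨Ideal.span {(p : 𝓞 K), x}, ?_⟩
  have hmul : Ideal.span {(p : 𝓞 K), x} * Ideal.span {(p : 𝓞 K), x} = Ideal.span {(p : 𝓞 K)} := by
    rw [Ideal.span_pair_mul_span_pair]
    apply le_antisymm
    · rw [Ideal.span_le]
      intro z hz
      simp only [Set.mem_insert_iff, Set.mem_singleton_iff] at hz
      rw [SetLike.mem_coe, Ideal.mem_span_singleton]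
      rcases hz with rfl | rfl | rfl | rfl
      · exact dvd_mul_right _ _
      · exact dvd_mul_right _ _
      · exact dvd_mul_left _ _
      · exact hdvd
    · have h3 : a * (p * p) + b * (p * x) + c * (x * x) ∈
          Ideal.span {(p : 𝓞 K) * p, p * x, x * p, x * x} := by
        refine add_mem (add_mem ?_ ?_) ?_ <;>
          exact Ideal.mul_mem_left _ _ (Ideal.subset_span (by simp))
      rwa [h, ← Ideal.span_singleton_le_iff_mem] at h3
  have hnorm := congrArg Ideal.absNorm hmul
  rw [map_mul, absNorm_span_natCast_of_finrank h2, ← sq] at hnorm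
  exact Nat.pow_left_injective two_ne_zero hnorm

variable (K) in
lemma exists_sq_eq_discr' (h2 : Module.finrank ℚ K = 2) :
    ∃ δ : 𝓞 K, δ ^ 2 = (discr K : 𝓞 K) ∧ Algebra.trace ℤ (𝓞 K) δ = 0 := by
  obtain ⟨δ, h, h'⟩ := exists_sq_eq_discr h2
  refine ⟨δ, h, ?_⟩
  have := Algebra.coe_trace_int δ
  rw [h'] at this
  exact_mod_cast this

lemma trace_int_intCast (h2 : Module.finrank ℚ K = 2) (n : ℤ) :
    Algebra.trace ℤ (𝓞 K) (n : 𝓞 K) = 2 * n := by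
  have := Algebra.trace_algebraMap (S := 𝓞 K) n
  rw [RingOfIntegers.rank, h2] at this
  simpa using this

lemma exists_half (δ : 𝓞 K) {m : ℤ} (h : δ ^ 2 = ((4 * m : ℤ) : 𝓞 K)) :
    ∃ μ : 𝓞 K, δ = 2 * μ ∧ μ ^ 2 = m := by
  have h1 : (algebraMap (𝓞 K) K δ / 2) ^ 2 = m := by
    rw [div_pow, ← map_pow, h, map_intCast]
    push_cast
    ring
  have hint : IsIntegral ℤ (algebraMap (𝓞 K) K δ / 2) := by
    refine IsIntegral.of_pow two_pos ?_
    rw [h1]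
    exact isIntegral_algebraMap (R := ℤ) (x := m)
  obtain ⟨y, hy⟩ := IsIntegralClosure.isIntegral_iff (A := 𝓞 K).1 hint
  refine ⟨y, ?_, ?_⟩ <;> apply FaithfulSMul.algebraMap_injective (𝓞 K) K
  · rw [map_mul, hy, map_ofNat]
    ring
  · rw [map_pow, hy, h1, map_intCast]

lemma exists_half_add (δ : 𝓞 K) {k : ℤ} (h : δ ^ 2 = ((1 + 4 * k : ℤ) : 𝓞 K)) :
    ∃ ω : 𝓞 K, 1 + δ = 2 * ω ∧ ω * (1 - ω) = -k := by
  have h1 : ((1 + algebraMap (𝓞 K) K δ) / 2) ^ 2 - (1 + algebraMap (𝓞 K) K δ) / 2 - k = 0 := by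
    have h3 := congrArg (algebraMap (𝓞 K) K) h
    rw [map_pow, map_intCast] at h3
    push_cast at h3
    linear_combination h3 / 4
  have hint : IsIntegral ℤ ((1 + algebraMap (𝓞 K) K δ) / 2) := by
    refine ⟨Polynomial.X ^ 2 - Polynomial.X - Polynomial.C k, by monicity!, ?_⟩
    simp only [Polynomial.eval₂_sub, Polynomial.eval₂_pow, Polynomial.eval₂_X, Polynomial.eval₂_C]
    simpa using h1
  obtain ⟨y, hy⟩ := IsIntegralClosure.isIntegral_iff (A := 𝓞 K).1 hint
  refine ⟨y, ?_, ?_⟩ <;> apply FaithfulSMul.algebraMap_injective (𝓞 K) K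
  · rw [map_mul, hy, map_ofNat, map_add, map_one]
    ring
  · rw [map_mul, map_sub, map_one, hy, map_neg, map_intCast]
    linear_combination -h1

variable {χ : DirichletCharacter ℂ (discr K).natAbs}

/-- Primes at which the Kronecker character is `1` split. -/
lemma exists_coprime_of_apply_eq_one (h2 : Module.finrank ℚ K = 2)
    (hχ : IsOddKroneckerChar (discr K) χ) {p : ℕ} (hp : p.Prime)
    (h : χ (p : ZMod (discr K).natAbs) = 1) :
    ∃ P Q : Ideal (𝓞 K), P.absNorm = p ∧ Q.absNorm = p ∧ IsCoprime P Q := by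
  obtain ⟨δ, hδ, htr⟩ := exists_sq_eq_discr' K h2
  rcases eq_or_ne p 2 with rfl | hp2
  · have h8 := hχ.mod_eight h
    obtain ⟨k, hk⟩ : ∃ k : ℤ, discr K = 1 + 4 * (2 * k) := ⟨discr K / 8, by omega⟩
    rw [hk] at hδ
    obtain ⟨ω, hω, hω'⟩ := exists_half_add δ hδ
    have htω : Algebra.trace ℤ (𝓞 K) ω = 1 := by
      have h3 := congrArg (Algebra.trace ℤ (𝓞 K)) hω
      have h4 := trace_int_intCast h2 1
      rw [Int.cast_one] at h4
      rw [map_add, htr, h4, two_mul ω, map_add] at h3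
      omega
    refine exists_coprime_absNorm_eq h2 hp (x := ω) (y := 1 - ω) (t := 1) (by simp) htω ?_
      (by norm_num) ⟨-k, by rw [hω']; push_cast; ring⟩
    have h4 := trace_int_intCast h2 1
    rw [Int.cast_one] at h4
    rw [map_sub, h4, htω]
    norm_num
  · have : Fact p.Prime := ⟨hp⟩
    have hpD : ¬ (p : ℤ) ∣ discr K := fun hd ↦ by
      rw [DirichletCharacter.apply_natCast_eq_zero hp (Int.natCast_dvd.1 hd)] at h
      exact zero_ne_one h
    have h3 := hχ.isKroneckerChar p hp hp2 hpD
    rw [h] at h3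
    have h4 : legendreSym p (discr K) = 1 := by exact_mod_cast h3.symm
    obtain ⟨a, ha⟩ := (legendreSym.eq_one_iff p
      (by rwa [Ne, ZMod.intCast_zmod_eq_zero_iff_dvd])).1 h4
    obtain ⟨a, rfl⟩ := ZMod.intCast_surjective a
    rw [← Int.cast_mul, ZMod.intCast_eq_intCast_iff_dvd_sub] at ha
    obtain ⟨k, hk⟩ := ha
    refine exists_coprime_absNorm_eq h2 hp (x := a - δ) (y := a + δ) (t := 2 * a)
      (by push_cast; ring) ?_ ?_ ?_ ⟨k, ?_⟩
    · rw [map_sub, trace_int_intCast h2, htr, sub_zero]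
    · rw [map_add, trace_int_intCast h2, htr, add_zero]
    · intro hd
      have h5 := (Nat.prime_iff_prime_int.1 hp).dvd_or_dvd hd
      rcases h5 with h5 | h5
      · exact hp2 ((Nat.prime_dvd_prime_iff_eq hp Nat.prime_two).1 (by exact_mod_cast h5))
      · apply hpD
        rw [show discr K = a * a - p * k by linarith]
        exact dvd_sub (h5.mul_left _) (dvd_mul_right _ _)
    · have h5 := congrArg (Int.cast : ℤ → 𝓞 K) hk
      push_cast at h5
      rw [← h5, ← hδ]
      ring

/-- Primes dividing a fundamental discriminant are norms of ideals. -/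
lemma exists_absNorm_eq_of_dvd (h2 : Module.finrank ℚ K = 2)
    (hD : IsFundamentalDiscriminant (discr K)) {p : ℕ} (hp : p.Prime) (hpD : (p : ℤ) ∣ discr K) :
    ∃ P : Ideal (𝓞 K), P.absNorm = p := by
  obtain ⟨δ, hδ, -⟩ := exists_sq_eq_discr' K h2
  rcases eq_or_ne p 2 with rfl | hp2
  · obtain ⟨-, ⟨h1, -⟩ | ⟨m, h1, -, hm⟩⟩ := hD
    · omega
    · rw [h1] at hδ
      obtain ⟨μ, -, hμ⟩ := exists_half δ hδ
      rcases hm with hm | hm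
      · obtain ⟨j, rfl⟩ : ∃ j, m = 4 * j + 2 := ⟨m / 4, by omega⟩
        push_cast at hμ
        exact exists_absNorm_eq_of_sq h2 (x := μ) (a := -j) (b := 0) (c := 1)
          ⟨2 * j + 1, by rw [← sq, hμ]; push_cast; ring⟩
          (by push_cast; linear_combination hμ)
      · obtain ⟨j, rfl⟩ : ∃ j, m = 4 * j + 3 := ⟨m / 4, by omega⟩
        push_cast at hμ
        exact exists_absNorm_eq_of_sq h2 (x := 1 + μ) (a := -j) (b := -1) (c := 1)
          ⟨2 * j + 2 + μ, by push_cast; linear_combination hμ⟩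
          (by push_cast; linear_combination hμ)
  · obtain ⟨k, hk⟩ := hpD
    have hpk : ¬ (p : ℤ) ∣ k := by
      rintro ⟨l, rfl⟩
      have hpi := Nat.prime_iff_prime_int.1 hp
      obtain ⟨-, ⟨-, h1⟩ | ⟨m, h1, h3, -⟩⟩ := hD
      · exact hpi.not_isUnit (h1 p ⟨l, by rw [hk]; ring⟩)
      · have h4 : IsCoprime ((p : ℤ) * p) 4 := by
          have h5 : IsCoprime (p : ℤ) 2 :=
            Nat.isCoprime_iff_coprime.2 ((Nat.coprime_primes hp Nat.prime_two).2 hp2)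
          exact (h5.mul_left h5).mul_right (h5.mul_left h5)
        refine hpi.not_isUnit (h3 p (h4.dvd_of_dvd_mul_left ⟨l, ?_⟩))
        rw [← h1, hk]
        ring
    obtain ⟨u, v, huv⟩ := (Nat.prime_iff_prime_int.1 hp).coprime_iff_not_dvd.2 hpk
    have h3 := congrArg (Int.cast : ℤ → 𝓞 K) huv
    rw [hk] at hδ
    push_cast at h3 hδ
    exact exists_absNorm_eq_of_sq h2 (x := δ) (a := u) (b := 0) (c := v)
      ⟨k, by rw [← hδ]; ring⟩ (by linear_combination v * hδ + p * h3)

end NumberField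

namespace NumberField

variable {K : Type*} [Field K] [NumberField K]

variable (K) in
/-- The number of ideals of norm `n`. -/
noncomputable def idealCount (n : ℕ) : ℕ :=
  Nat.card {I : Ideal (𝓞 K) // I.absNorm = n}

lemma le_idealCount {n m : ℕ} (f : Fin n → Ideal (𝓞 K)) (hf : Function.Injective f)
    (h : ∀ i, (f i).absNorm = m) : n ≤ idealCount K m := by
  have : Finite {I : Ideal (𝓞 K) // I.absNorm = m} := Ideal.finite_setOfPred_absNorm_eq m
  simpa [idealCount] using Nat.card_le_card_of_injective
    (fun i ↦ (⟨f i, h i⟩ : {I : Ideal (𝓞 K) // I.absNorm = m}))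
    fun i j hij ↦ hf (congrArg (Subtype.val) hij : (f i : Ideal (𝓞 K)) = f j)

lemma sup_span_absNorm {I J : Ideal (𝓞 K)} (h : I.absNorm.Coprime J.absNorm) :
    I * J ⊔ Ideal.span {(I.absNorm : 𝓞 K)} = I := by
  apply le_antisymm
  · exact sup_le Ideal.mul_le_left ((Ideal.span_singleton_le_iff_mem _).2 (Ideal.absNorm_mem I))
  · intro x hx
    obtain ⟨u, v, huv⟩ := Nat.isCoprime_iff_coprime.2 h
    have h3 := congrArg (Int.cast : ℤ → 𝓞 K) huv
    push_cast at h3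
    rw [← mul_one x, ← h3, mul_add, add_comm]
    refine Submodule.add_mem_sup ?_ ?_
    · exact Ideal.mul_mem_mul hx (Ideal.mul_mem_left _ _ (Ideal.absNorm_mem J))
    · exact Ideal.mul_mem_left _ _ (Ideal.mul_mem_left _ _ (Ideal.mem_span_singleton_self _))

lemma idealCount_mul_le {m n : ℕ} (h : m.Coprime n) :
    idealCount K m * idealCount K n ≤ idealCount K (m * n) := by
  have : Finite {I : Ideal (𝓞 K) // I.absNorm = m * n} := Ideal.finite_setOfPred_absNorm_eq _
  rw [idealCount, idealCount, ← Nat.card_prod]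
  refine Nat.card_le_card_of_injective (fun x ↦ (⟨x.1.1 * x.2.1, by
    rw [map_mul, x.1.2, x.2.2]⟩ : {I : Ideal (𝓞 K) // I.absNorm = m * n})) ?_
  rintro ⟨⟨I, rfl⟩, ⟨J, rfl⟩⟩ ⟨⟨I', hI⟩, ⟨J', hJ⟩⟩ hij
  have hij : I * J = I' * J' := congrArg Subtype.val hij
  have h1 : I = I' := by
    rw [← sup_span_absNorm h, hij, ← hI, sup_span_absNorm (by rwa [hI, hJ])]
  have h2 : J = J' := by
    rw [← sup_span_absNorm h.symm, mul_comm, hij, ← hJ, mul_comm I', sup_span_absNorm]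
    rw [hI, hJ]
    exact h.symm
  subst h1 h2
  rfl

lemma le_idealCount_of_isCoprime {p : ℕ} (hp : p.Prime) {P Q : Ideal (𝓞 K)} (hP : P.absNorm = p)
    (hQ : Q.absNorm = p) (hPQ : IsCoprime P Q) (k : ℕ) : k + 1 ≤ idealCount K (p ^ k) := by
  have hP0 : P ≠ ⊥ := by
    rintro rfl
    simp only [Ideal.absNorm_bot] at hP
    exact hp.ne_zero hP.symm
  have key {i j : ℕ} (hi : i ≤ k) (hj : j ≤ k) (h : P ^ i * Q ^ (k - i) = P ^ j * Q ^ (k - j)) :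
      i ≤ j := by
    have h1 : P ^ i ∣ P ^ j :=
      (hPQ.pow (m := i) (n := k - j)).dvd_of_dvd_mul_right (h ▸ dvd_mul_right _ _)
    have h2 := Ideal.absNorm_dvd_absNorm_of_le (Ideal.le_of_dvd h1)
    rw [map_pow, map_pow, hP] at h2
    exact (Nat.pow_dvd_pow_iff_le_right hp.one_lt).1 h2
  refine le_idealCount (fun i : Fin (k + 1) ↦ P ^ (i : ℕ) * Q ^ (k - i)) (fun i j h ↦ ?_)
    fun i ↦ ?_
  · exact Fin.ext (le_antisymm (key (by omega) (by omega) h) (key (by omega) (by omega) h.symm))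
  · rw [map_mul, map_pow, map_pow, hP, hQ, ← pow_add]
    congr 1
    omega

variable {χ : DirichletCharacter ℂ (discr K).natAbs}

open scoped ComplexOrder

lemma zetaMul_prime_pow_le_idealCount (h2 : Module.finrank ℚ K = 2)
    (hD : IsFundamentalDiscriminant (discr K)) (hχ : IsOddKroneckerChar (discr K) χ) {p : ℕ}
    (hp : p.Prime) (k : ℕ) : χ.zetaMul (p ^ k) ≤ idealCount K (p ^ k) := by
  simp only [DirichletCharacter.zetaMul, ArithmeticFunction.coe_zeta_mul_apply,
    Nat.sum_divisors_prime_pow hp, DirichletCharacter.toArithmeticFunction_apply_prime_pow χ hp]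
  rcases DirichletCharacter.apply_mem_of_sq hχ.sq_eq_one p with h | h | h
  · have hpD : (p : ℤ) ∣ discr K := by
      by_contra hpD
      exact DirichletCharacter.apply_natCast_ne_zero hp (fun h3 ↦ hpD (Int.natCast_dvd.2 h3)) χ h
    obtain ⟨P, hP⟩ := exists_absNorm_eq_of_dvd h2 hD hp hpD
    have := le_idealCount (fun _ : Fin 1 ↦ P ^ k) (fun _ _ _ ↦ Subsingleton.elim _ _)
      (m := p ^ k) fun _ ↦ by rw [map_pow, hP]
    simp only [h, Finset.sum_range_succ', pow_zero, ne_eq, Nat.add_eq_zero_iff, one_ne_zero,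
      and_false, not_false_eq_true, zero_pow, Finset.sum_const_zero, zero_add]
    exact_mod_cast this
  · obtain ⟨P, Q, hP, hQ, hPQ⟩ := exists_coprime_of_apply_eq_one h2 hχ hp h
    have := le_idealCount_of_isCoprime hp hP hQ hPQ k
    simp only [h, one_pow, Finset.sum_const, Finset.card_range, nsmul_eq_mul, mul_one]
    exact_mod_cast this
  · simp only [h, neg_one_geom_sum]
    split_ifs with hk
    · exact_mod_cast Nat.zero_le _
    · obtain ⟨j, rfl⟩ : ∃ j, k = 2 * j := ⟨k / 2, by
        rw [Nat.even_add_one, not_not, Nat.even_iff] at hk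
        omega⟩
      have := le_idealCount (fun _ : Fin 1 ↦ Ideal.span {(p : 𝓞 K)} ^ j)
        (fun _ _ _ ↦ Subsingleton.elim _ _) (m := p ^ (2 * j)) fun _ ↦ by
          rw [map_pow, absNorm_span_natCast_of_finrank h2, pow_mul]
      exact_mod_cast this

lemma zetaMul_le_idealCount (h2 : Module.finrank ℚ K = 2)
    (hD : IsFundamentalDiscriminant (discr K)) (hχ : IsOddKroneckerChar (discr K) χ) (n : ℕ) :
    χ.zetaMul n ≤ idealCount K n := by
  induction n using Nat.recOnPosPrimePosCoprime with
  | zero => simp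
  | one => simpa using zetaMul_prime_pow_le_idealCount h2 hD hχ Nat.prime_two 0
  | prime_pow p k hp _ => exact zetaMul_prime_pow_le_idealCount h2 hD hχ hp k
  | coprime a b _ _ hab ha hb =>
    rw [χ.isMultiplicative_zetaMul.map_mul_of_coprime hab]
    calc χ.zetaMul a * χ.zetaMul b ≤ idealCount K a * idealCount K b :=
          mul_le_mul ha hb (DirichletCharacter.zetaMul_nonneg hχ.sq_eq_one b)
            (by exact_mod_cast Nat.zero_le _)
      _ ≤ idealCount K (a * b) := by exact_mod_cast idealCount_mul_le hab

/-- The residue of the Dedekind zeta function of an imaginary quadratic field bounds `L(1, χ)`. -/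
lemma realL_one_le_dedekindZeta_residue (h2 : Module.finrank ℚ K = 2)
    (hD : IsFundamentalDiscriminant (discr K)) (hχ : IsOddKroneckerChar (discr K) χ)
    [NeZero (discr K).natAbs] (hr : χ.IsRealPrimitive) :
    χ.realL 1 ≤ dedekindZeta_residue K := by
  have hre : Tendsto (fun s : ℝ ↦ (((s - 1 : ℝ) : ℂ) * dedekindZeta K s).re) (𝓝[>] 1)
      (𝓝 (dedekindZeta_residue K)) := by
    have := (continuous_re.tendsto _).comp (tendsto_sub_one_mul_dedekindZeta_nhdsGT K)
    simpa [Function.comp_def] using this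
  have hz : Tendsto (fun s : ℝ ↦ (((s - 1 : ℝ) : ℂ) * (riemannZeta s * χ.LFunction s)).re) (𝓝[>] 1)
      (𝓝 (χ.realL 1)) := by
    have h1 : Tendsto (fun s : ℝ ↦ (s : ℂ)) (𝓝[>] 1) (𝓝[≠] 1) := by
      refine tendsto_nhdsWithin_iff.2 ⟨?_, ?_⟩
      · exact (continuous_ofReal.tendsto 1).mono_left nhdsWithin_le_nhds
      · filter_upwards [self_mem_nhdsWithin] with s hs
        exact ofReal_ne_one.2 (ne_of_gt hs)
    have h3 := (riemannZeta_residue_one.mul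
      (((DirichletCharacter.differentiable_LFunction hr.ne_one).continuous.tendsto 1).mono_left
        nhdsWithin_le_nhds)).comp h1
    have h4 := (continuous_re.tendsto _).comp h3
    rw [one_mul] at h4
    refine h4.congr fun s ↦ ?_
    simp [Function.comp_def, mul_assoc]
  refine le_of_tendsto_of_tendsto hz hre ?_
  filter_upwards [self_mem_nhdsWithin,
    hre.eventually_ne (dedekindZeta_residue_pos K).ne'] with s hs hne
  have hs1 : 1 < (s : ℂ).re := by simpa using hs
  have hs0 : 0 < s - 1 := sub_pos.2 hs
  have hsum : LSeriesSummable (fun n ↦ (idealCount K n : ℂ)) s := by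
    by_contra h
    apply hne
    have : dedekindZeta K s = 0 := tsum_eq_zero_of_not_summable h
    rw [this, mul_zero, zero_re]
  have h3 := (hasSum_re_lseries (a := fun n ↦ (idealCount K n : ℂ)) (by simp)
    (by linarith : s ≠ 0) hsum).1
  have h4 := (hasSum_re_lseries (a := χ.zetaMul) (fun n ↦
    (Complex.nonneg_iff.1 (DirichletCharacter.zetaMul_nonneg hχ.sq_eq_one n)).2.symm)
    (by linarith : s ≠ 0) (DirichletCharacter.LSeriesSummable_zetaMul χ hs1)).1
  rw [DirichletCharacter.lseries_zetaMul χ hs1] at h4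
  have h5 := hasSum_le (fun n ↦ mul_le_mul_of_nonneg_right
    (Complex.le_def.1 (zetaMul_le_idealCount h2 hD hχ n)).1 (by positivity)) h4 h3
  rw [re_ofReal_mul, re_ofReal_mul]
  exact mul_le_mul_of_nonneg_left h5 hs0.le

/-- The class number of an imaginary quadratic field is at least `√|D| L(1, χ) / π`. -/
lemma sqrt_mul_realL_one_le_classNumber (h2 : Module.finrank ℚ K = 2)
    (hD : IsFundamentalDiscriminant (discr K)) (hneg : discr K < 0)
    (hχ : IsOddKroneckerChar (discr K) χ)
    [NeZero (discr K).natAbs] (hr : χ.IsRealPrimitive) :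
    √|(discr K : ℝ)| * χ.realL 1 / Real.pi ≤ classNumber K := by
  have h3 := (realL_one_le_dedekindZeta_residue h2 hD hχ hr).trans
    (dedekindZeta_residue_le K h2 hneg)
  have h4 : 0 < √|(discr K : ℝ)| :=
    Real.sqrt_pos.2 (abs_pos.2 (Int.cast_ne_zero.2 (discr_ne_zero K)))
  rw [le_div_iff₀ h4] at h3
  rw [div_le_iff₀ Real.pi_pos]
  linarith

end NumberField

lemma mul_exp_neg_anti {y z : ℝ} (hy : 1 ≤ y) (hyz : y ≤ z) :
    z * Real.exp (-z) ≤ y * Real.exp (-y) := by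
  have h := mul_le_mul_of_nonneg_right
    (one_add_mul_exp_neg_anti (y := y - 1) (z := z - 1) (by linarith) (by linarith))
    (Real.exp_pos (-1)).le
  rwa [mul_assoc, mul_assoc, ← Real.exp_add, ← Real.exp_add, add_sub_cancel, add_sub_cancel,
    show -(z - 1) + -1 = -z by ring, show -(y - 1) + -1 = -y by ring] at h

lemma le_log_ten_pow_six : 13.8 ≤ Real.log (10 ^ 6) := by
  rw [Real.le_log_iff_exp_le (by norm_num)]
  refine le_of_pow_le_pow_left₀ (n := 5) (by norm_num) (by norm_num) ?_
  rw [← Real.exp_nat_mul, show ((5 : ℕ) : ℝ) * 13.8 = (69 : ℕ) * 1 by norm_num, Real.exp_nat_mul]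
  calc Real.exp 1 ^ 69 ≤ 2.7182818286 ^ 69 := by gcongr; exact Real.exp_one_lt_d9.le
    _ ≤ (10 ^ 6) ^ 5 := by norm_num

/-- The lower bound for `L(1, χ)` in Chen's theorem. -/
noncomputable def chenBound (A d : ℝ) : ℝ :=
  min (1 / (7.732 * Real.log d)) (1.5 * 10 ^ 6 * (1 / Real.log A) / d ^ ((1 : ℝ) / Real.log A))

section

variable {A d : ℝ}

lemma rpow_one_div_log (hd : 0 < d) :
    d ^ ((1 : ℝ) / Real.log A) = Real.exp (Real.log d / Real.log A) := by
  rw [Real.rpow_def_of_pos hd, mul_one_div]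

lemma sqrt_mul_chenBound_div_pi (hd : 1 < d) :
    min (Real.sqrt d / (Real.pi * 7.732 * Real.log d))
      ((Real.log d / Real.log A) * (1.5 * 10 ^ 6) * Real.sqrt d /
        (Real.pi * Real.exp (Real.log d / Real.log A) * Real.log d)) =
      √d * chenBound A d / Real.pi := by
  have hl : 0 < Real.log d := Real.log_pos hd
  have hpi := Real.pi_pos
  rw [chenBound, mul_min_of_nonneg _ _ (Real.sqrt_nonneg d), ← min_div_div_right hpi.le,
    rpow_one_div_log (by linarith)]
  generalize Real.log A = a
  generalize (7.732 : ℝ) = c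
  congr 1
  · rw [mul_one_div, div_div]
    ring
  · field_simp

lemma mul_log_lt_of_lt_chenBound (hd : 1 < d) {L : ℝ} (hL : L < chenBound A d) :
    L * Real.log d < 0.12934 ∧ L * Real.log d <
      1500000 * (Real.log d / Real.log A * Real.exp (-(Real.log d / Real.log A))) := by
  have hl : 0 < Real.log d := Real.log_pos hd
  rw [chenBound, lt_min_iff, rpow_one_div_log (by linarith)] at hL
  constructor
  · refine (mul_lt_mul_of_pos_right hL.1 hl).trans ?_
    rw [one_div, mul_inv, mul_assoc, inv_mul_cancel₀ hl.ne']
    norm_num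
  · refine (mul_lt_mul_of_pos_right hL.2 hl).trans_eq ?_
    rw [Real.exp_neg]
    ring

end

section

variable {A : ℝ} {D : ℤ}

lemma chen_bound_of_realL [NeZero D.natAbs] (hD : IsFundamentalDiscriminant D) (hneg : D < 0)
    (hd : 1 < |(D : ℝ)|) {χ : DirichletCharacter ℂ D.natAbs} (hχ : IsOddKroneckerChar D χ)
    (h : chenBound A |(D : ℝ)| ≤ χ.realL 1) :
    (∀ χ : DirichletCharacter ℂ D.natAbs, IsKroneckerChar D χ →
      chenBound A |(D : ℝ)| ≤ (LFunc χ 1).re) ∧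
    ∀ (K : Type) [Field K] [NumberField K], Module.finrank ℚ K = 2 → NumberField.discr K = D →
      √|(D : ℝ)| * chenBound A |(D : ℝ)| / Real.pi ≤ NumberField.classNumber K := by
  refine ⟨fun ψ hψ ↦ ?_, fun K _ _ h2 hK ↦ ?_⟩
  · rw [IsKroneckerChar.unique hneg hψ hχ.isKroneckerChar, LFunc, dif_neg (NeZero.ne _)]
    exact h
  · subst hK
    have hpi := Real.pi_pos
    refine le_trans ?_
      (NumberField.sqrt_mul_realL_one_le_classNumber h2 hD hneg hχ hχ.isRealPrimitive)
    gcongr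

lemma not_realL_lt_chenBound {D₁ D₂ : ℤ} [NeZero D₁.natAbs] [NeZero D₂.natAbs]
    (hA : (10 : ℝ) ^ 6 ≤ A) (hA1 : A ≤ |(D₁ : ℝ)|) (h12 : D₁.natAbs < D₂.natAbs)
    {χ₁ : DirichletCharacter ℂ D₁.natAbs} {χ₂ : DirichletCharacter ℂ D₂.natAbs}
    (hχ1 : IsOddKroneckerChar D₁ χ₁) (hχ2 : IsOddKroneckerChar D₂ χ₂)
    (h1 : χ₁.realL 1 < chenBound A |(D₁ : ℝ)|) : ¬ χ₂.realL 1 < chenBound A |(D₂ : ℝ)| := by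
  intro h2
  have e1 : |(D₁ : ℝ)| = (D₁.natAbs : ℝ) := by rw [Nat.cast_natAbs, Int.cast_abs]
  have e2 : |(D₂ : ℝ)| = (D₂.natAbs : ℝ) := by rw [Nat.cast_natAbs, Int.cast_abs]
  rw [e1] at h1 hA1
  rw [e2] at h2
  have hlt : (D₁.natAbs : ℝ) < D₂.natAbs := by exact_mod_cast h12
  have hd1 : (1 : ℝ) < D₁.natAbs := by linarith [show (1 : ℝ) < 10 ^ 6 by norm_num]
  have h1 := mul_log_lt_of_lt_chenBound hd1 h1
  have h2 := mul_log_lt_of_lt_chenBound (hd1.trans hlt) h2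
  have hlA : 13.8 ≤ Real.log A :=
    le_log_ten_pow_six.trans (Real.log_le_log (by norm_num) hA)
  have hA0 : 0 < Real.log A := lt_of_lt_of_le (by norm_num) hlA
  have hAl : Real.log A ≤ Real.log D₁.natAbs :=
    Real.log_le_log (lt_of_lt_of_le (by norm_num) hA) hA1
  have hl1 : 0 < Real.log D₁.natAbs := hA0.trans_le hAl
  have hl12 : Real.log D₁.natAbs ≤ Real.log D₂.natAbs := Real.log_le_log (by linarith) hlt.le
  obtain ⟨N₃, _, χ₃, hr3, he3, hN3, hp⟩ := hχ1.isRealPrimitive.exists_product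
    hχ2.isRealPrimitive hχ1.odd hχ2.odd h12.ne
  rcases DirichletCharacter.le_realL_one_of_small hχ1.isRealPrimitive hχ2.isRealPrimitive hr3
    hχ1.odd hχ2.odd he3 hp hN3 h12.le (hlA.trans hAl) h1.1.le with h | h
  · exact absurd h2.1 (not_lt.2 h)
  · refine absurd h2.2 (not_lt.2 (le_trans ?_ h))
    rw [mul_assoc]
    refine mul_le_mul_of_nonneg_left (mul_exp_neg_anti ?_ ?_) (by norm_num)
    · rwa [one_le_div hl1]
    · exact div_le_div_of_nonneg_left (hl1.le.trans hl12) hA0 hAl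

end

end

/-- (Chen) Let `A ≥ 10^6` and `ε = 1/log A`. For all fundamental discriminants `D < 0` with
`|D| ≥ A`, with at most one exception, one has
`L(1, χ_D) ≥ min(1/(7.732 log|D|), 1.5·10^6 ε/|D|^ε)` and, with `m = log|D|/log A`,
`h(D) ≥ min(√|D|/(π·7.732·log|D|), m·1.5·10^6·√|D|/(π e^m log|D|))`. -/
theorem chen_bound (A : ℝ) (hA : (10 : ℝ) ^ 6 ≤ A) :
    {D : ℤ | IsFundamentalDiscriminant D ∧ D < 0 ∧ A ≤ |(D : ℝ)| ∧
      ¬ ((∀ χ : DirichletCharacter ℂ D.natAbs, IsKroneckerChar D χ →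
            min (1 / (7.732 * Real.log |(D : ℝ)|))
              (1.5 * 10 ^ 6 * (1 / Real.log A) / |(D : ℝ)| ^ ((1 : ℝ) / Real.log A))
              ≤ (LFunc χ 1).re) ∧
         ∀ (K : Type) [Field K] [NumberField K], Module.finrank ℚ K = 2 →
           NumberField.discr K = D →
             min (Real.sqrt |(D : ℝ)| / (Real.pi * 7.732 * Real.log |(D : ℝ)|))
               ((Real.log |(D : ℝ)| / Real.log A) * (1.5 * 10 ^ 6) * Real.sqrt |(D : ℝ)| /
                 (Real.pi * Real.exp (Real.log |(D : ℝ)| / Real.log A) * Real.log |(D : ℝ)|))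
               ≤ (NumberField.classNumber K : ℝ))}.Subsingleton := by
  have key {D : ℤ} [NeZero D.natAbs] (hd : 1 < |(D : ℝ)|) {χ : DirichletCharacter ℂ D.natAbs}
      (hD : IsFundamentalDiscriminant D) (hneg : D < 0) (hχ : IsOddKroneckerChar D χ) :=
    not_imp_not.2 (chen_bound_of_realL (A := A) hD hneg hd hχ)
  intro D₁ ⟨hD1, hneg1, hA1, hv1⟩ D₂ ⟨hD2, hneg2, hA2, hv2⟩
  have hd1 : 1 < |(D₁ : ℝ)| := by linarith [show (1 : ℝ) < 10 ^ 6 by norm_num]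
  have hd2 : 1 < |(D₂ : ℝ)| := by linarith [show (1 : ℝ) < 10 ^ 6 by norm_num]
  have : NeZero D₁.natAbs := ⟨by omega⟩
  have : NeZero D₂.natAbs := ⟨by omega⟩
  obtain ⟨χ₁, hχ1⟩ := hD1.exists_isOddKroneckerChar hneg1
  obtain ⟨χ₂, hχ2⟩ := hD2.exists_isOddKroneckerChar hneg2
  simp only [sqrt_mul_chenBound_div_pi hd1] at hv1
  simp only [sqrt_mul_chenBound_div_pi hd2] at hv2
  have hL1 := not_le.1 (key hd1 hD1 hneg1 hχ1 hv1)
  have hL2 := not_le.1 (key hd2 hD2 hneg2 hχ2 hv2)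
  rcases lt_trichotomy D₁.natAbs D₂.natAbs with h | h | h
  · exact absurd hL2 (not_realL_lt_chenBound hA hA1 h hχ1 hχ2 hL1)
  · omega
  · exact absurd hL1 (not_realL_lt_chenBound hA hA2 h hχ2 hχ1 hL2)
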